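/- arXiv:1302.4117 — 2 statements merged into one kernel-verified Lean document; each statement's English description precedes it below -/
import Mathlib

section
/- Let d ≥ 1 be an integer, let q₁,…,q_d be multiplicatively independent integers ≥ 2, let c_{q_1},…,c_{q_d} be nonzero complex numbers and c₁ ∈ ℂ with Re c₁ − ∑_{j=1}^d |c_{q_j}| = 1/2, and set φ(s) = c₁ + ∑_{j=1}^d c_{q_j} q_j^{−s}. Then the composition operator C_φ is bounded on ℋ² and there exist constants c, C > 0 such that c·n^{−(d−1)/2} ≤ a_n(C_φ) ≤ C·(n/log n)^{−(d−1)/2} for all n ≥ 2. -/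
open Complex Filter MeasureTheory

noncomputable section

/-- The Hilbert space `ℋ²` of Dirichlet series with square-summable coefficients,
modeled by its coefficient sequences (indexed by `ℕ+`). -/
abbrev H2 := ↥(lp (fun _ : ℕ+ => ℂ) 2)

/-- The Dirichlet series attached to an element of `ℋ²`; it converges on `Re s > 1/2`. -/
noncomputable def H2series (x : H2) (s : ℂ) : ℂ := ∑' n : ℕ+, x n * (n : ℂ) ^ (-s)

/-- `T` is (the bounded operator realizing) the composition operator `C_φ` on `ℋ²`:
for every `f ∈ ℋ²`, the Dirichlet series of `T f` agrees with `f ∘ φ` on `ℂ_{1/2}`. -/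
def IsCompOp (φ : ℂ → ℂ) (T : H2 →L[ℂ] H2) : Prop :=
  ∀ (x : H2) (s : ℂ), 1 / 2 < s.re → H2series (T x) s = H2series x (φ s)

/-- The `n`-th approximation number of a bounded operator: the distance in operator
norm to the operators of rank `< n`. -/
noncomputable def approxNumber {E F : Type*} [NormedAddCommGroup E] [NormedSpace ℂ E]
    [NormedAddCommGroup F] [NormedSpace ℂ F] (T : E →L[ℂ] F) (n : ℕ) : ℝ :=
  sInf {c : ℝ | ∃ R : E →L[ℂ] F,
    FiniteDimensional ℂ (LinearMap.range (R : E →ₗ[ℂ] F)) ∧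
    Module.finrank ℂ (LinearMap.range (R : E →ₗ[ℂ] F)) < n ∧ c = ‖T - R‖}

/-- The positive integers `q j ≥ 2` are multiplicatively independent. -/
def MultIndep {d : ℕ} (q : Fin d → ℕ) : Prop :=
  ∀ α β : Fin d → ℕ, ∏ j, q j ^ α j = ∏ j, q j ^ β j → α = β

lemma HasSum.congr_of_eq {ι E : Type*} [AddCommMonoid E] [TopologicalSpace E] {f g : ι → E}
    {a b : E} (h : HasSum f a) (hfg : ∀ i, f i = g i) (hab : a = b) : HasSum g b := by
  rwa [← funext hfg, ← hab]

/-- The Poisson weights `e^{-l} l^k / k!`. -/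
def poissonWeight (l : ℝ) (k : ℕ) : ℝ := Real.exp (-l) * (l ^ k / k.factorial)

lemma poissonWeight_nonneg {l : ℝ} (hl : 0 ≤ l) (k : ℕ) : 0 ≤ poissonWeight l k := by
  unfold poissonWeight; positivity

lemma hasSum_poissonWeight (l : ℝ) : HasSum (poissonWeight l) 1 := by
  have h : HasSum (fun k : ℕ => l ^ k / k.factorial) (Real.exp l) := by
    rw [Real.exp_eq_exp_ℝ]; exact NormedSpace.expSeries_div_hasSum_exp l
  have h2 := h.mul_left (Real.exp (-l))
  rwa [← Real.exp_add, neg_add_cancel, Real.exp_zero] at h2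

lemma sum_poissonWeight_le_one {l : ℝ} (hl : 0 ≤ l) (s : Finset ℕ) :
    ∑ k ∈ s, poissonWeight l k ≤ 1 :=
  sum_le_hasSum s (fun k _ => poissonWeight_nonneg hl k) (hasSum_poissonWeight l)

lemma poissonWeight_le_one {l : ℝ} (hl : 0 ≤ l) (k : ℕ) : poissonWeight l k ≤ 1 := by
  simpa using sum_poissonWeight_le_one hl {k}

lemma succ_mul_poissonWeight (l : ℝ) (k : ℕ) :
    ((k + 1 : ℕ) : ℝ) * poissonWeight l (k + 1) = l * poissonWeight l k := by
  unfold poissonWeight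
  rw [Nat.factorial_succ]
  push_cast
  field_simp
  ring

lemma hasSum_mul_poissonWeight (l : ℝ) : HasSum (fun k : ℕ => (k : ℝ) * poissonWeight l k) l := by
  rw [← hasSum_nat_add_iff' 1]
  simp_rw [succ_mul_poissonWeight]
  simpa using (hasSum_poissonWeight l).mul_left l

lemma hasSum_sq_mul_poissonWeight (l : ℝ) :
    HasSum (fun k : ℕ => (k : ℝ) ^ 2 * poissonWeight l k) (l ^ 2 + l) := by
  rw [← hasSum_nat_add_iff' 1]
  have h : ∀ k : ℕ, ((k + 1 : ℕ) : ℝ) ^ 2 * poissonWeight l (k + 1)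
      = l * ((k : ℝ) * poissonWeight l k) + l * poissonWeight l k := by
    intro k
    rw [sq, mul_assoc, succ_mul_poissonWeight]
    push_cast; ring
  simp_rw [h]
  have := ((hasSum_mul_poissonWeight l).mul_left l).add ((hasSum_poissonWeight l).mul_left l)
  simpa [sq] using this

/-- The variance of the Poisson distribution. -/
lemma hasSum_variance_poissonWeight (l : ℝ) :
    HasSum (fun k : ℕ => ((k : ℝ) - l) ^ 2 * poissonWeight l k) l := by
  have := ((hasSum_sq_mul_poissonWeight l).sub
    ((hasSum_mul_poissonWeight l).mul_left (2 * l))).add ((hasSum_poissonWeight l).mul_left (l ^ 2))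
  exact this.congr_of_eq (fun k => by ring) (by ring)

lemma sum_abs_sub_mul_poissonWeight_le {l : ℝ} (hl : 0 ≤ l) (s : Finset ℕ) :
    ∑ k ∈ s, poissonWeight l k * |(k : ℝ) - l| ≤ √l := by
  apply Real.le_sqrt_of_sq_le
  calc (∑ k ∈ s, poissonWeight l k * |(k : ℝ) - l|) ^ 2
      ≤ (∑ k ∈ s, poissonWeight l k) * ∑ k ∈ s, ((k : ℝ) - l) ^ 2 * poissonWeight l k := by
        apply Finset.sum_sq_le_sum_mul_sum_of_sq_le_mul
        · exact fun k _ => poissonWeight_nonneg hl k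
        · exact fun k _ => mul_nonneg (sq_nonneg _) (poissonWeight_nonneg hl k)
        · intro k _
          rw [mul_pow, sq_abs]; exact le_of_eq (by ring)
    _ ≤ 1 * l := by
        gcongr
        · exact Finset.sum_nonneg fun k _ => mul_nonneg (sq_nonneg _) (poissonWeight_nonneg hl k)
        · exact sum_poissonWeight_le_one hl s
        · exact sum_le_hasSum s
            (fun k _ => mul_nonneg (sq_nonneg _) (poissonWeight_nonneg hl k))
            (hasSum_variance_poissonWeight l)
    _ = l := one_mul l

lemma poissonWeight_le_inv_sqrt {l : ℝ} (hl : 0 < l) (k : ℕ) : poissonWeight l k ≤ 1 / √l := by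
  have tel : ∀ k : ℕ, ∑ i ∈ Finset.range (k + 1), poissonWeight l i * (l - i)
      = l * poissonWeight l k := by
    intro k
    induction k with
    | zero => simp; ring
    | succ k ih =>
      rw [Finset.sum_range_succ, ih, ← succ_mul_poissonWeight]; ring
  have h1 : l * poissonWeight l k ≤ √l := by
    rw [← tel k]
    refine le_trans (Finset.sum_le_sum fun i _ => ?_)
      (sum_abs_sub_mul_poissonWeight_le hl.le (Finset.range (k + 1)))
    rw [abs_sub_comm]
    exact mul_le_mul_of_nonneg_left (le_abs_self _) (poissonWeight_nonneg hl.le i)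
  rw [le_div_iff₀ (Real.sqrt_pos.2 hl)]
  have h2 : 0 < √l := Real.sqrt_pos.2 hl
  have h3 : √l * √l = l := Real.mul_self_sqrt hl.le
  nlinarith

/-- Chebyshev's inequality for the Poisson distribution, outside an interval. -/
lemma sum_poissonWeight_le_of_far {l t : ℝ} (hl : 0 ≤ l) (ht : 0 < t) (s : Finset ℕ)
    (hs : ∀ k ∈ s, t ≤ |(k : ℝ) - l|) : ∑ k ∈ s, poissonWeight l k ≤ l / t ^ 2 := by
  rw [le_div_iff₀ (by positivity), Finset.sum_mul]
  refine le_trans (Finset.sum_le_sum fun k hk => ?_) (sum_le_hasSum s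
    (fun k _ => mul_nonneg (sq_nonneg _) (poissonWeight_nonneg hl k))
    (hasSum_variance_poissonWeight l))
  rw [mul_comm, ← sq_abs ((k : ℝ) - l)]
  gcongr
  · exact poissonWeight_nonneg hl k
  · exact hs k hk

/-- Chebyshev's inequality for the Poisson distribution, inside an interval. -/
lemma le_sum_poissonWeight_of_near {l t : ℝ} (hl : 0 ≤ l) (ht : 0 < t) (s : Finset ℕ)
    (hs : ∀ k : ℕ, |(k : ℝ) - l| < t → k ∈ s) :
    1 - l / t ^ 2 ≤ ∑ k ∈ s, poissonWeight l k := by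
  have h1 : HasSum (fun k : ℕ => ((k : ℝ) - l) ^ 2 * poissonWeight l k * (t ^ 2)⁻¹)
      (l * (t ^ 2)⁻¹) := (hasSum_variance_poissonWeight l).mul_right _
  have h2 : HasSum (fun k : ℕ => if k ∈ s then poissonWeight l k else 0)
      (∑ k ∈ s, poissonWeight l k) := by
    have := hasSum_sum_of_ne_finset_zero (L := SummationFilter.unconditional ℕ)
      (f := fun k : ℕ => if k ∈ s then poissonWeight l k else 0) (s := s) (fun k hk => by simp [hk])
    exact this.congr_of_eq (fun _ => rfl) (Finset.sum_congr rfl fun k hk => by simp [hk])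
  have h3 : (1 : ℝ) ≤ ∑ k ∈ s, poissonWeight l k + l * (t ^ 2)⁻¹ := by
    refine hasSum_le (fun k => ?_) (hasSum_poissonWeight l) (h2.add h1)
    have hp := poissonWeight_nonneg hl k
    by_cases hk : k ∈ s
    · simp only [hk, if_true]
      have : 0 ≤ ((k : ℝ) - l) ^ 2 * poissonWeight l k * (t ^ 2)⁻¹ := by positivity
      linarith
    · have hfar : t ≤ |(k : ℝ) - l| := not_lt.1 fun h => hk (hs k h)
      simp only [hk, if_false, zero_add]
      rw [← div_eq_mul_inv, le_div_iff₀ (by positivity), mul_comm, ← sq_abs ((k : ℝ) - l)]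
      gcongr
  rw [div_eq_mul_inv]; linarith

/-- The Poisson distribution function in the parameter: its derivative is `-poissonWeight`. -/
lemma hasDerivAt_sum_poissonWeight (k : ℕ) (l : ℝ) :
    HasDerivAt (fun l => ∑ i ∈ Finset.range (k + 1), poissonWeight l i) (-poissonWeight l k) l := by
  have hd : ∀ i : ℕ, HasDerivAt (fun l => poissonWeight l (i + 1))
      (poissonWeight l i - poissonWeight l (i + 1)) l := by
    intro i
    have h1 : HasDerivAt (fun l : ℝ => Real.exp (-l)) (-Real.exp (-l)) l := by
      simpa using (hasDerivAt_neg l).exp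
    have h2 : HasDerivAt (fun l : ℝ => l ^ (i + 1) / (i + 1).factorial)
        (l ^ i / i.factorial) l := by
      refine ((hasDerivAt_pow (i + 1) l).div_const ((i + 1).factorial : ℝ)).congr_deriv ?_
      rw [Nat.factorial_succ]; push_cast; field_simp
    refine (h1.mul h2).congr_deriv ?_
    unfold poissonWeight; ring
  induction k with
  | zero =>
    have h1 : HasDerivAt (fun l : ℝ => Real.exp (-l)) (-Real.exp (-l)) l := by
      simpa using (hasDerivAt_neg l).exp
    simpa [poissonWeight] using h1
  | succ k ih =>
    simp_rw [Finset.sum_range_succ _ (k + 1)]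
    refine (ih.add (hd k)).congr_deriv ?_
    ring

lemma sum_inv_mul_poissonWeight_log_le {r : ℝ} (hr : 0 < r) (k : ℕ) (s : Finset ℕ+) :
    ∑ n ∈ s, (1 / (n : ℝ)) * poissonWeight (r * Real.log n) k ≤ 2 ^ (1 + r) / r := by
  set G : ℝ → ℝ := fun t => ∑ i ∈ Finset.range (k + 1), poissonWeight (r * Real.log t) i with hG
  have hGd : ∀ t : ℝ, 0 < t → HasDerivAt G (-(poissonWeight (r * Real.log t) k) * (r * t⁻¹)) t := by
    intro t ht
    exact (hasDerivAt_sum_poissonWeight k (r * Real.log t)).comp t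
      ((Real.hasDerivAt_log ht.ne').const_mul r)
  have hpw : ∀ t : ℝ, 0 < t → poissonWeight (r * Real.log t) k
      = t ^ (-r) * ((r * Real.log t) ^ k / k.factorial) := by
    intro t ht
    rw [poissonWeight, Real.rpow_def_of_pos ht]; congr 2; ring
  have key : ∀ n : ℕ, 1 ≤ n → (1 / (n : ℝ)) * poissonWeight (r * Real.log n) k
      ≤ (2 ^ (1 + r) / r) * (G n - G (n + 1 : ℕ)) := by
    intro n hn
    have hn0 : (1 : ℝ) ≤ n := by exact_mod_cast hn
    obtain ⟨t, ht, hte⟩ := exists_hasDerivAt_eq_slope G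
      (fun t => -(poissonWeight (r * Real.log t) k) * (r * t⁻¹)) (a := n) (b := (n + 1 : ℕ))
      (by push_cast; linarith)
      (fun t ht => (hGd t (by linarith [ht.1])).continuousAt.continuousWithinAt)
      (fun t ht => hGd t (by linarith [ht.1]))
    push_cast at hte ht
    simp only [add_sub_cancel_left, div_one] at hte
    have ht1 : (n : ℝ) < t := ht.1
    have ht2 : t < 2 * n := by linarith [ht.2]
    have ht0 : 0 < t := by linarith
    have : G n - G (n + 1 : ℕ) = r * (t⁻¹ * poissonWeight (r * Real.log t) k) := by
      push_cast; linarith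
    rw [this, hpw t ht0, hpw n (by linarith)]
    have e1 : t⁻¹ * (t ^ (-r) * ((r * Real.log t) ^ k / k.factorial))
        = t ^ (-(1 + r)) * ((r * Real.log t) ^ k / k.factorial) := by
      rw [← mul_assoc, ← Real.rpow_neg_one, ← Real.rpow_add ht0]; congr 2; ring
    have e2 : 1 / (n : ℝ) * ((n : ℝ) ^ (-r) * ((r * Real.log n) ^ k / k.factorial))
        = (n : ℝ) ^ (-(1 + r)) * ((r * Real.log n) ^ k / k.factorial) := by
      rw [← mul_assoc, one_div, ← Real.rpow_neg_one, ← Real.rpow_add (by linarith)]; congr 2; ring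
    rw [e1, e2]
    have e3 : (2 : ℝ) ^ (1 + r) / r * (r * (t ^ (-(1 + r)) * ((r * Real.log t) ^ k / k.factorial)))
        = (2 ^ (1 + r) * t ^ (-(1 + r))) * ((r * Real.log t) ^ k / k.factorial) := by
      field_simp
    rw [e3]
    have hl0 : 0 ≤ Real.log n := Real.log_nonneg hn0
    have hl1 : Real.log n ≤ Real.log t := Real.log_le_log (by linarith) ht1.le
    gcongr
    have : (2 * (n : ℝ)) ^ (-(1 + r)) ≤ t ^ (-(1 + r)) :=
      Real.rpow_le_rpow_of_nonpos ht0 ht2.le (by linarith)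
    rw [Real.mul_rpow (by norm_num) (by linarith), Real.rpow_neg (by norm_num)] at this
    have h2 : (0 : ℝ) < 2 ^ (1 + r) := by positivity
    calc (n : ℝ) ^ (-(1 + r)) = 2 ^ (1 + r) * ((2 ^ (1 + r))⁻¹ * (n : ℝ) ^ (-(1 + r))) := by
          field_simp
      _ ≤ _ := by gcongr
  have hG0 : ∀ n : ℕ, 0 ≤ G n := fun n => Finset.sum_nonneg fun i _ =>
    poissonWeight_nonneg (mul_nonneg hr.le (Real.log_natCast_nonneg n)) i
  have hG1 : G (1 : ℕ) ≤ 1 := sum_poissonWeight_le_one (by simp) _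
  obtain ⟨K, hK⟩ : ∃ K : ℕ, s.image (fun n : ℕ+ => (n : ℕ)) ⊆ Finset.Ico 1 (K + 1) := by
    refine ⟨s.sup (fun n : ℕ+ => (n : ℕ)), fun m hm => ?_⟩
    obtain ⟨n, hn, rfl⟩ := Finset.mem_image.1 hm
    have := Finset.le_sup (f := fun n : ℕ+ => (n : ℕ)) hn
    simp only [Finset.mem_Ico]
    exact ⟨n.pos, by omega⟩
  calc ∑ n ∈ s, (1 / (n : ℝ)) * poissonWeight (r * Real.log n) k
      = ∑ m ∈ s.image (fun n : ℕ+ => (n : ℕ)),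
          (1 / (m : ℝ)) * poissonWeight (r * Real.log m) k := by
        rw [Finset.sum_image (fun a _ b _ h => PNat.coe_injective h)]
    _ ≤ ∑ m ∈ Finset.Ico 1 (K + 1), (1 / (m : ℝ)) * poissonWeight (r * Real.log m) k := by
        refine Finset.sum_le_sum_of_subset_of_nonneg hK fun m _ _ => ?_
        have := poissonWeight_nonneg (mul_nonneg hr.le (Real.log_natCast_nonneg m)) k
        positivity
    _ ≤ ∑ m ∈ Finset.Ico 1 (K + 1), (2 ^ (1 + r) / r) * (G m - G (m + 1 : ℕ)) :=
        Finset.sum_le_sum fun m hm => key m (Finset.mem_Ico.1 hm).1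
    _ = (2 ^ (1 + r) / r) * (G (1 : ℕ) - G (K + 1 : ℕ)) := by
        rw [← Finset.mul_sum]
        congr 1
        rw [← neg_sub (G (K + 1 : ℕ)), ← Finset.sum_Ico_sub (fun m : ℕ => G m) (by omega),
          ← Finset.sum_neg_distrib]
        exact Finset.sum_congr rfl fun m _ => (neg_sub _ _).symm
    _ ≤ 2 ^ (1 + r) / r * 1 := by
        gcongr
        linarith [hG0 (K + 1)]
    _ = _ := mul_one _

section BanachAlgebra

variable {A : Type*} [NormedRing A] [NormedAlgebra ℂ A] [CompleteSpace A]

lemma hasSum_exp_smul (z : ℂ) (S : A) :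
    HasSum (fun k : ℕ => (z ^ k / k.factorial) • S ^ k) (NormedSpace.exp (z • S)) := by
  refine (NormedSpace.exp_series_hasSum_exp' (𝕂 := ℂ) (z • S)).congr_of_eq (fun k => ?_) rfl
  rw [smul_pow, smul_smul, div_eq_inv_mul]

lemma hasSum_mul_exp_smul {z : ℂ} (hz : z ≠ 0) (S : A) :
    HasSum (fun k : ℕ => (k / z * (z ^ k / k.factorial)) • S ^ k)
      (S * NormedSpace.exp (z • S)) := by
  rw [← hasSum_nat_add_iff' 1]
  refine ((hasSum_exp_smul z S).mul_left S).congr_of_eq (fun k => ?_) (by simp)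
  rw [mul_smul_comm, ← pow_succ', Nat.factorial_succ]
  congr 1
  push_cast
  have : (k : ℂ) + 1 ≠ 0 := by exact_mod_cast k.succ_ne_zero
  field_simp
  ring

lemma exp_neg_smul_sub (v R : ℝ) (S : A) :
    NormedSpace.exp (-(v : ℂ) • ((R : ℂ) • (1 : A) - S))
      = Complex.exp (-(v * R)) • NormedSpace.exp ((v : ℂ) • S) := by
  have h : -(v : ℂ) • ((R : ℂ) • (1 : A) - S) = algebraMap ℂ A (-(v * R)) + (v : ℂ) • S := by
    rw [Algebra.algebraMap_eq_smul_one]; module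
  let := NormedAlgebra.restrictScalars ℚ ℂ A
  rw [h, NormedSpace.exp_add_of_commute (Algebra.commutes _ _),
    ← NormedSpace.algebraMap_exp_comm, ← Complex.exp_eq_exp_ℂ, ← Algebra.smul_def]

variable [NormOneClass A] {R : ℝ} {S : A}

lemma norm_exp_neg_smul_sub_le (hS : ‖S‖ ≤ R) {v : ℝ} (hv : 0 ≤ v) :
    ‖NormedSpace.exp (-(v : ℂ) • ((R : ℂ) • (1 : A) - S))‖ ≤ 1 := by
  rw [exp_neg_smul_sub]
  refine ((hasSum_exp_smul (v : ℂ) S).const_smul (Complex.exp (-(v * R)))).norm_le_of_bounded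
    (hasSum_poissonWeight (v * R)) fun k => ?_
  rw [norm_smul, norm_smul, poissonWeight, Complex.norm_exp]
  have : ‖S ^ k‖ ≤ R ^ k := (norm_pow_le S k).trans (by gcongr)
  simp only [norm_div, norm_pow, Complex.norm_natCast, Complex.norm_real, Real.norm_eq_abs,
    abs_of_nonneg hv, mul_pow]
  rw [mul_div_right_comm]
  have e : (-((v : ℂ) * R)).re = -(v * R) := by simp
  rw [e]
  gcongr

lemma norm_sub_mul_exp_le (hR : 0 < R) (hS : ‖S‖ ≤ R) {v : ℝ} (hv : 0 < v) :
    ‖((R : ℂ) • (1 : A) - S) * NormedSpace.exp (-(v : ℂ) • ((R : ℂ) • (1 : A) - S))‖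
      ≤ √(R / v) := by
  have hv' : (v : ℂ) ≠ 0 := by exact_mod_cast hv.ne'
  have h := (((hasSum_exp_smul (v : ℂ) S).const_smul (R : ℂ)).sub
    (hasSum_mul_exp_smul hv' S)).const_smul (Complex.exp (-(v * R)))
  have hbd : ∀ k : ℕ, ‖Complex.exp (-(v * R)) • ((R : ℂ) • ((v : ℂ) ^ k / k.factorial) • S ^ k
      - ((k : ℂ) / v * ((v : ℂ) ^ k / k.factorial)) • S ^ k)‖
      ≤ poissonWeight (v * R) k * |(k : ℝ) - v * R| * v⁻¹ := by
    intro k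
    have : ‖S ^ k‖ ≤ R ^ k := (norm_pow_le S k).trans (by gcongr)
    rw [smul_smul, ← sub_smul, smul_smul, norm_smul]
    have e : Complex.exp (-(v * R)) * ((R : ℂ) * ((v : ℂ) ^ k / k.factorial)
        - (k : ℂ) / v * ((v : ℂ) ^ k / k.factorial))
        = ((Real.exp (-(v * R)) * (v ^ k / k.factorial) * -((k - v * R) * v⁻¹) : ℝ) : ℂ) := by
      push_cast; field_simp; ring
    rw [e, Complex.norm_real, Real.norm_eq_abs, abs_mul, abs_neg, abs_mul, abs_mul,
      abs_of_pos (Real.exp_pos _), abs_of_nonneg (by positivity : 0 ≤ v ^ k / (k.factorial : ℝ)),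
      abs_of_pos (inv_pos.2 hv), poissonWeight]
    calc _ ≤ Real.exp (-(v * R)) * (v ^ k / k.factorial) * (|(k : ℝ) - v * R| * v⁻¹) * R ^ k := by
          gcongr
      _ = _ := by rw [mul_pow]; ring
  have hsum : Summable fun k : ℕ => poissonWeight (v * R) k * |(k : ℝ) - v * R| * v⁻¹ := by
    refine (summable_of_sum_le (fun k => ?_)
      (sum_abs_sub_mul_poissonWeight_le (mul_nonneg hv.le hR.le))).mul_right _
    exact mul_nonneg (poissonWeight_nonneg (mul_nonneg hv.le hR.le) _) (abs_nonneg _)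
  have hle := h.norm_le_of_bounded hsum.hasSum hbd
  rw [exp_neg_smul_sub, mul_smul_comm, sub_mul, smul_mul_assoc, one_mul]
  refine hle.trans ?_
  rw [tsum_mul_right]
  have h1 : ∑' k : ℕ, poissonWeight (v * R) k * |(k : ℝ) - v * R| ≤ √(v * R) :=
    Real.tsum_le_of_sum_le (fun k =>
      mul_nonneg (poissonWeight_nonneg (mul_nonneg hv.le hR.le) _) (abs_nonneg _))
      (sum_abs_sub_mul_poissonWeight_le (mul_nonneg hv.le hR.le))
  calc _ ≤ √(v * R) * v⁻¹ := by gcongr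
    _ = √(R / v) := by
      rw [Real.sqrt_mul hv.le, Real.sqrt_div hR.le]
      have h2 : 0 < √v := Real.sqrt_pos.2 hv
      have h3 : √v * √v = v := Real.mul_self_sqrt hv.le
      field_simp
      linear_combination h3

lemma norm_sub_pow_mul_exp_le (hR : 0 < R) (hS : ‖S‖ ≤ R) {v : ℝ} (hv : 0 < v) (m : ℕ) :
    ‖((R : ℂ) • (1 : A) - S) ^ m * NormedSpace.exp (-(v : ℂ) • ((R : ℂ) • (1 : A) - S))‖
      ≤ √(R * m / v) ^ m := by
  rcases Nat.eq_zero_or_pos m with rfl | hm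
  · simpa using norm_exp_neg_smul_sub_le hS hv.le
  set X := (R : ℂ) • (1 : A) - S with hX
  have hm' : (m : ℂ) ≠ 0 := by exact_mod_cast hm.ne'
  have hm0 : (0 : ℝ) < m := by exact_mod_cast hm
  have h1 : NormedSpace.exp (-(v : ℂ) • X) = NormedSpace.exp (-((v / m : ℝ) : ℂ) • X) ^ m := by
    let := NormedAlgebra.restrictScalars ℚ ℂ A
    rw [← NormedSpace.exp_nsmul]
    congr 1
    rw [← Nat.cast_smul_eq_nsmul ℂ, smul_smul]
    congr 1
    push_cast; field_simp
  have hc : Commute X (NormedSpace.exp (-((v / m : ℝ) : ℂ) • X)) := by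
    let := NormedAlgebra.restrictScalars ℚ ℂ A
    exact ((Commute.refl X).smul_right _).exp_right
  rw [h1, ← hc.mul_pow]
  refine (norm_pow_le _ _).trans ?_
  have := norm_sub_mul_exp_le hR hS (v := v / m) (by positivity)
  rw [div_div_eq_mul_div] at this
  gcongr

/-- Quantitative Taylor expansion of `exp (-u (R - S))` around a point at distance `O(√v)`. -/
lemma norm_exp_sub_taylor_le (hR : 0 < R) (hS : ‖S‖ ≤ R) {u v : ℝ} (hv : 0 < v)
    (huv : |v - u| ≤ 2 * √v) {M : ℕ} (hM : 16 * Real.exp 1 ^ 2 * R ≤ M) :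
    ‖NormedSpace.exp (-(u : ℂ) • ((R : ℂ) • (1 : A) - S))
      - ∑ m ∈ Finset.range M, (((v - u : ℝ) : ℂ) ^ m / m.factorial) •
        (((R : ℂ) • (1 : A) - S) ^ m * NormedSpace.exp (-(v : ℂ) • ((R : ℂ) • (1 : A) - S)))‖
      ≤ 2 * (1 / 2) ^ M := by
  set X := (R : ℂ) • (1 : A) - S with hX
  have h1 : NormedSpace.exp (-(u : ℂ) • X)
      = NormedSpace.exp (((v - u : ℝ) : ℂ) • X) * NormedSpace.exp (-(v : ℂ) • X) := by
    let := NormedAlgebra.restrictScalars ℚ ℂ A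
    rw [← NormedSpace.exp_add_of_commute (((Commute.refl X).smul_right _).smul_left _)]
    congr 1
    push_cast; module
  have h2 := (hasSum_exp_smul ((v - u : ℝ) : ℂ) X).mul_right (NormedSpace.exp (-(v : ℂ) • X))
  rw [← h1] at h2
  simp only [smul_mul_assoc] at h2
  have h3 := (hasSum_nat_add_iff' M).2 h2
  have hgeo : HasSum (fun k : ℕ => (1 / 2 : ℝ) ^ (k + M)) (2 * (1 / 2) ^ M) := by
    refine (hasSum_geometric_two.mul_right ((1 / 2 : ℝ) ^ M)).congr_of_eq (fun k => ?_) rfl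
    rw [pow_add]
  refine h3.norm_le_of_bounded hgeo fun k => ?_
  set m := k + M with hm
  have hMm : 16 * Real.exp 1 ^ 2 * R ≤ m := hM.trans (by rw [hm]; push_cast; linarith [k.cast_nonneg (α := ℝ)])
  have hm0 : (0 : ℝ) < m := lt_of_lt_of_le (by positivity) hMm
  rw [norm_smul, norm_div, norm_pow, Complex.norm_natCast, Complex.norm_real, Real.norm_eq_abs]
  have hfac : (m : ℝ) ^ m / Real.exp 1 ^ m ≤ m.factorial := by
    have h := Real.pow_div_factorial_le_exp m hm0.le m
    rw [div_le_iff₀ (by positivity)] at h ⊢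
    rwa [← Real.exp_nat_mul, mul_one, mul_comm]
  have hb : 2 * √(R * m) ≤ (1 / 2) * (m / Real.exp 1) := by
    have hle : √(R * m) ≤ (1 / 4) * (m / Real.exp 1) := by
      apply Real.sqrt_le_iff.2 ⟨by positivity, ?_⟩
      have e : (1 / 4 * ((m : ℝ) / Real.exp 1)) ^ 2 = m * m / (16 * Real.exp 1 ^ 2) := by
        field_simp; norm_num
      rw [e, le_div_iff₀ (by positivity)]
      nlinarith [mul_le_mul_of_nonneg_right hMm hm0.le]
    linarith
  calc |v - u| ^ m / m.factorial * ‖X ^ m * NormedSpace.exp (-(v : ℂ) • X)‖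
      ≤ (2 * √v) ^ m / m.factorial * √(R * m / v) ^ m := by
        gcongr
        exact norm_sub_pow_mul_exp_le hR hS hv m
    _ = (2 * √(R * m)) ^ m / m.factorial := by
        rw [div_mul_eq_mul_div, ← mul_pow, Real.sqrt_div (by positivity)]
        have : 0 < √v := Real.sqrt_pos.2 hv
        congr 2; field_simp
    _ ≤ ((1 / 2) * (m / Real.exp 1)) ^ m / ((m : ℝ) ^ m / Real.exp 1 ^ m) := by gcongr
    _ = (1 / 2) ^ m := by
        rw [mul_pow, ← div_pow, mul_div_assoc, div_self (by positivity), mul_one]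

end BanachAlgebra

section SquareSummable

variable {ι κ : Type*}

/-- The Hilbert space of square-summable complex families. -/
abbrev SqSum (ι : Type*) := ↥(lp (fun _ : ι => ℂ) 2)

/-- The standard basis vectors of `SqSum ι`. -/
def stdVec [DecidableEq ι] (i : ι) : SqSum ι := lp.single 2 i (1 : ℂ)

lemma SqSum.hasSum_sq_norm (x : SqSum ι) : HasSum (fun i => ‖x i‖ ^ 2) (‖x‖ ^ 2) := by
  have := lp.hasSum_norm (p := 2) (by norm_num) x
  simpa using this

lemma SqSum.sum_sq_norm_le (x : SqSum ι) (s : Finset ι) : ∑ i ∈ s, ‖x i‖ ^ 2 ≤ ‖x‖ ^ 2 :=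
  sum_le_hasSum s (fun _ _ => sq_nonneg _) x.hasSum_sq_norm

lemma SqSum.norm_le_of_sum_le {x : SqSum ι} {C : ℝ} (hC : 0 ≤ C)
    (h : ∀ s : Finset ι, ∑ i ∈ s, ‖x i‖ ^ 2 ≤ C ^ 2) : ‖x‖ ≤ C := by
  refine lp.norm_le_of_forall_sum_le (by norm_num) hC fun s => ?_
  simpa using h s

lemma norm_stdVec [DecidableEq ι] (i : ι) : ‖stdVec i‖ = 1 := by
  simp [stdVec, lp.norm_single]

lemma stdVec_apply [DecidableEq ι] (i j : ι) : stdVec i j = if j = i then 1 else 0 := by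
  rw [stdVec, lp.single_apply, Pi.single_apply]

lemma SqSum.hasSum_smul_stdVec [DecidableEq ι] (x : SqSum ι) :
    HasSum (fun i => x i • stdVec i) x := by
  refine (lp.hasSum_single (by norm_num) x).congr_of_eq (fun i => ?_) rfl
  rw [stdVec, ← lp.single_smul, smul_eq_mul, mul_one]

lemma orthonormal_stdVec [DecidableEq ι] : Orthonormal ℂ (stdVec : ι → SqSum ι) := by
  rw [orthonormal_iff_ite]
  intro i j
  rw [stdVec, lp.inner_single_left]
  simp [stdVec_apply]

/-- The isometry of `ℓ²` spaces induced by an injection of the index sets. -/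
def SqSum.push [DecidableEq κ] (f : ι → κ) (hf : Function.Injective f) :
    SqSum ι →ₗᵢ[ℂ] SqSum κ :=
  (orthonormal_stdVec.comp f hf).orthogonalFamily.linearIsometry

lemma SqSum.hasSum_push [DecidableEq κ] (f : ι → κ) (hf : Function.Injective f) (x : SqSum ι) :
    HasSum (fun i => x i • stdVec (f i)) (SqSum.push f hf x) :=
  (orthonormal_stdVec.comp f hf).orthogonalFamily.hasSum_linearIsometry x

lemma SqSum.push_stdVec [DecidableEq ι] [DecidableEq κ] (f : ι → κ) (hf : Function.Injective f)
    (i : ι) : SqSum.push f hf (stdVec i) = stdVec (f i) := by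
  rw [stdVec, SqSum.push, OrthogonalFamily.linearIsometry_apply_single]
  simp

/-- Evaluation at an index, as a continuous linear functional. -/
def SqSum.eval (i : ι) : SqSum ι →L[ℂ] ℂ :=
  LinearMap.mkContinuous
    { toFun := fun x => x i, map_add' := fun _ _ => rfl, map_smul' := fun _ _ => rfl } 1
    fun x => by rw [one_mul]; exact lp.norm_apply_le_norm two_ne_zero x i

@[simp] lemma SqSum.eval_apply (i : ι) (x : SqSum ι) : SqSum.eval i x = x i := rfl

lemma SqSum.push_apply_of_forall_ne [DecidableEq κ] (f : ι → κ) (hf : Function.Injective f)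
    (x : SqSum ι) {k : κ} (hk : ∀ i, f i ≠ k) : SqSum.push f hf x k = 0 := by
  have h := (SqSum.hasSum_push f hf x).mapL (SqSum.eval k)
  refine h.unique (hasSum_zero.congr_of_eq (fun i => ?_) rfl)
  simp [stdVec_apply, (hk i).symm]

lemma SqSum.push_apply [DecidableEq κ] (f : ι → κ) (hf : Function.Injective f)
    (x : SqSum ι) (i : ι) : SqSum.push f hf x (f i) = x i := by
  have h := (SqSum.hasSum_push f hf x).mapL (SqSum.eval (f i))
  have h2 := hasSum_single (f := fun j => SqSum.eval (f i) (x j • stdVec (f j))) i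
    (fun j hj => by simp [stdVec_apply, hf.ne hj.symm])
  have := h.unique h2
  simpa [stdVec_apply] using this

lemma exists_clm_of_norm_sum_le {E : Type*} [NormedAddCommGroup E] [NormedSpace ℂ E]
    [CompleteSpace E] (v : ι → E) {C : ℝ} (hC : 0 ≤ C)
    (h : ∀ (s : Finset ι) (x : ι → ℂ), ‖∑ i ∈ s, x i • v i‖ ≤ C * √(∑ i ∈ s, ‖x i‖ ^ 2)) :
    ∃ T : SqSum ι →L[ℂ] E, ‖T‖ ≤ C ∧ ∀ x : SqSum ι, HasSum (fun i => x i • v i) (T x) := by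
  have hs : ∀ x : SqSum ι, Summable fun i => x i • v i := by
    intro x
    rw [summable_iff_vanishing_norm]
    intro e he
    obtain ⟨s, hs⟩ := summable_iff_vanishing_norm.1 x.hasSum_sq_norm.summable
      ((e / (C + 1)) ^ 2) (by positivity)
    refine ⟨s, fun t ht => (h t x).trans_lt ?_⟩
    have h1 := hs t ht
    rw [Real.norm_of_nonneg (Finset.sum_nonneg fun _ _ => sq_nonneg _)] at h1
    have h2 : √(∑ i ∈ t, ‖x i‖ ^ 2) < e / (C + 1) := (Real.sqrt_lt' (by positivity)).2 h1
    calc C * √(∑ i ∈ t, ‖x i‖ ^ 2) ≤ C * (e / (C + 1)) := by gcongr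
      _ < (C + 1) * (e / (C + 1)) := by
        have : 0 < e / (C + 1) := by positivity
        nlinarith
      _ = e := by field_simp
  have hb : ∀ x : SqSum ι, ‖∑' i, x i • v i‖ ≤ C * ‖x‖ := by
    intro x
    refine le_of_tendsto (hs x).hasSum.norm (Eventually.of_forall fun s => (h s x).trans ?_)
    gcongr
    exact Real.sqrt_le_iff.2 ⟨norm_nonneg _, x.sum_sq_norm_le s⟩
  refine ⟨LinearMap.mkContinuous
    { toFun := fun x => ∑' i, x i • v i
      map_add' := fun x y => ?_
      map_smul' := fun c x => ?_ } C hb, LinearMap.mkContinuous_norm_le _ hC _,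
    fun x => (hs x).hasSum⟩
  · rw [← (hs x).tsum_add (hs y)]
    exact tsum_congr fun i => by rw [lp.coeFn_add, Pi.add_apply, add_smul]
  · rw [RingHom.id_apply, ← (hs x).tsum_const_smul]
    exact tsum_congr fun i => by rw [lp.coeFn_smul, Pi.smul_apply, smul_assoc]

/-- A form of the Schur test. -/
lemma norm_sum_le_of_schur (v : ι → SqSum κ) (p : ι → ℝ) (w : ι → κ → ℝ)
    (hw : ∀ i k, 0 ≤ w i k) (hv : ∀ i k, ‖v i k‖ ≤ p i * w i k)
    (hcol : ∀ i (t : Finset κ), ∑ k ∈ t, w i k ≤ 1) (s : Finset ι) {A : ℝ} (hA : 0 ≤ A)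
    (hrow : ∀ k, ∑ i ∈ s, p i ^ 2 * w i k ≤ A) (x : ι → ℂ) :
    ‖∑ i ∈ s, x i • v i‖ ≤ √A * √(∑ i ∈ s, ‖x i‖ ^ 2) := by
  refine SqSum.norm_le_of_sum_le (by positivity) fun t => ?_
  have hS : 0 ≤ ∑ i ∈ s, ‖x i‖ ^ 2 := Finset.sum_nonneg fun _ _ => sq_nonneg _
  rw [mul_pow, Real.sq_sqrt hA, Real.sq_sqrt hS]
  have hpt : ∀ k, ‖(∑ i ∈ s, x i • v i) k‖ ^ 2 ≤ A * ∑ i ∈ s, ‖x i‖ ^ 2 * w i k := by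
    intro k
    have e : (∑ i ∈ s, x i • v i) k = ∑ i ∈ s, x i * v i k := by
      rw [← SqSum.eval_apply, map_sum]; simp
    calc ‖(∑ i ∈ s, x i • v i) k‖ ^ 2 ≤ (∑ i ∈ s, ‖x i‖ * (p i * w i k)) ^ 2 := by
          rw [e]
          gcongr
          refine (norm_sum_le _ _).trans (Finset.sum_le_sum fun i _ => ?_)
          rw [norm_mul]
          gcongr
          exact hv i k
      _ ≤ (∑ i ∈ s, p i ^ 2 * w i k) * ∑ i ∈ s, ‖x i‖ ^ 2 * w i k := by
          refine Finset.sum_sq_le_sum_mul_sum_of_sq_le_mul _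
            (fun i _ => mul_nonneg (sq_nonneg _) (hw i k))
            (fun i _ => mul_nonneg (sq_nonneg _) (hw i k)) fun i _ => le_of_eq (by ring)
      _ ≤ _ := by
          gcongr
          · exact Finset.sum_nonneg fun i _ => mul_nonneg (sq_nonneg _) (hw i k)
          · exact hrow k
  calc ∑ k ∈ t, ‖(∑ i ∈ s, x i • v i) k‖ ^ 2
      ≤ ∑ k ∈ t, A * ∑ i ∈ s, ‖x i‖ ^ 2 * w i k := Finset.sum_le_sum fun k _ => hpt k
    _ = A * ∑ i ∈ s, ‖x i‖ ^ 2 * ∑ k ∈ t, w i k := by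
        rw [← Finset.mul_sum, Finset.sum_comm]
        simp_rw [Finset.mul_sum]
    _ ≤ A * ∑ i ∈ s, ‖x i‖ ^ 2 * 1 := by
        gcongr with i _
        exact hcol i t
    _ = _ := by simp

lemma norm_sum_smul_le_of_sum_sq_le {E : Type*} [NormedAddCommGroup E] [NormedSpace ℂ E]
    (v : ι → E) (s : Finset ι) {A : ℝ} (hA : ∑ i ∈ s, ‖v i‖ ^ 2 ≤ A) (x : ι → ℂ) :
    ‖∑ i ∈ s, x i • v i‖ ≤ √A * √(∑ i ∈ s, ‖x i‖ ^ 2) := by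
  calc ‖∑ i ∈ s, x i • v i‖ ≤ ∑ i ∈ s, ‖v i‖ * ‖x i‖ := by
        refine (norm_sum_le _ _).trans (Finset.sum_le_sum fun i _ => ?_)
        rw [norm_smul, mul_comm]
    _ ≤ √(∑ i ∈ s, ‖v i‖ ^ 2) * √(∑ i ∈ s, ‖x i‖ ^ 2) := Real.sum_mul_le_sqrt_mul_sqrt _ _ _
    _ ≤ _ := by gcongr

end SquareSummable

section Symbol

variable {d : ℕ}

/-- Raising the `j`-th coordinate of a multi-index by one. -/
def raise (j : Fin d) (α : Fin d → ℕ) : Fin d → ℕ := α + Pi.single j 1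

lemma raise_injective (j : Fin d) : Function.Injective (raise j) := add_left_injective _

/-- Multiplication by the linear form `∑ j, b j * z j` on the Hardy space of the polydisc,
in terms of Taylor coefficients. -/
def shiftSum (b : Fin d → ℂ) : SqSum (Fin d → ℕ) →L[ℂ] SqSum (Fin d → ℕ) :=
  ∑ j, b j • (SqSum.push (raise j) (raise_injective j)).toContinuousLinearMap

instance : Nontrivial (SqSum (Fin d → ℕ)) :=
  ⟨⟨stdVec 0, 0, fun h => by simpa [h] using norm_stdVec (0 : Fin d → ℕ)⟩⟩

lemma norm_shiftSum_le (b : Fin d → ℂ) : ‖shiftSum b‖ ≤ ∑ j, ‖b j‖ := by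
  refine (norm_sum_le _ _).trans (Finset.sum_le_sum fun j _ => ?_)
  rw [norm_smul]
  exact mul_le_of_le_one_right (norm_nonneg _) (LinearIsometry.norm_toContinuousLinearMap_le _)

lemma shiftSum_stdVec (b : Fin d → ℂ) (α : Fin d → ℕ) :
    shiftSum b (stdVec α) = ∑ j, b j • stdVec (raise j α) := by
  simp [shiftSum, SqSum.push_stdVec]

lemma shiftSum_apply (b : Fin d → ℂ) (y : SqSum (Fin d → ℕ)) (α : Fin d → ℕ) :
    shiftSum b y α = ∑ j, b j * if α j = 0 then 0 else y (α - Pi.single j 1) := by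
  rw [shiftSum, sum_apply, ← SqSum.eval_apply, map_sum]
  refine Finset.sum_congr rfl fun j _ => ?_
  rw [smul_apply, map_smul, smul_eq_mul, SqSum.eval_apply]
  congr 1
  split_ifs with h
  · refine SqSum.push_apply_of_forall_ne _ (raise_injective j) _ fun β hβ => ?_
    have := congrFun hβ j
    simp [raise, h] at this
  · have e : raise j (α - Pi.single j 1) = α := by
      refine tsub_add_cancel_of_le fun i => ?_
      by_cases hi : i = j
      · subst hi; simp; omega
      · simp [hi]
    conv_lhs => rw [← e]
    exact SqSum.push_apply _ (raise_injective j) _ _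

lemma shiftSum_pow_apply (b : Fin d → ℂ) (k : ℕ) (α : Fin d → ℕ) :
    (shiftSum b ^ k) (stdVec 0) α
      = if ∑ j, α j = k then (k.factorial : ℂ) * ∏ j, b j ^ α j / (α j).factorial else 0 := by
  induction k generalizing α with
  | zero =>
    by_cases h : α = 0
    · subst h; simp [stdVec_apply]
    · have : ¬ ∀ j, α j = 0 := fun h' => h (funext h')
      simp [stdVec_apply, h, this]
  | succ k ih =>
    rw [pow_succ', mul_apply_eq_comp, shiftSum_apply]
    have hterm : ∀ j, (b j * if α j = 0 then 0
        else ((shiftSum b ^ k) (stdVec 0)) (α - Pi.single j 1))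
        = if ∑ j, α j = k + 1 then
            (α j : ℂ) * ((k.factorial : ℂ) * ∏ j, b j ^ α j / (α j).factorial) else 0 := by
      intro j
      by_cases h0 : α j = 0
      · simp [h0]
      obtain ⟨a, ha⟩ := Nat.exists_eq_succ_of_ne_zero h0
      set β := α - Pi.single j 1 with hβ
      have hβj : β j = a := by simp [hβ, ha]
      have hβi : ∀ i, i ≠ j → β i = α i := fun i hi => by simp [hβ, hi]
      have hsum : ∑ i, α i = ∑ i, β i + 1 := by
        have h1 := Finset.add_sum_erase _ α (Finset.mem_univ j)
        have h2 := Finset.add_sum_erase _ β (Finset.mem_univ j)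
        have h3 : ∑ i ∈ Finset.univ.erase j, β i = ∑ i ∈ Finset.univ.erase j, α i :=
          Finset.sum_congr rfl fun i hi => hβi i (Finset.ne_of_mem_erase hi)
        rw [← h1, ← h2, h3, hβj, ha]
        exact Nat.succ_add _ _
      have hprod : b j * ∏ i, b i ^ β i / (β i).factorial
          = (α j : ℂ) * ∏ i, b i ^ α i / (α i).factorial := by
        rw [← Finset.mul_prod_erase _ _ (Finset.mem_univ j),
          ← Finset.mul_prod_erase _ (fun i => b i ^ α i / ((α i).factorial : ℂ))
            (Finset.mem_univ j), hβj, ha,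
          Finset.prod_congr rfl fun i hi => by rw [hβi i (Finset.ne_of_mem_erase hi)],
          Nat.factorial_succ]
        have : (a : ℂ) + 1 ≠ 0 := by exact_mod_cast a.succ_ne_zero
        rw [Nat.succ_eq_add_one, pow_succ]
        push_cast
        field_simp
      rw [if_neg h0, ih β, hsum]
      simp only [Nat.add_right_cancel_iff]
      split_ifs
      · linear_combination (k.factorial : ℂ) * hprod
      · simp
    simp_rw [hterm]
    by_cases h : ∑ j, α j = k + 1
    · simp only [h, if_true]
      rw [← Finset.sum_mul, ← Nat.cast_sum, h, Nat.factorial_succ]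
      push_cast; ring
    · simp [h]

lemma exp_shiftSum_apply (b : Fin d → ℂ) (u : ℂ) (α : Fin d → ℕ) :
    NormedSpace.exp (u • shiftSum b) (stdVec 0) α
      = ∏ j, (u * b j) ^ α j / (α j).factorial := by
  have h := ((hasSum_exp_smul u (shiftSum b)).mapL
    (ContinuousLinearMap.apply ℂ (SqSum (Fin d → ℕ)) (stdVec 0))).mapL (SqSum.eval α)
  have h2 := hasSum_single (f := fun k : ℕ => SqSum.eval α (ContinuousLinearMap.apply ℂ
    (SqSum (Fin d → ℕ)) (stdVec 0) ((u ^ k / k.factorial) • shiftSum b ^ k))) (∑ j, α j)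
    (fun k hk => by
      simp only [map_smul, ContinuousLinearMap.apply_apply, SqSum.eval_apply, shiftSum_pow_apply,
        if_neg hk.symm, smul_zero])
  refine (h.unique h2).trans ?_
  simp only [map_smul, ContinuousLinearMap.apply_apply, SqSum.eval_apply, shiftSum_pow_apply,
    if_true, smul_eq_mul]
  simp_rw [mul_pow, mul_div_assoc, Finset.prod_mul_distrib, Finset.prod_pow_eq_pow_sum]
  have : ((∑ j, α j).factorial : ℂ) ≠ 0 := by exact_mod_cast Nat.factorial_ne_zero _
  field_simp

/-- On a multiplicative functional, `exp (u * shiftSum b)` is evaluated by the exponential. -/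
lemma apply_exp_shiftSum (b : Fin d → ℂ) (u : ℂ) (ζ : Fin d → ℂ)
    (l : SqSum (Fin d → ℕ) →L[ℂ] ℂ) (hl : ∀ α, l (stdVec α) = ∏ j, ζ j ^ α j) :
    l (NormedSpace.exp (u • shiftSum b) (stdVec 0)) = Complex.exp (u * ∑ j, b j * ζ j) := by
  have hmul : ∀ y, l (shiftSum b y) = (∑ j, b j * ζ j) * l y := by
    intro y
    have h1 := (y.hasSum_smul_stdVec.mapL (shiftSum b)).mapL l
    have h2 := (y.hasSum_smul_stdVec.mapL l).mul_left (∑ j, b j * ζ j)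
    refine h1.unique (h2.congr_of_eq (fun α => ?_) rfl)
    simp only [map_smul, shiftSum_stdVec, map_sum, hl, smul_eq_mul]
    have : ∀ j, ∏ i, ζ i ^ raise j α i = ζ j * ∏ i, ζ i ^ α i := by
      intro j
      simp_rw [raise, Pi.add_apply, pow_add, Finset.prod_mul_distrib]
      rw [mul_comm]
      congr 1
      rw [Finset.prod_eq_single j (fun i _ hi => by simp [hi]) (by simp)]
      simp
    simp_rw [this]
    rw [Finset.sum_mul, Finset.mul_sum]
    exact Finset.sum_congr rfl fun j _ => by ring
  have hpow : ∀ k : ℕ, l ((shiftSum b ^ k) (stdVec 0)) = (∑ j, b j * ζ j) ^ k := by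
    intro k
    induction k with
    | zero => simp [hl]
    | succ k ih => rw [pow_succ', mul_apply_eq_comp, hmul, ih, pow_succ']
  have h := ((hasSum_exp_smul u (shiftSum b)).mapL
    (ContinuousLinearMap.apply ℂ (SqSum (Fin d → ℕ)) (stdVec 0))).mapL l
  have h2 := NormedSpace.expSeries_div_hasSum_exp (u * ∑ j, b j * ζ j)
  rw [← Complex.exp_eq_exp_ℂ] at h2
  refine h.unique (h2.congr_of_eq (fun k => ?_) rfl)
  simp only [map_smul, ContinuousLinearMap.apply_apply, hpow, mul_pow, smul_eq_mul]
  ring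

end Symbol

section Columns

variable {d : ℕ}

/-- The joint law of independent Poisson variables with parameters `r j * u`. -/
def prodPoisson (r : Fin d → ℝ) (u : ℝ) (α : Fin d → ℕ) : ℝ :=
  ∏ j, poissonWeight (r j * u) (α j)

lemma prodPoisson_nonneg {r : Fin d → ℝ} (hr : ∀ j, 0 ≤ r j) {u : ℝ} (hu : 0 ≤ u)
    (α : Fin d → ℕ) : 0 ≤ prodPoisson r u α :=
  Finset.prod_nonneg fun j _ => poissonWeight_nonneg (mul_nonneg (hr j) hu) _

lemma sum_piFinset_prodPoisson (r : Fin d → ℝ) (u : ℝ) (B : Fin d → Finset ℕ) :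
    ∑ α ∈ Fintype.piFinset B, prodPoisson r u α = ∏ j, ∑ k ∈ B j, poissonWeight (r j * u) k :=
  (Finset.prod_univ_sum B fun j k => poissonWeight (r j * u) k).symm

lemma sum_prodPoisson_le_one {r : Fin d → ℝ} (hr : ∀ j, 0 ≤ r j) {u : ℝ} (hu : 0 ≤ u)
    (t : Finset (Fin d → ℕ)) : ∑ α ∈ t, prodPoisson r u α ≤ 1 := by
  have hsub : t ⊆ Fintype.piFinset fun j => t.image fun α => α j := fun α hα =>
    Fintype.mem_piFinset.2 fun j => Finset.mem_image_of_mem _ hα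
  refine (Finset.sum_le_sum_of_subset_of_nonneg hsub
    fun α _ _ => prodPoisson_nonneg hr hu α).trans ?_
  rw [sum_piFinset_prodPoisson]
  exact Finset.prod_le_one
    (fun j _ => Finset.sum_nonneg fun k _ => poissonWeight_nonneg (mul_nonneg (hr j) hu) k)
    fun j _ => sum_poissonWeight_le_one (mul_nonneg (hr j) hu) _

lemma PNat.log_nonneg (n : ℕ+) : 0 ≤ Real.log (n : ℕ) :=
  Real.log_nonneg (by exact_mod_cast n.pos)

lemma sum_inv_mul_prodPoisson_le {r : Fin d → ℝ} (hr : ∀ j, 0 < r j) (j₀ : Fin d)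
    (s : Finset ℕ+) {δ : ℝ}
    (hδ : ∀ n ∈ s, ∀ j k, poissonWeight (r j * Real.log (n : ℕ)) k ≤ δ) (hδ0 : 0 ≤ δ)
    (α : Fin d → ℕ) :
    ∑ n ∈ s, (1 / (n : ℕ) : ℝ) * prodPoisson r (Real.log (n : ℕ)) α
      ≤ δ ^ (d - 1) * (2 ^ (1 + r j₀) / r j₀) := by
  calc ∑ n ∈ s, (1 / (n : ℕ) : ℝ) * prodPoisson r (Real.log (n : ℕ)) α
      ≤ ∑ n ∈ s, δ ^ (d - 1) *
          ((1 / (n : ℕ) : ℝ) * poissonWeight (r j₀ * Real.log (n : ℕ)) (α j₀)) := by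
        refine Finset.sum_le_sum fun n hn => ?_
        have h0 : ∀ j k, 0 ≤ poissonWeight (r j * Real.log (n : ℕ)) k := fun j k =>
          poissonWeight_nonneg (mul_nonneg (hr j).le n.log_nonneg) k
        rw [prodPoisson, ← Finset.mul_prod_erase _ _ (Finset.mem_univ j₀)]
        have h1 : ∏ j ∈ Finset.univ.erase j₀, poissonWeight (r j * Real.log (n : ℕ)) (α j)
            ≤ δ ^ (d - 1) := by
          refine (Finset.prod_le_prod (fun j _ => h0 j _) fun j _ => hδ n hn j (α j)).trans ?_
          simp [Finset.card_erase_of_mem]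
        have h2 := mul_le_mul_of_nonneg_left h1
          (mul_nonneg (by positivity : (0 : ℝ) ≤ 1 / (n : ℕ)) (h0 j₀ (α j₀)))
        linarith
    _ ≤ _ := by
        rw [← Finset.mul_sum]
        gcongr
        exact sum_inv_mul_poissonWeight_log_le (hr j₀) _ s

/-- The image of the `n`-th basis vector of `ℋ²` under the composition operator with symbol
`c - ∑ j, b j * z j`, written in the variables `z`. -/
def dirCol (c : ℂ) (b : Fin d → ℂ) (n : ℕ+) : SqSum (Fin d → ℕ) :=
  ((n : ℕ) : ℂ) ^ (-c) • NormedSpace.exp ((Real.log (n : ℕ) : ℂ) • shiftSum b) (stdVec 0)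

lemma dirCol_apply (c : ℂ) (b : Fin d → ℂ) (n : ℕ+) (α : Fin d → ℕ) :
    dirCol c b n α
      = ((n : ℕ) : ℂ) ^ (-c) * ∏ j, ((Real.log (n : ℕ) : ℂ) * b j) ^ α j / (α j).factorial := by
  rw [dirCol, lp.coeFn_smul, Pi.smul_apply, exp_shiftSum_apply, smul_eq_mul]

/-- The unimodular factor making `dirCol c b n` positive in the `n` aspect. -/
def colPhase (c : ℂ) (n : ℕ+) : ℂ := ((n : ℕ) : ℂ) ^ (Complex.I * c.im)

/-- The unimodular factor making `dirCol c b n α` positive in the `α` aspect. -/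
def rowPhase (b : Fin d → ℂ) (α : Fin d → ℕ) : ℂ :=
  ∏ j, (starRingEnd ℂ (b j) / ‖b j‖) ^ α j

lemma norm_colPhase (c : ℂ) (n : ℕ+) : ‖colPhase c n‖ = 1 := by
  rw [colPhase, Complex.norm_natCast_cpow_of_pos n.pos]
  simp

lemma norm_rowPhase {b : Fin d → ℂ} (hb : ∀ j, b j ≠ 0) (α : Fin d → ℕ) :
    ‖rowPhase b α‖ = 1 := by
  rw [rowPhase, norm_prod]
  refine Finset.prod_eq_one fun j _ => ?_
  rw [norm_pow, norm_div, RCLike.norm_conj, Complex.norm_real, norm_norm,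
    div_self (norm_ne_zero_iff.2 (hb j)), one_pow]

lemma colPhase_mul_rowPhase_mul_dirCol {c : ℂ} {b : Fin d → ℂ} (hb : ∀ j, b j ≠ 0)
    (hc : c.re = 1 / 2 + ∑ j, ‖b j‖) (n : ℕ+) (α : Fin d → ℕ) :
    colPhase c n * (rowPhase b α * dirCol c b n α)
      = ((((n : ℕ) : ℝ) ^ (-(1 / 2) : ℝ)
          * prodPoisson (fun j => ‖b j‖) (Real.log (n : ℕ)) α : ℝ) : ℂ) := by
  have hn : (0 : ℝ) < (n : ℕ) := by exact_mod_cast n.pos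
  have hn' : ((n : ℕ) : ℂ) ≠ 0 := by exact_mod_cast n.pos.ne'
  have h1 : colPhase c n * ((n : ℕ) : ℂ) ^ (-c)
      = ((((n : ℕ) : ℝ) ^ (-(1 / 2) : ℝ) * ∏ j, Real.exp (-(‖b j‖ * Real.log (n : ℕ))) : ℝ) : ℂ) := by
    rw [colPhase, ← Complex.cpow_add _ _ hn', ← Real.exp_sum, Real.rpow_def_of_pos hn,
      ← Real.exp_add, Finset.sum_neg_distrib, ← Finset.sum_mul, Complex.cpow_def_of_ne_zero hn',
      ← Complex.natCast_log, Complex.ofReal_exp]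
    congr 1
    have : c = (c.re : ℂ) + c.im * Complex.I := (Complex.re_add_im c).symm
    rw [hc] at this
    conv_lhs => rw [this]
    push_cast
    simp
    ring
  have h2 : rowPhase b α * ∏ j, ((Real.log (n : ℕ) : ℂ) * b j) ^ α j / (α j).factorial
      = ((∏ j, (‖b j‖ * Real.log (n : ℕ)) ^ α j / (α j).factorial : ℝ) : ℂ) := by
    rw [rowPhase, ← Finset.prod_mul_distrib]
    push_cast
    refine Finset.prod_congr rfl fun j _ => ?_
    rw [← mul_div_assoc, ← mul_pow]
    have hb' : (‖b j‖ : ℂ) ≠ 0 := by exact_mod_cast norm_ne_zero_iff.2 (hb j)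
    have := Complex.conj_mul' (b j)
    congr 2
    field_simp
    linear_combination Complex.log ((n : ℕ) : ℂ) * this
  rw [dirCol_apply, mul_left_comm (rowPhase b α), ← mul_assoc, h1, h2, ← Complex.ofReal_mul,
    mul_assoc, ← Finset.prod_mul_distrib]
  rfl

lemma norm_dirCol_apply {c : ℂ} {b : Fin d → ℂ} (hb : ∀ j, b j ≠ 0)
    (hc : c.re = 1 / 2 + ∑ j, ‖b j‖) (n : ℕ+) (α : Fin d → ℕ) :
    ‖dirCol c b n α‖
      = ((n : ℕ) : ℝ) ^ (-(1 / 2) : ℝ) * prodPoisson (fun j => ‖b j‖) (Real.log (n : ℕ)) α := by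
  have h := congrArg norm (colPhase_mul_rowPhase_mul_dirCol hb hc n α)
  rw [norm_mul, norm_mul, norm_colPhase, norm_rowPhase hb, one_mul, one_mul, Complex.norm_real,
    Real.norm_of_nonneg (mul_nonneg (by positivity)
      (prodPoisson_nonneg (fun j => norm_nonneg _) n.log_nonneg α))] at h
  exact h

/-- The constant in the norm estimate for the operator with columns `dirCol c b n`. -/
def colConst (b : Fin d → ℂ) (j₀ : Fin d) : ℝ := 2 ^ (1 + ‖b j₀‖) / ‖b j₀‖

lemma colConst_nonneg (b : Fin d → ℂ) (j₀ : Fin d) : 0 ≤ colConst b j₀ := by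
  unfold colConst; positivity

lemma natCast_rpow_neg_half_sq (m : ℕ) : ((m : ℝ) ^ (-(1 / 2) : ℝ)) ^ 2 = 1 / m := by
  rw [← Real.rpow_natCast, ← Real.rpow_mul (by positivity)]
  norm_num [Real.rpow_neg_one]

lemma norm_sum_dirCol_le {c : ℂ} {b : Fin d → ℂ} (hb : ∀ j, b j ≠ 0)
    (hc : c.re = 1 / 2 + ∑ j, ‖b j‖) (j₀ : Fin d) (s : Finset ℕ+) {δ : ℝ}
    (hδ : ∀ n ∈ s, ∀ j k, poissonWeight (‖b j‖ * Real.log (n : ℕ)) k ≤ δ) (hδ0 : 0 ≤ δ)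
    (x : ℕ+ → ℂ) :
    ‖∑ n ∈ s, x n • dirCol c b n‖
      ≤ √(δ ^ (d - 1) * colConst b j₀) * √(∑ n ∈ s, ‖x n‖ ^ 2) := by
  refine norm_sum_le_of_schur _ (fun n : ℕ+ => ((n : ℕ) : ℝ) ^ (-(1 / 2) : ℝ))
    (fun n α => prodPoisson (fun j => ‖b j‖) (Real.log (n : ℕ)) α)
    (fun n α => prodPoisson_nonneg (fun _ => norm_nonneg _) n.log_nonneg α)
    (fun n α => (norm_dirCol_apply hb hc n α).le)
    (fun n t => sum_prodPoisson_le_one (fun _ => norm_nonneg _) n.log_nonneg t) s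
    (mul_nonneg (pow_nonneg hδ0 _) (colConst_nonneg b j₀)) (fun α => ?_) x
  refine le_trans (le_of_eq (Finset.sum_congr rfl fun n _ => ?_))
    (sum_inv_mul_prodPoisson_le (fun j => norm_pos_iff.2 (hb j)) j₀ s hδ hδ0 α)
  rw [natCast_rpow_neg_half_sq]

end Columns

section CompositionOperator

variable {d : ℕ}

/-- The integer with exponents `α` with respect to `q`. -/
def monomialIndex (q : Fin d → ℕ) (hq : ∀ j, 0 < q j) (α : Fin d → ℕ) : ℕ+ :=
  ⟨∏ j, q j ^ α j, Finset.prod_pos fun j _ => pow_pos (hq j) _⟩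

lemma monomialIndex_injective {q : Fin d → ℕ} (hq : ∀ j, 0 < q j) (h : MultIndep q) :
    Function.Injective (monomialIndex q hq) := fun α β e =>
  h α β (congrArg PNat.val e)

lemma memℓp_conj_cpow {s : ℂ} (hs : 1 / 2 < s.re) :
    Memℓp (fun n : ℕ+ => starRingEnd ℂ (((n : ℕ) : ℂ) ^ (-s))) 2 := by
  refine memℓp_gen ?_
  have h : Summable fun n : ℕ => 1 / (n : ℝ) ^ (2 * s.re) :=
    Real.summable_one_div_nat_rpow.2 (by linarith)
  refine (h.comp_injective PNat.coe_injective).congr fun n => ?_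
  rw [Function.comp_apply, RCLike.norm_conj, Complex.norm_natCast_cpow_of_pos n.pos,
    ← Real.rpow_mul (by positivity), one_div, ← Real.rpow_neg (by positivity)]
  congr 1
  simp
  ring

/-- The reproducing kernel of `ℋ²` at `s`. -/
def dirKernel {s : ℂ} (hs : 1 / 2 < s.re) : H2 := ⟨_, memℓp_conj_cpow hs⟩

lemma inner_dirKernel {s : ℂ} (hs : 1 / 2 < s.re) (x : H2) :
    inner ℂ (dirKernel hs) x = H2series x s := by
  rw [lp.inner_eq_tsum, H2series]
  refine tsum_congr fun n => ?_
  rw [RCLike.inner_apply]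
  congr 1
  exact Complex.conj_conj _

lemma inner_dirKernel_stdVec {s : ℂ} (hs : 1 / 2 < s.re) (n : ℕ+) :
    inner ℂ (dirKernel hs) (stdVec n : H2) = ((n : ℕ) : ℂ) ^ (-s) := by
  rw [inner_dirKernel, H2series, tsum_eq_single n fun m hm => by simp [stdVec_apply, hm]]
  simp [stdVec_apply]

lemma isCompOp_push_comp {q : Fin d → ℕ} (hq : ∀ j, 0 < q j) (h : MultIndep q)
    (c : ℂ) (b : Fin d → ℂ) (T : H2 →L[ℂ] SqSum (Fin d → ℕ))
    (hT : ∀ x : H2, HasSum (fun n => x n • dirCol c b n) (T x)) :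
    IsCompOp (fun s => c - ∑ j, b j * (q j : ℂ) ^ (-s))
      ((SqSum.push _ (monomialIndex_injective hq h)).toContinuousLinearMap.comp T) := by
  intro x s hs
  set l : SqSum (Fin d → ℕ) →L[ℂ] ℂ := (innerSL ℂ (dirKernel hs)).comp
    (SqSum.push _ (monomialIndex_injective hq h)).toContinuousLinearMap with hl
  have hmono : ∀ α, l (stdVec α) = ∏ j, ((q j : ℂ) ^ (-s)) ^ α j := by
    intro α
    have : l (stdVec α) = inner ℂ (dirKernel hs) (stdVec (monomialIndex q hq α) : H2) := by
      rw [← SqSum.push_stdVec _ (monomialIndex_injective hq h)]; rfl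
    rw [this, inner_dirKernel_stdVec]
    simp only [monomialIndex, PNat.mk_coe, Nat.cast_prod, Nat.cast_pow]
    have : ∀ t : Finset (Fin d), (∏ j ∈ t, (q j : ℂ) ^ α j) ^ (-s)
        = ∏ j ∈ t, ((q j : ℂ) ^ (-s)) ^ α j := by
      intro t
      induction t using Finset.cons_induction with
      | empty => simp
      | cons j t hj ih =>
        rw [Finset.prod_cons, Finset.prod_cons, ← ih]
        have := Complex.natCast_mul_natCast_cpow (q j ^ α j) (∏ j ∈ t, q j ^ α j) (-s)
        push_cast at this
        rw [this, ← Complex.natCast_cpow_natCast_mul, Complex.cpow_nat_mul]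
    exact this _
  have e : H2series ((SqSum.push _ (monomialIndex_injective hq h)).toContinuousLinearMap.comp T x) s
      = l (T x) := (inner_dirKernel hs _).symm
  rw [e, H2series]
  refine (((hT x).mapL l).congr_of_eq (fun n => ?_) rfl).tsum_eq.symm
  have hn : ((n : ℕ) : ℂ) ≠ 0 := by exact_mod_cast n.pos.ne'
  rw [map_smul, smul_eq_mul, dirCol, map_smul, apply_exp_shiftSum _ _ _ _ hmono, smul_eq_mul,
    neg_sub, sub_eq_neg_add, Complex.cpow_add _ _ hn, Complex.cpow_def_of_ne_zero hn (∑ j, _),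
    ← Complex.natCast_log]

end CompositionOperator

section Operators

variable {d : ℕ} {c : ℂ} {b : Fin d → ℂ}

/-- The operator whose columns are the `dirCol c b n` with `U ≤ log n`. -/
lemma exists_tail_operator (hb : ∀ j, b j ≠ 0) (hc : c.re = 1 / 2 + ∑ j, ‖b j‖) (j₀ : Fin d)
    (U : ℝ) {δ : ℝ} (hδ0 : 0 ≤ δ)
    (hδ : ∀ u, 0 ≤ u → U ≤ u → ∀ j k, poissonWeight (‖b j‖ * u) k ≤ δ) :
    ∃ T : H2 →L[ℂ] SqSum (Fin d → ℕ), ‖T‖ ≤ √(δ ^ (d - 1) * colConst b j₀) ∧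
      ∀ x : H2, HasSum
        (fun n : ℕ+ => x n • if U ≤ Real.log (n : ℕ) then dirCol c b n else 0) (T x) := by
  refine exists_clm_of_norm_sum_le _ (Real.sqrt_nonneg _) fun s x => ?_
  have e : ∑ n ∈ s, x n • (if U ≤ Real.log (n : ℕ) then dirCol c b n else 0)
      = ∑ n ∈ s with U ≤ Real.log ((n : ℕ+) : ℕ), x n • dirCol c b n := by
    rw [Finset.sum_filter]
    refine Finset.sum_congr rfl fun n _ => ?_
    split_ifs <;> simp
  rw [e]
  refine (norm_sum_dirCol_le hb hc j₀ _ (fun n hn => hδ _ n.log_nonneg (Finset.mem_filter.1 hn).2)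
    hδ0 x).trans ?_
  gcongr
  exact Finset.filter_subset _ _

lemma exists_dirCol_operator (hb : ∀ j, b j ≠ 0) (hc : c.re = 1 / 2 + ∑ j, ‖b j‖)
    (j₀ : Fin d) :
    ∃ T : H2 →L[ℂ] SqSum (Fin d → ℕ), ∀ x : H2, HasSum (fun n => x n • dirCol c b n) (T x) := by
  obtain ⟨T, -, hT⟩ := exists_tail_operator hb hc j₀ 0 zero_le_one fun u hu _ j k =>
    poissonWeight_le_one (mul_nonneg (norm_nonneg _) hu) k
  refine ⟨T, fun x => (hT x).congr_of_eq (fun n => ?_) rfl⟩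
  rw [if_pos n.log_nonneg]

end Operators

section ApproxNumber

variable {E F G : Type*} [NormedAddCommGroup E] [NormedSpace ℂ E]
  [NormedAddCommGroup F] [NormedSpace ℂ F] [NormedAddCommGroup G] [NormedSpace ℂ G]

lemma approxNumber_le (T R : E →L[ℂ] F) {n : ℕ}
    (h : FiniteDimensional ℂ (LinearMap.range (R : E →ₗ[ℂ] F)))
    (hn : Module.finrank ℂ (LinearMap.range (R : E →ₗ[ℂ] F)) < n) :
    approxNumber T n ≤ ‖T - R‖ :=
  csInf_le ⟨0, fun _ ⟨_, _, _, e⟩ => e ▸ norm_nonneg _⟩ ⟨R, h, hn, rfl⟩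

lemma finiteDimensional_range_zero :
    FiniteDimensional ℂ (LinearMap.range ((0 : E →L[ℂ] F) : E →ₗ[ℂ] F)) := by
  rw [ContinuousLinearMap.toLinearMap_zero, LinearMap.range_zero]; infer_instance

lemma finrank_range_zero_lt {n : ℕ} (hn : 0 < n) :
    Module.finrank ℂ (LinearMap.range ((0 : E →L[ℂ] F) : E →ₗ[ℂ] F)) < n := by
  rw [ContinuousLinearMap.toLinearMap_zero, LinearMap.range_zero]; simpa using hn

lemma approxNumber_le_norm (T : E →L[ℂ] F) {n : ℕ} (hn : 0 < n) : approxNumber T n ≤ ‖T‖ := by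
  simpa using approxNumber_le T 0 finiteDimensional_range_zero (finrank_range_zero_lt hn)

lemma le_approxNumber (T : E →L[ℂ] F) {n : ℕ} (hn : 0 < n) {c : ℝ}
    (h : ∀ R : E →L[ℂ] F, FiniteDimensional ℂ (LinearMap.range (R : E →ₗ[ℂ] F)) →
      Module.finrank ℂ (LinearMap.range (R : E →ₗ[ℂ] F)) < n → c ≤ ‖T - R‖) :
    c ≤ approxNumber T n :=
  le_csInf ⟨_, 0, finiteDimensional_range_zero, finrank_range_zero_lt hn, rfl⟩
    fun _ ⟨R, h1, h2, e⟩ => e ▸ h R h1 h2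

lemma approxNumber_comp_le (J : F →L[ℂ] G) (hJ : ‖J‖ ≤ 1) (T R : E →L[ℂ] F)
    {κ : Type*} [Fintype κ] (w : κ → F) (hR : ∀ x, R x ∈ Submodule.span ℂ (Set.range w))
    {n : ℕ} (hn : Fintype.card κ < n) : approxNumber (J.comp T) n ≤ ‖T - R‖ := by
  have hle : LinearMap.range ((J.comp R : E →L[ℂ] G) : E →ₗ[ℂ] G)
      ≤ Submodule.span ℂ (Set.range (J ∘ w)) := by
    rintro _ ⟨x, rfl⟩
    rw [Set.range_comp]
    exact Submodule.image_span_subset_span (J : F →ₗ[ℂ] G) _ ⟨R x, hR x, rfl⟩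
  have hfd : FiniteDimensional ℂ (Submodule.span ℂ (Set.range (J ∘ w))) :=
    FiniteDimensional.span_of_finite ℂ (Set.finite_range _)
  refine (approxNumber_le (J.comp T) (J.comp R) (Submodule.finiteDimensional_of_le hle)
    (((Submodule.finrank_mono hle).trans (finrank_range_le_card _)).trans_lt hn)).trans ?_
  rw [← ContinuousLinearMap.comp_sub]
  exact (ContinuousLinearMap.opNorm_comp_le _ _).trans
    (mul_le_of_le_one_left (norm_nonneg _) hJ)

end ApproxNumber

section UpperBound

variable {d : ℕ} {c : ℂ} {b : Fin d → ℂ}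

lemma sum_inv_le_of_log_le {s : Finset ℕ+} {U : ℝ} (hU : 0 ≤ U)
    (hs : ∀ n ∈ s, Real.log (n : ℕ) ≤ U) : ∑ n ∈ s, (1 / (n : ℕ) : ℝ) ≤ 1 + U := by
  rcases s.eq_empty_or_nonempty with rfl | hne
  · simp; linarith
  obtain ⟨m, hm, hmax⟩ := s.exists_max_image (fun n => n) hne
  have h1 : ∑ n ∈ s, (1 / (n : ℕ) : ℝ) ≤ ∑ i ∈ Finset.Icc 1 (m : ℕ), (1 / i : ℝ) := by
    refine (Finset.sum_map s ⟨PNat.val, PNat.coe_injective⟩ fun i : ℕ => (1 / i : ℝ)).ge.trans ?_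
    refine Finset.sum_le_sum_of_subset_of_nonneg (fun i hi => ?_) fun i _ _ => by positivity
    obtain ⟨n, hn, rfl⟩ := Finset.mem_map.1 hi
    exact Finset.mem_Icc.2 ⟨n.pos, hmax n hn⟩
  have h2 := harmonic_le_one_add_log (m : ℕ)
  rw [harmonic_eq_sum_Icc] at h2
  push_cast at h2
  simp only [one_div] at h1 ⊢
  linarith [hs m hm]

/-- The vectors spanning the range of the finite rank approximations. -/
def approxVec (b : Fin d → ℂ) (j m : ℕ) : SqSum (Fin d → ℕ) :=
  ((((∑ i, ‖b i‖ : ℝ) : ℂ) • (1 : SqSum (Fin d → ℕ) →L[ℂ] SqSum (Fin d → ℕ)) - shiftSum b) ^ m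
    * NormedSpace.exp (-((((j : ℝ) + 1) ^ 2 : ℝ) : ℂ) •
      (((∑ i, ‖b i‖ : ℝ) : ℂ) • (1 : SqSum (Fin d → ℕ) →L[ℂ] SqSum (Fin d → ℕ)) - shiftSum b)))
    (stdVec 0)

/-- Taylor approximation of a column in one block. -/
lemma exists_mem_span_norm_dirCol_sub_le (hc : c.re = 1 / 2 + ∑ j, ‖b j‖)
    (hR : 0 < ∑ j, ‖b j‖) {N M : ℕ} (hM : 16 * Real.exp 1 ^ 2 * ∑ j, ‖b j‖ ≤ M) (n : ℕ+)
    (hn : Real.log (n : ℕ) < (N : ℝ) ^ 2) :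
    ∃ y ∈ Submodule.span ℂ (Set.range fun p : Fin N × Fin M => approxVec b p.1 p.2),
      ‖dirCol c b n - y‖ ≤ ((n : ℕ) : ℝ) ^ (-(1 / 2) : ℝ) * (2 * (1 / 2) ^ M) := by
  set R := ∑ j, ‖b j‖ with hRdef
  set u := Real.log (n : ℕ) with hu
  have hu0 : 0 ≤ u := n.log_nonneg
  set j := ⌊√u⌋₊ with hj
  have hju : (j : ℝ) ≤ √u := Nat.floor_le (Real.sqrt_nonneg _)
  have huj : √u < j + 1 := Nat.lt_floor_add_one _
  have hjN : j < N := by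
    rw [hj, Nat.floor_lt (Real.sqrt_nonneg _)]
    exact (Real.sqrt_lt' (by
      by_contra h
      have : (N : ℝ) = 0 := le_antisymm (not_lt.1 h) (Nat.cast_nonneg _)
      rw [this] at hn
      norm_num at hn
      linarith)).2 hn
  have hsq : √u ^ 2 = u := Real.sq_sqrt hu0
  set v : ℝ := ((j : ℝ) + 1) ^ 2 with hv
  have hv0 : 0 < v := by positivity
  have hsv : √v = j + 1 := Real.sqrt_sq (by positivity)
  have hj0 : (0 : ℝ) ≤ j := Nat.cast_nonneg _
  have huv : |v - u| ≤ 2 * √v := by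
    rw [hsv, abs_le, hv, ← hsq]
    constructor <;> nlinarith
  have key := norm_exp_sub_taylor_le hR (norm_shiftSum_le b) hv0 huv hM
  set Q := ((R : ℂ) • (1 : SqSum (Fin d → ℕ) →L[ℂ] SqSum (Fin d → ℕ)) - shiftSum b) with hQ
  set γ : ℂ := ((n : ℕ) : ℂ) ^ (-c) * Complex.exp (u * R) with hγ
  have hγn : ‖γ‖ = ((n : ℕ) : ℝ) ^ (-(1 / 2) : ℝ) := by
    have hnpos : (0 : ℝ) < (n : ℕ) := by exact_mod_cast n.pos
    rw [hγ, norm_mul, Complex.norm_natCast_cpow_of_pos n.pos, ← Complex.ofReal_mul,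
      Complex.norm_exp_ofReal, Complex.neg_re, hc, Real.rpow_def_of_pos hnpos,
      Real.rpow_def_of_pos hnpos, ← Real.exp_add]
    congr 1
    ring
  have hcol : dirCol c b n = γ • NormedSpace.exp (-(u : ℂ) • Q) (stdVec 0) := by
    rw [hQ, exp_neg_smul_sub, smul_apply, smul_smul, hγ, mul_assoc, ← Complex.exp_add,
      add_neg_cancel, Complex.exp_zero, mul_one]
    rfl
  refine ⟨γ • (∑ m ∈ Finset.range M, (((v - u : ℝ) : ℂ) ^ m / m.factorial) •
    (Q ^ m * NormedSpace.exp (-(v : ℂ) • Q))) (stdVec 0), ?_, ?_⟩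
  · refine Submodule.smul_mem _ _ ?_
    rw [sum_apply]
    refine Submodule.sum_mem _ fun m hm => ?_
    rw [smul_apply]
    exact Submodule.smul_mem _ _ (Submodule.subset_span
      ⟨(⟨j, hjN⟩, ⟨m, Finset.mem_range.1 hm⟩), rfl⟩)
  · rw [hcol, ← smul_sub, ← sub_apply, norm_smul, hγn]
    gcongr
    refine (ContinuousLinearMap.le_opNorm _ _).trans ?_
    rw [norm_stdVec, mul_one]
    exact key

lemma exists_approximation (hb : ∀ j, b j ≠ 0) (hc : c.re = 1 / 2 + ∑ j, ‖b j‖) (j₀ : Fin d)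
    {ρ : ℝ} (hρ : 0 < ρ) (hρb : ∀ j, ρ ≤ ‖b j‖)
    (T : H2 →L[ℂ] SqSum (Fin d → ℕ)) (hT : ∀ x : H2, HasSum (fun n => x n • dirCol c b n) (T x))
    {N M : ℕ} (hN : 0 < N) (hM : 16 * Real.exp 1 ^ 2 * ∑ j, ‖b j‖ ≤ M) :
    ∃ R : H2 →L[ℂ] SqSum (Fin d → ℕ),
      (∀ x, R x ∈ Submodule.span ℂ (Set.range fun p : Fin N × Fin M => approxVec b p.1 p.2)) ∧
      ‖T - R‖ ≤ √((1 / (√ρ * N)) ^ (d - 1) * colConst b j₀) + 4 * N * (1 / 2) ^ M := by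
  have hN1 : (1 : ℝ) ≤ N := by exact_mod_cast hN
  have hR : 0 < ∑ j, ‖b j‖ :=
    Finset.sum_pos (fun j _ => norm_pos_iff.2 (hb j)) ⟨j₀, Finset.mem_univ _⟩
  obtain ⟨Tt, hTt, hTts⟩ := exists_tail_operator hb hc j₀ ((N : ℝ) ^ 2)
    (δ := 1 / (√ρ * N)) (by positivity) (fun u hu hNu j k => by
      have hu' : 0 < u := lt_of_lt_of_le (by positivity) hNu
      refine (poissonWeight_le_inv_sqrt (mul_pos (norm_pos_iff.2 (hb j)) hu') k).trans ?_
      have : √ρ * N = √(ρ * N ^ 2) := by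
        rw [Real.sqrt_mul hρ.le, Real.sqrt_sq (Nat.cast_nonneg _)]
      rw [this]
      gcongr
      exact hρb j)
  choose y hymem hy using fun n : ℕ+ => exists_mem_span_norm_dirCol_sub_le (N := N) hc hR hM n
  set Y : ℕ+ → SqSum (Fin d → ℕ) := fun n =>
    if h : Real.log (n : ℕ) < (N : ℝ) ^ 2 then y n h else 0 with hY
  set e : ℕ+ → SqSum (Fin d → ℕ) := fun n =>
    if Real.log (n : ℕ) < (N : ℝ) ^ 2 then dirCol c b n - Y n else 0 with he
  have hE : ∀ (s : Finset ℕ+) (x : ℕ+ → ℂ),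
      ‖∑ n ∈ s, x n • e n‖ ≤ (4 * N * (1 / 2) ^ M) * √(∑ n ∈ s, ‖x n‖ ^ 2) := by
    intro s x
    have hs : ∑ n ∈ s, ‖e n‖ ^ 2 ≤ (4 * N * (1 / 2) ^ M) ^ 2 := by
      calc ∑ n ∈ s, ‖e n‖ ^ 2
          ≤ ∑ n ∈ s with Real.log ((n : ℕ+) : ℕ) < (N : ℝ) ^ 2,
              (1 / (n : ℕ) : ℝ) * (2 * (1 / 2) ^ M) ^ 2 := by
            rw [Finset.sum_filter]
            refine Finset.sum_le_sum fun n _ => ?_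
            simp only [he]
            split_ifs with h
            · have h1 : ‖dirCol c b n - Y n‖
                  ≤ ((n : ℕ) : ℝ) ^ (-(1 / 2) : ℝ) * (2 * (1 / 2) ^ M) := by
                simp only [hY, h, dif_pos]; exact hy n h
              rw [← natCast_rpow_neg_half_sq, ← mul_pow]
              gcongr
            · simp
        _ ≤ (1 + (N : ℝ) ^ 2) * (2 * (1 / 2) ^ M) ^ 2 := by
            rw [← Finset.sum_mul]
            gcongr
            exact sum_inv_le_of_log_le (by positivity) fun n hn => (Finset.mem_filter.1 hn).2.le
        _ ≤ _ := by
            have : (1 + (N : ℝ) ^ 2) * 4 ≤ 16 * N ^ 2 := by nlinarith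
            calc _ = ((1 + (N : ℝ) ^ 2) * 4) * ((1 / 2) ^ M) ^ 2 := by ring
              _ ≤ (16 * N ^ 2) * ((1 / 2) ^ M) ^ 2 := by gcongr
              _ = _ := by ring
    have := norm_sum_smul_le_of_sum_sq_le e s hs x
    rwa [Real.sqrt_sq (by positivity)] at this
  obtain ⟨E, hEn, hEs⟩ := exists_clm_of_norm_sum_le e (by positivity) hE
  refine ⟨T - Tt - E, fun x => ?_, ?_⟩
  · have hsum := ((hT x).sub (hTts x)).sub (hEs x)
    have : FiniteDimensional ℂ
        (Submodule.span ℂ (Set.range fun p : Fin N × Fin M => approxVec b p.1 p.2)) :=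
      FiniteDimensional.span_of_finite ℂ (Set.finite_range _)
    have hclosed := Submodule.closed_of_finiteDimensional
      (Submodule.span ℂ (Set.range fun p : Fin N × Fin M => approxVec b p.1 p.2))
    refine hclosed.mem_of_tendsto hsum (Eventually.of_forall fun s => ?_)
    refine Submodule.sum_mem _ fun n _ => ?_
    rw [← smul_sub, ← smul_sub]
    refine Submodule.smul_mem _ _ ?_
    simp only [he, hY]
    by_cases h : Real.log (n : ℕ) < (N : ℝ) ^ 2
    · simpa [h, not_le.2 h] using hymem n h
    · simp [h, not_lt.1 h]
  · have : T - (T - Tt - E) = Tt + E := by abel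
    rw [this]
    exact (norm_add_le _ _).trans (add_le_add hTt hEn)

end UpperBound

section UpperRate

lemma rpow_neg_le_of_le_mul {x y k p : ℝ} (hx : 0 < x) (hy : 0 < y) (hk : 0 ≤ k) (hp : 0 ≤ p)
    (h : y ≤ k * x) : x ^ (-p) ≤ k ^ p * y ^ (-p) := by
  have h1 := Real.rpow_le_rpow hy.le h hp
  rw [Real.mul_rpow hk hx.le] at h1
  rw [Real.rpow_neg hx.le, Real.rpow_neg hy.le, ← div_eq_mul_inv, le_div_iff₀ (by positivity),
    inv_mul_le_iff₀ (by positivity)]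
  linarith

/-- Optimization of the block length in the two-parameter upper estimate. -/
lemma exists_le_mul_div_log_rpow {a : ℕ → ℝ} {p K B : ℝ} (hp : 0 ≤ p) (hK : 0 ≤ K) (hB : 0 ≤ B)
    (M₀ : ℕ) (h1 : ∀ n, 0 < n → a n ≤ B)
    (h2 : ∀ N M n : ℕ, 0 < N → M₀ ≤ M → N * M < n →
      a n ≤ K * (N : ℝ) ^ (-p) + 4 * N * (1 / 2) ^ M) :
    ∃ C : ℝ, 0 < C ∧ ∀ n : ℕ, 2 ≤ n → a n ≤ C * ((n : ℝ) / Real.log n) ^ (-p) := by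
  have hl2 : 0 < Real.log 2 := Real.log_pos one_lt_two
  set K' := (p + 1) / Real.log 2 with hK'
  have hK'0 : 0 < K' := by positivity
  set K₂ := K' + (M₀ + 1) / Real.log 2 with hK₂
  have hK₂0 : 0 < K₂ := by positivity
  refine ⟨B * K₂ ^ p + K * (2 * K₂) ^ p + 4 * (1 / Real.log 2) ^ p + 1, by positivity,
    fun n hn => ?_⟩
  have hn2 : (2 : ℝ) ≤ n := by exact_mod_cast hn
  have hln : Real.log 2 ≤ Real.log n := Real.log_le_log two_pos hn2
  have hln0 : 0 < Real.log n := hl2.trans_le hln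
  have hn0 : (0 : ℝ) < n := by linarith
  have hy : 0 < (n : ℝ) / Real.log n := by positivity
  set Z := ((n : ℝ) / Real.log n) ^ (-p) with hZ
  have hZ0 : 0 < Z := Real.rpow_pos_of_pos hy _
  set M := M₀ + ⌈K' * Real.log n⌉₊ with hM
  have hMl : K' * Real.log n ≤ M := by
    have := Nat.le_ceil (K' * Real.log n)
    rw [hM]; push_cast
    have : (0 : ℝ) ≤ M₀ := Nat.cast_nonneg _
    linarith
  have hMu : (M : ℝ) ≤ K₂ * Real.log n := by
    have h3 := Nat.ceil_lt_add_one (show 0 ≤ K' * Real.log n by positivity)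
    have h4 : (M₀ + 1 : ℝ) ≤ (M₀ + 1) / Real.log 2 * Real.log n := by
      rw [div_mul_eq_mul_div, le_div_iff₀ hl2]
      gcongr
    rw [hM, hK₂, add_mul]; push_cast
    linarith
  have hM0 : 0 < M := by
    have : (0 : ℝ) < M := lt_of_lt_of_le (by positivity) hMl
    exact_mod_cast this
  have hdiv := Nat.div_mul_le_self (n - 1) M
  have hdiv2 := Nat.lt_div_mul_add (a := n - 1) hM0
  set N := (n - 1) / M with hN
  have t1 : 0 ≤ B * K₂ ^ p := by positivity
  have t2 : 0 ≤ K * (2 * K₂) ^ p := by positivity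
  have t3 : 0 ≤ 4 * (1 / Real.log 2) ^ p := by positivity
  rcases Nat.eq_zero_or_pos N with h0 | h0
  · have hnM : (n : ℝ) ≤ M := by
      rw [h0] at hdiv2
      exact_mod_cast (by omega : n ≤ M)
    have h5 : (n : ℝ) / Real.log n ≤ K₂ * 1 := by
      rw [mul_one, div_le_iff₀ hln0]; linarith
    have h6 := rpow_neg_le_of_le_mul one_pos hy hK₂0.le hp h5
    rw [Real.one_rpow] at h6
    calc a n ≤ B * 1 := by rw [mul_one]; exact h1 n (by omega)
      _ ≤ B * (K₂ ^ p * Z) := by gcongr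
      _ = (B * K₂ ^ p) * Z := by ring
      _ ≤ _ := mul_le_mul_of_nonneg_right (by linarith) hZ0.le
  · have hN0 : (0 : ℝ) < N := by exact_mod_cast h0
    have hnNM : (n : ℝ) ≤ 2 * N * M := by
      have : n ≤ 2 * N * M := by
        nlinarith [Nat.mul_le_mul_right M h0, Nat.sub_add_cancel (by omega : 1 ≤ n)]
      exact_mod_cast this
    have h5 : (n : ℝ) / Real.log n ≤ (2 * K₂) * N := by
      rw [div_le_iff₀ hln0]
      calc (n : ℝ) ≤ 2 * N * M := hnNM
        _ ≤ 2 * N * (K₂ * Real.log n) := by gcongr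
        _ = _ := by ring
    have h6 := rpow_neg_le_of_le_mul hN0 hy (by positivity) hp h5
    have h7 : (n : ℝ) / Real.log n ≤ (1 / Real.log 2) * n := by
      rw [one_div_mul_eq_div]; gcongr
    have h8 := rpow_neg_le_of_le_mul hn0 hy (by positivity) hp h7
    have hNn : (N : ℝ) ≤ n := by
      exact_mod_cast (Nat.div_le_self _ _).trans (Nat.sub_le _ _)
    have h9 : ((1 : ℝ) / 2) ^ M ≤ (n : ℝ) ^ (-p) / n := by
      have e1 : ((1 : ℝ) / 2) ^ M = Real.exp (-(M * Real.log 2)) := by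
        rw [← mul_neg, Real.exp_nat_mul, Real.exp_neg, Real.exp_log two_pos, one_div]
      rw [e1, ← Real.rpow_sub_one hn0.ne', Real.rpow_def_of_pos hn0]
      apply Real.exp_le_exp.2
      have : K' * Real.log n * Real.log 2 = (p + 1) * Real.log n := by
        rw [hK']; field_simp
      nlinarith
    calc a n ≤ K * (N : ℝ) ^ (-p) + 4 * N * (1 / 2) ^ M :=
          h2 N M n h0 (Nat.le_add_right _ _) (by omega)
      _ ≤ K * ((2 * K₂) ^ p * Z) + 4 * n * ((n : ℝ) ^ (-p) / n) := by gcongr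
      _ = K * ((2 * K₂) ^ p * Z) + 4 * (n : ℝ) ^ (-p) := by field_simp
      _ ≤ K * ((2 * K₂) ^ p * Z) + 4 * ((1 / Real.log 2) ^ p * Z) := by gcongr
      _ = (K * (2 * K₂) ^ p + 4 * (1 / Real.log 2) ^ p) * Z := by ring
      _ ≤ _ := mul_le_mul_of_nonneg_right (by linarith) hZ0.le

variable {d : ℕ} {c : ℂ} {b : Fin d → ℂ} {F : Type*} [NormedAddCommGroup F] [NormedSpace ℂ F]

lemma exists_approxNumber_comp_le (hd : 0 < d) (hb : ∀ j, b j ≠ 0)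
    (hc : c.re = 1 / 2 + ∑ j, ‖b j‖)
    (T : H2 →L[ℂ] SqSum (Fin d → ℕ)) (hT : ∀ x : H2, HasSum (fun n => x n • dirCol c b n) (T x))
    (J : SqSum (Fin d → ℕ) →L[ℂ] F) (hJ : ‖J‖ ≤ 1) :
    ∃ C : ℝ, 0 < C ∧ ∀ n : ℕ, 2 ≤ n →
      approxNumber (J.comp T) n ≤ C * ((n : ℝ) / Real.log n) ^ (-(((d : ℝ) - 1) / 2)) := by
  have : Nonempty (Fin d) := ⟨⟨0, hd⟩⟩
  obtain ⟨j₀, hj₀⟩ := Finite.exists_min fun j => ‖b j‖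
  have hρ : 0 < ‖b j₀‖ := norm_pos_iff.2 (hb j₀)
  have hd1 : ((d - 1 : ℕ) : ℝ) = (d : ℝ) - 1 := by rw [Nat.cast_sub hd, Nat.cast_one]
  refine exists_le_mul_div_log_rpow (K := √((1 / √‖b j₀‖) ^ (d - 1) * colConst b j₀))
    (B := ‖J.comp T‖) (by rw [← hd1]; positivity) (Real.sqrt_nonneg _) (norm_nonneg _)
    ⌈16 * Real.exp 1 ^ 2 * ∑ j, ‖b j‖⌉₊ (fun n hn => approxNumber_le_norm _ hn)
    fun N M n hN hM hn => ?_
  obtain ⟨R, hR, hTR⟩ := exists_approximation hb hc j₀ hρ hj₀ T hT hN (Nat.ceil_le.1 hM)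
  refine (approxNumber_comp_le J hJ T R _ hR (by simpa using hn)).trans (hTR.trans (le_of_eq ?_))
  have hN0 : (0 : ℝ) ≤ N := Nat.cast_nonneg _
  have e : (1 / (√‖b j₀‖ * N)) ^ (d - 1) * colConst b j₀
      = (1 / √‖b j₀‖) ^ (d - 1) * colConst b j₀ * ((N : ℝ) ^ (d - 1))⁻¹ := by
    rw [← one_div_mul_one_div, mul_pow, one_div_pow (N : ℝ), one_div ((N : ℝ) ^ (d - 1))]; ring
  rw [e, Real.sqrt_mul (mul_nonneg (by positivity) (colConst_nonneg b j₀)), Real.sqrt_inv,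
    Real.rpow_neg hN0, ← hd1, Real.sqrt_eq_rpow ((N : ℝ) ^ (d - 1)), ← Real.rpow_natCast_mul hN0,
    mul_one_div]

end UpperRate

section LowerAbstract

lemma le_approxNumber_of_test {E F : Type*} [NormedAddCommGroup E] [NormedSpace ℂ E]
    [NormedAddCommGroup F] [NormedSpace ℂ F] (T : E →L[ℂ] F) {n : ℕ} (hn : 0 < n)
    (x : Fin n → E) {A B : ℝ} (hB : 0 < B)
    (hx : ∀ c : Fin n → ℂ, ‖∑ i, c i • x i‖ ≤ B * √(∑ i, ‖c i‖ ^ 2))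
    (hT : ∀ c : Fin n → ℂ, A * √(∑ i, ‖c i‖ ^ 2) ≤ ‖T (∑ i, c i • x i)‖) :
    A / B ≤ approxNumber T n := by
  refine le_approxNumber T hn fun R hfd hR => ?_
  set φ : (Fin n → ℂ) →ₗ[ℂ] LinearMap.range (R : E →ₗ[ℂ] F) :=
    (R : E →ₗ[ℂ] F).rangeRestrict ∘ₗ Fintype.linearCombination ℂ x with hφ
  obtain ⟨c, hc, hc0⟩ := (Submodule.ne_bot_iff _).1
    (LinearMap.ker_ne_bot_of_finrank_lt (f := φ) (by simpa using hR))
  have hRc : R (∑ i, c i • x i) = 0 := by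
    have := congrArg Subtype.val (LinearMap.mem_ker.1 hc)
    simpa [hφ, Fintype.linearCombination_apply] using this
  have hpos : 0 < √(∑ i, ‖c i‖ ^ 2) := by
    obtain ⟨i, hi⟩ := Function.ne_iff.1 hc0
    refine Real.sqrt_pos.2 (Finset.sum_pos' (fun _ _ => sq_nonneg _) ⟨i, Finset.mem_univ _, ?_⟩)
    exact pow_pos (norm_pos_iff.2 hi) 2
  rw [div_le_iff₀ hB]
  refine le_of_mul_le_mul_right ?_ hpos
  calc A * √(∑ i, ‖c i‖ ^ 2) ≤ ‖T (∑ i, c i • x i)‖ := hT c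
    _ = ‖(T - R) (∑ i, c i • x i)‖ := by rw [sub_apply, hRc, sub_zero]
    _ ≤ ‖T - R‖ * ‖∑ i, c i • x i‖ := ContinuousLinearMap.le_opNorm _ _
    _ ≤ ‖T - R‖ * (B * √(∑ i, ‖c i‖ ^ 2)) := by gcongr; exact hx c
    _ = _ := by ring

/-- A real matrix with dominant diagonal is bounded below on `ℓ²`. -/
lemma sum_sq_norm_le_of_diagonal {ι : Type*} [Fintype ι] [DecidableEq ι] (e : ι → ι → ℝ)
    (h0 : ∀ i k, 0 ≤ e i k) (hdiag : ∀ i, 1 / 2 ≤ e i i)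
    (hrow : ∀ i, ∑ k ∈ Finset.univ.erase i, e i k ≤ 1 / 4)
    (hcol : ∀ k, ∑ i ∈ Finset.univ.erase k, e i k ≤ 1 / 4) (c : ι → ℂ) :
    ∑ i, ‖c i‖ ^ 2 ≤ 16 * ∑ i, ‖∑ k, (e i k : ℂ) * c k‖ ^ 2 := by
  set ρ : ι → ℂ := fun i => ∑ k ∈ Finset.univ.erase i, (e i k : ℂ) * c k with hρ
  have h1 : ∀ i, ‖ρ i‖ ^ 2 ≤ 1 / 4 * ∑ k ∈ Finset.univ.erase i, e i k * ‖c k‖ ^ 2 := by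
    intro i
    have a1 : ‖ρ i‖ ≤ ∑ k ∈ Finset.univ.erase i, e i k * ‖c k‖ :=
      (norm_sum_le _ _).trans (le_of_eq (Finset.sum_congr rfl fun k _ => by
        rw [norm_mul, Complex.norm_real, Real.norm_of_nonneg (h0 i k)]))
    have a2 : (∑ k ∈ Finset.univ.erase i, e i k * ‖c k‖) ^ 2
        ≤ (∑ k ∈ Finset.univ.erase i, e i k) * ∑ k ∈ Finset.univ.erase i, e i k * ‖c k‖ ^ 2 :=
      Finset.sum_sq_le_sum_mul_sum_of_sq_le_mul _ (fun k _ => h0 i k)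
        (fun k _ => mul_nonneg (h0 i k) (sq_nonneg _)) fun k _ => le_of_eq (by ring)
    have a3 : 0 ≤ ∑ k ∈ Finset.univ.erase i, e i k * ‖c k‖ ^ 2 :=
      Finset.sum_nonneg fun k _ => mul_nonneg (h0 i k) (sq_nonneg _)
    calc ‖ρ i‖ ^ 2 ≤ (∑ k ∈ Finset.univ.erase i, e i k * ‖c k‖) ^ 2 := by gcongr
      _ ≤ _ := a2
      _ ≤ _ := by gcongr; exact hrow i
  have h2 : ∑ i, ‖ρ i‖ ^ 2 ≤ 1 / 16 * ∑ k, ‖c k‖ ^ 2 := by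
    calc ∑ i, ‖ρ i‖ ^ 2
        ≤ ∑ i, 1 / 4 * ∑ k ∈ Finset.univ.erase i, e i k * ‖c k‖ ^ 2 :=
          Finset.sum_le_sum fun i _ => h1 i
      _ = 1 / 4 * ∑ k, (∑ i ∈ Finset.univ.erase k, e i k) * ‖c k‖ ^ 2 := by
          rw [← Finset.mul_sum]
          congr 1
          simp_rw [Finset.sum_mul]
          exact Finset.sum_comm' fun i k => by simp [ne_comm]
      _ ≤ 1 / 4 * ∑ k, 1 / 4 * ‖c k‖ ^ 2 := by
          gcongr with k _
          exact hcol k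
      _ = _ := by rw [← Finset.mul_sum]; ring
  have h3 : ∀ i, 1 / 8 * ‖c i‖ ^ 2 - ‖ρ i‖ ^ 2 ≤ ‖∑ k, (e i k : ℂ) * c k‖ ^ 2 := by
    intro i
    rw [← Finset.add_sum_erase _ _ (Finset.mem_univ i)]
    change _ ≤ ‖(e i i : ℂ) * c i + ρ i‖ ^ 2
    have a1 : 1 / 2 * ‖c i‖ ≤ ‖(e i i : ℂ) * c i‖ := by
      rw [norm_mul, Complex.norm_real, Real.norm_of_nonneg (h0 i i)]
      gcongr
      exact hdiag i
    have a2 : ‖(e i i : ℂ) * c i‖ ≤ ‖(e i i : ℂ) * c i + ρ i‖ + ‖ρ i‖ := by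
      simpa using norm_sub_le ((e i i : ℂ) * c i + ρ i) (ρ i)
    nlinarith [norm_nonneg (c i), norm_nonneg (ρ i), norm_nonneg ((e i i : ℂ) * c i + ρ i),
      sq_nonneg (‖(e i i : ℂ) * c i + ρ i‖ - ‖ρ i‖)]
  have h4 := Finset.sum_le_sum fun i (_ : i ∈ Finset.univ) => h3 i
  rw [Finset.sum_sub_distrib, ← Finset.mul_sum] at h4
  linarith

lemma sum_sq_norm_le_of_test_sets {ι κ : Type*} [Fintype ι] [DecidableEq ι] [DecidableEq κ]
    (y : ι → SqSum κ) (G : ι → Finset κ) (hG : Pairwise fun i k => Disjoint (G i) (G k))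
    {g : ℝ} (hg : ∀ i, ((G i).card : ℝ) ≤ g) (θ : κ → ℂ) (hθ : ∀ α, ‖θ α‖ = 1)
    (e : ι → ι → ℝ) (he : ∀ i k, ∑ α ∈ G i, θ α * y k α = (e i k : ℂ))
    (h0 : ∀ i k, 0 ≤ e i k) (hdiag : ∀ i, 1 / 2 ≤ e i i)
    (hrow : ∀ i, ∑ k ∈ Finset.univ.erase i, e i k ≤ 1 / 4)
    (hcol : ∀ k, ∑ i ∈ Finset.univ.erase k, e i k ≤ 1 / 4) (c : ι → ℂ) :
    ∑ i, ‖c i‖ ^ 2 ≤ 16 * g * ‖∑ k, c k • y k‖ ^ 2 := by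
  set Y := ∑ k, c k • y k with hY
  have hYα : ∀ α, Y α = ∑ k, c k * y k α := fun α => by
    rw [← SqSum.eval_apply, hY, map_sum]; simp
  have h1 : ∀ i, ∑ k, (e i k : ℂ) * c k = ∑ α ∈ G i, θ α * Y α := by
    intro i
    simp_rw [← he, hYα, Finset.mul_sum, Finset.sum_mul]
    rw [Finset.sum_comm]
    exact Finset.sum_congr rfl fun α _ => Finset.sum_congr rfl fun k _ => by ring
  have h2 : ∀ i, ‖∑ k, (e i k : ℂ) * c k‖ ^ 2 ≤ g * ∑ α ∈ G i, ‖Y α‖ ^ 2 := by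
    intro i
    have a1 : ‖∑ k, (e i k : ℂ) * c k‖ ≤ ∑ α ∈ G i, ‖Y α‖ := by
      rw [h1]
      exact (norm_sum_le _ _).trans (le_of_eq (Finset.sum_congr rfl fun α _ => by
        rw [norm_mul, hθ, one_mul]))
    calc ‖∑ k, (e i k : ℂ) * c k‖ ^ 2 ≤ (∑ α ∈ G i, ‖Y α‖) ^ 2 := by gcongr
      _ ≤ (G i).card * ∑ α ∈ G i, ‖Y α‖ ^ 2 := sq_sum_le_card_mul_sum_sq
      _ ≤ _ := by gcongr; exact hg i
  rcases isEmpty_or_nonempty ι with hι | ⟨⟨i₀⟩⟩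
  · simp [hY]
  have hg0 : 0 ≤ g := (Nat.cast_nonneg _).trans (hg i₀)
  calc ∑ i, ‖c i‖ ^ 2 ≤ 16 * ∑ i, ‖∑ k, (e i k : ℂ) * c k‖ ^ 2 :=
        sum_sq_norm_le_of_diagonal e h0 hdiag hrow hcol c
    _ ≤ 16 * ∑ i, g * ∑ α ∈ G i, ‖Y α‖ ^ 2 := by
        gcongr with i _
        exact h2 i
    _ = 16 * g * ∑ α ∈ Finset.univ.biUnion G, ‖Y α‖ ^ 2 := by
        rw [Finset.sum_biUnion fun i _ k _ hik => hG hik, ← Finset.mul_sum, mul_assoc]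
    _ ≤ _ := by
        gcongr
        exact Y.sum_sq_norm_le _

lemma SqSum.norm_sum_smul_le_of_disjoint {ι κ : Type*} [Fintype ι] [DecidableEq ι]
    (x : ι → SqSum κ) (hx : ∀ m i k, i ≠ k → x i m = 0 ∨ x k m = 0) {B : ℝ} (hB : 0 ≤ B)
    (hn : ∀ i, ‖x i‖ ≤ B) (c : ι → ℂ) :
    ‖∑ i, c i • x i‖ ≤ B * √(∑ i, ‖c i‖ ^ 2) := by
  refine SqSum.norm_le_of_sum_le (by positivity) fun t => ?_
  have hp : ∀ m, ‖(∑ i, c i • x i) m‖ ^ 2 ≤ ∑ i, ‖c i‖ ^ 2 * ‖x i m‖ ^ 2 := by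
    intro m
    have e : (∑ i, c i • x i) m = ∑ i, c i * x i m := by
      rw [← SqSum.eval_apply, map_sum]; simp
    rw [e]
    by_cases h : ∃ i, x i m ≠ 0
    · obtain ⟨i, hi⟩ := h
      rw [Finset.sum_eq_single i (fun k _ hk => by rw [(hx m k i hk).resolve_right hi, mul_zero])
        (by simp), norm_mul, mul_pow]
      exact Finset.single_le_sum (f := fun i => ‖c i‖ ^ 2 * ‖x i m‖ ^ 2)
        (fun _ _ => by positivity) (Finset.mem_univ i)
    · push Not at h
      simp [h]
  calc ∑ m ∈ t, ‖(∑ i, c i • x i) m‖ ^ 2 ≤ ∑ m ∈ t, ∑ i, ‖c i‖ ^ 2 * ‖x i m‖ ^ 2 :=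
        Finset.sum_le_sum fun m _ => hp m
    _ = ∑ i, ‖c i‖ ^ 2 * ∑ m ∈ t, ‖x i m‖ ^ 2 := by
        rw [Finset.sum_comm]; simp_rw [Finset.mul_sum]
    _ ≤ ∑ i, ‖c i‖ ^ 2 * B ^ 2 := by
        gcongr with i _
        exact ((x i).sum_sq_norm_le t).trans (by gcongr; exact hn i)
    _ = _ := by
        rw [← Finset.sum_mul, mul_pow, Real.sq_sqrt (Finset.sum_nonneg fun _ _ => sq_nonneg _),
          mul_comm]

end LowerAbstract

section LogIntervals

/-- The positive integers whose logarithm lies in `[u, u + h]`. -/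
def logInterval (u h : ℝ) : Finset ℕ+ :=
  (Finset.Icc ⌈Real.exp u⌉₊ ⌊Real.exp (u + h)⌋₊).subtype (0 < ·)

lemma log_mem_of_mem_logInterval {u h : ℝ} {m : ℕ+} (hm : m ∈ logInterval u h) :
    u ≤ Real.log (m : ℕ) ∧ Real.log (m : ℕ) ≤ u + h := by
  have hm0 : (0 : ℝ) < (m : ℕ) := by exact_mod_cast m.pos
  obtain ⟨h1, h2⟩ := Finset.mem_Icc.1 (Finset.mem_subtype.1 hm)
  exact ⟨(Real.le_log_iff_exp_le hm0).2 (Nat.ceil_le.1 h1),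
    (Real.log_le_iff_le_exp hm0).2 ((Nat.le_floor_iff (Real.exp_pos _).le).1 h2)⟩

/-- The logarithmic mass of `logInterval u h`. -/
def logMass (u h : ℝ) : ℝ := ∑ m ∈ logInterval u h, (1 / (m : ℕ) : ℝ)

lemma le_logMass {u h : ℝ} (hu : 0 ≤ u) (hh : 1 ≤ h) : h / 4 ≤ logMass u h := by
  set K := ⌈Real.exp u⌉₊ with hK
  set K' := ⌊Real.exp (u + h)⌋₊ with hK'
  have hK0 : 0 < K := Nat.ceil_pos.2 (Real.exp_pos _)
  have e : logMass u h = ∑ m ∈ Finset.Icc K K', (1 / m : ℝ) := by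
    refine (Finset.sum_subtype_of_mem (p := fun m => 0 < m) (fun m : ℕ => (1 / m : ℝ))
      fun m hm => ?_)
    exact hK0.trans_le (Finset.mem_Icc.1 hm).1
  have hlogK : Real.log K ≤ u + Real.log 2 := by
    rw [← Real.log_exp u, ← Real.log_mul (Real.exp_pos _).ne' two_ne_zero]
    refine Real.log_le_log (by exact_mod_cast hK0) ?_
    linarith [Nat.ceil_lt_add_one (Real.exp_pos u).le, Real.one_le_exp hu]
  have hlogK' : u + h ≤ Real.log (K' + 1) := by
    rw [Real.le_log_iff_exp_le (by positivity)]
    exact (Nat.lt_floor_add_one _).le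
  have hKK : K ≤ K' + 1 := by
    have h1 : Real.exp u < K' + 1 := lt_of_le_of_lt (Real.exp_le_exp.2 (by linarith))
      (Nat.lt_floor_add_one (Real.exp (u + h)))
    exact Nat.ceil_le.2 (by push_cast; exact h1.le)
  have htel : Real.log ((K' + 1 : ℕ) : ℝ) - Real.log K ≤ ∑ m ∈ Finset.Icc K K', (1 / m : ℝ) := by
    rw [← Finset.sum_Ico_sub (fun m : ℕ => Real.log (m : ℝ)) hKK, ← Finset.Ico_add_one_right_eq_Icc]
    refine Finset.sum_le_sum fun m hm => ?_
    have hm0 : (0 : ℝ) < m := by exact_mod_cast hK0.trans_le (Finset.mem_Ico.1 hm).1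
    rw [← Real.log_div (by positivity) hm0.ne']
    refine (Real.log_le_sub_one_of_pos (by positivity)).trans (le_of_eq ?_)
    push_cast
    field_simp
    ring
  rw [e]
  push_cast at htel
  linarith [Real.log_two_lt_d9]

lemma logMass_pos {u h : ℝ} (hu : 0 ≤ u) (hh : 1 ≤ h) : 0 < logMass u h :=
  lt_of_lt_of_le (by linarith) (le_logMass hu hh)

/-- The mean of `f` over `logInterval u h` with respect to the weights `1 / m`. -/
def logMean (u h : ℝ) (f : ℝ → ℝ) : ℝ :=
  (∑ m ∈ logInterval u h, (1 / (m : ℕ) : ℝ) * f (Real.log (m : ℕ))) / logMass u h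

lemma logMean_le {u h C : ℝ} (hu : 0 ≤ u) (hh : 1 ≤ h) {f : ℝ → ℝ}
    (hf : ∀ t, u ≤ t → t ≤ u + h → f t ≤ C) : logMean u h f ≤ C := by
  rw [logMean, div_le_iff₀ (logMass_pos hu hh), logMass, Finset.mul_sum]
  refine Finset.sum_le_sum fun m hm => ?_
  rw [mul_comm C]
  have := log_mem_of_mem_logInterval hm
  gcongr
  exact hf _ this.1 this.2

lemma le_logMean {u h C : ℝ} (hu : 0 ≤ u) (hh : 1 ≤ h) {f : ℝ → ℝ}
    (hf : ∀ t, u ≤ t → t ≤ u + h → C ≤ f t) : C ≤ logMean u h f := by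
  rw [logMean, le_div_iff₀ (logMass_pos hu hh), logMass, Finset.mul_sum]
  refine Finset.sum_le_sum fun m hm => ?_
  rw [mul_comm C]
  have := log_mem_of_mem_logInterval hm
  gcongr
  exact hf _ this.1 this.2

end LogIntervals

section Boxes

variable {d : ℕ}

/-- The natural numbers at distance at most `h` from `x`. -/
def natBall (x h : ℝ) : Finset ℕ := Finset.Icc ⌈x - h⌉₊ ⌊x + h⌋₊

lemma mem_natBall {x h : ℝ} (hx : 0 ≤ x) (hh : 0 ≤ h) {k : ℕ} :
    k ∈ natBall x h ↔ |(k : ℝ) - x| ≤ h := by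
  rw [natBall, Finset.mem_Icc, Nat.ceil_le, Nat.le_floor_iff (by positivity), abs_le]
  constructor <;> rintro ⟨h1, h2⟩ <;> constructor <;> linarith

lemma card_natBall_le {x h : ℝ} (hx : 0 ≤ x) (hh : 0 ≤ h) :
    ((natBall x h).card : ℝ) ≤ 2 * h + 1 := by
  rw [natBall, Nat.card_Icc]
  have h1 := Nat.floor_le (show 0 ≤ x + h by positivity)
  have h2 := Nat.le_ceil (x - h)
  rcases le_total ⌈x - h⌉₊ (⌊x + h⌋₊ + 1) with h3 | h3
  · rw [Nat.cast_sub h3]; push_cast; linarith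
  · rw [Nat.sub_eq_zero_of_le h3]; push_cast; linarith

/-- The box of multi-indices with coordinates within `h` of `r j * u`. -/
def indexBox (r : Fin d → ℝ) (u h : ℝ) : Finset (Fin d → ℕ) :=
  Fintype.piFinset fun j => natBall (r j * u) h

lemma card_indexBox_le {r : Fin d → ℝ} (hr : ∀ j, 0 ≤ r j) {u h : ℝ} (hu : 0 ≤ u) (hh : 1 ≤ h) :
    ((indexBox r u h).card : ℝ) ≤ (3 * h) ^ d := by
  rw [indexBox, Fintype.card_piFinset]
  push_cast
  calc ∏ j, ((natBall (r j * u) h).card : ℝ) ≤ ∏ _j : Fin d, 3 * h :=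
        Finset.prod_le_prod (fun _ _ => Nat.cast_nonneg _) fun j _ =>
          (card_natBall_le (mul_nonneg (hr j) hu) (by linarith)).trans (by linarith)
    _ = _ := by simp

lemma half_le_sum_indexBox {r : Fin d → ℝ} (hr : ∀ j, 0 ≤ r j) {u t h : ℝ} (hu : 0 ≤ u)
    (ht : 0 ≤ t) (hh : 0 ≤ h)
    (hs : ∀ j, ∃ s, 0 < s ∧ s + r j * |t - u| ≤ h ∧ 2 * d * (r j * t) ≤ s ^ 2) :
    1 / 2 ≤ ∑ α ∈ indexBox r u h, prodPoisson r t α := by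
  rw [indexBox, sum_piFinset_prodPoisson]
  have h1 : ∀ j, 1 - 1 / (2 * d) ≤ ∑ k ∈ natBall (r j * u) h, poissonWeight (r j * t) k := by
    intro j
    obtain ⟨s, hs0, hs1, hs2⟩ := hs j
    have hd : (0 : ℝ) < d := by
      have : 0 < d := j.pos
      exact_mod_cast this
    refine le_trans ?_ (le_sum_poissonWeight_of_near (mul_nonneg (hr j) ht) hs0 _ fun k hk => ?_)
    · refine sub_le_sub_left ?_ _
      rw [div_le_div_iff₀ (by positivity) (by positivity)]
      linarith
    · rw [mem_natBall (mul_nonneg (hr j) hu) hh]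
      have : |r j * t - r j * u| = r j * |t - u| := by
        rw [← mul_sub, abs_mul, abs_of_nonneg (hr j)]
      have := abs_sub_le (k : ℝ) (r j * t) (r j * u)
      linarith
  rcases Nat.eq_zero_or_pos d with rfl | hd
  · norm_num
  have hd1 : (1 : ℝ) ≤ d := by exact_mod_cast hd
  have hle : 1 / (2 * d : ℝ) ≤ 1 := by
    rw [div_le_one (by positivity)]; linarith
  calc (1 / 2 : ℝ) = 1 + d * (-(1 / (2 * d))) := by field_simp; norm_num
    _ ≤ (1 + -(1 / (2 * d) : ℝ)) ^ d := one_add_mul_le_pow (by linarith) d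
    _ = ∏ _j : Fin d, (1 - 1 / (2 * d) : ℝ) := by simp [sub_eq_add_neg]
    _ ≤ _ := Finset.prod_le_prod (fun _ _ => by linarith) fun j _ => h1 j

lemma sum_indexBox_le {r : Fin d → ℝ} (hr : ∀ j, 0 ≤ r j) {u t h s : ℝ} (hu : 0 ≤ u)
    (ht : 0 ≤ t) (hh : 0 ≤ h) (j₀ : Fin d) (hs : 0 < s) (hst : h + s ≤ r j₀ * |t - u|) :
    ∑ α ∈ indexBox r u h, prodPoisson r t α ≤ r j₀ * t / s ^ 2 := by
  rw [indexBox, sum_piFinset_prodPoisson, ← Finset.mul_prod_erase _ _ (Finset.mem_univ j₀)]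
  have h0 : ∀ j, 0 ≤ ∑ k ∈ natBall (r j * u) h, poissonWeight (r j * t) k := fun j =>
    Finset.sum_nonneg fun k _ => poissonWeight_nonneg (mul_nonneg (hr j) ht) k
  refine (mul_le_of_le_one_right (h0 _) (Finset.prod_le_one (fun j _ => h0 j) fun j _ =>
    sum_poissonWeight_le_one (mul_nonneg (hr j) ht) _)).trans ?_
  refine sum_poissonWeight_le_of_far (mul_nonneg (hr _) ht) hs _ fun k hk => ?_
  rw [mem_natBall (mul_nonneg (hr _) hu) hh] at hk
  have h1 : |r j₀ * t - r j₀ * u| = r j₀ * |t - u| := by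
    rw [← mul_sub, abs_mul, abs_of_nonneg (hr _)]
  have h2 := abs_sub_le (r j₀ * t) (k : ℝ) (r j₀ * u)
  rw [abs_sub_comm (r j₀ * t) (k : ℝ)] at h2
  linarith

lemma disjoint_indexBox {r : Fin d → ℝ} (hr : ∀ j, 0 ≤ r j) {u u' h : ℝ} (hu : 0 ≤ u)
    (hu' : 0 ≤ u') (hh : 0 ≤ h) (j₀ : Fin d) (hlt : 2 * h < r j₀ * |u - u'|) :
    Disjoint (indexBox r u h) (indexBox r u' h) := by
  rw [Finset.disjoint_left]
  intro α h1 h2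
  have h1 := (mem_natBall (mul_nonneg (hr _) hu) hh).1 (Fintype.mem_piFinset.1 h1 j₀)
  have h2 := (mem_natBall (mul_nonneg (hr _) hu') hh).1 (Fintype.mem_piFinset.1 h2 j₀)
  have h3 : |r j₀ * u - r j₀ * u'| = r j₀ * |u - u'| := by
    rw [← mul_sub, abs_mul, abs_of_nonneg (hr _)]
  have h4 := abs_sub_le (r j₀ * u) (α j₀ : ℝ) (r j₀ * u')
  rw [abs_sub_comm (r j₀ * u) (α j₀ : ℝ)] at h4
  linarith

end Boxes

section TestVectors

variable {d : ℕ} {c : ℂ} {b : Fin d → ℂ}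

/-- The test vector attached to `logInterval u h`. -/
def testVec (c : ℂ) (u h : ℝ) : H2 :=
  ∑ m ∈ logInterval u h,
    (colPhase c m * ((((m : ℕ) : ℝ) ^ (-(1 / 2) : ℝ) / logMass u h : ℝ) : ℂ)) • stdVec m

lemma testVec_apply (c : ℂ) (u h : ℝ) (m : ℕ+) :
    testVec c u h m = if m ∈ logInterval u h then
      colPhase c m * ((((m : ℕ) : ℝ) ^ (-(1 / 2) : ℝ) / logMass u h : ℝ) : ℂ) else 0 := by
  rw [testVec, ← SqSum.eval_apply, map_sum]
  simp only [map_smul, SqSum.eval_apply, stdVec_apply, smul_eq_mul, mul_ite, mul_one, mul_zero]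
  exact Finset.sum_ite_eq _ _ _

lemma norm_testVec_le (c : ℂ) {u h : ℝ} (hu : 0 ≤ u) (hh : 1 ≤ h) :
    ‖testVec c u h‖ ≤ 2 / √h := by
  have hM := logMass_pos hu hh
  have hh0 : 0 < h := by linarith
  refine SqSum.norm_le_of_sum_le (by positivity) fun t => ?_
  have e : ∀ m, ‖testVec c u h m‖ ^ 2
      = if m ∈ logInterval u h then (1 / (m : ℕ) : ℝ) / logMass u h ^ 2 else 0 := by
    intro m
    rw [testVec_apply]
    split_ifs
    · rw [norm_mul, norm_colPhase, one_mul, Complex.norm_real, Real.norm_of_nonneg (by positivity),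
        div_pow, natCast_rpow_neg_half_sq]
    · simp
  calc ∑ m ∈ t, ‖testVec c u h m‖ ^ 2
      ≤ ∑ m ∈ logInterval u h, (1 / (m : ℕ) : ℝ) / logMass u h ^ 2 := by
        simp_rw [e, ← Finset.sum_filter]
        refine Finset.sum_le_sum_of_subset_of_nonneg (fun m hm => (Finset.mem_filter.1 hm).2)
          fun _ _ _ => by positivity
    _ = 1 / logMass u h := by
        rw [← Finset.sum_div]
        change logMass u h / _ = _
        field_simp
    _ ≤ 1 / (h / 4) := by gcongr; exact le_logMass hu hh
    _ = (2 / √h) ^ 2 := by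
        rw [div_pow, Real.sq_sqrt hh0.le]; field_simp; norm_num

lemma sum_rowPhase_mul_testVec (hb : ∀ j, b j ≠ 0) (hc : c.re = 1 / 2 + ∑ j, ‖b j‖)
    (T : H2 →L[ℂ] SqSum (Fin d → ℕ)) (hT : ∀ x : H2, HasSum (fun n => x n • dirCol c b n) (T x))
    (u h : ℝ) (G : Finset (Fin d → ℕ)) :
    ∑ α ∈ G, rowPhase b α * T (testVec c u h) α
      = (logMean u h fun t => ∑ α ∈ G, prodPoisson (fun j => ‖b j‖) t α : ℝ) := by
  have hTm : ∀ m, T (stdVec m) = dirCol c b m := by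
    intro m
    refine (hT (stdVec m)).unique ?_
    have := hasSum_single (f := fun n => (stdVec m : H2) n • dirCol c b n) m
      (fun n hn => by simp [stdVec_apply, hn])
    simpa [stdVec_apply] using this
  have hTx : ∀ α, T (testVec c u h) α = ∑ m ∈ logInterval u h,
      (colPhase c m * ((((m : ℕ) : ℝ) ^ (-(1 / 2) : ℝ) / logMass u h : ℝ) : ℂ))
        * dirCol c b m α := by
    intro α
    rw [testVec, ← SqSum.eval_apply, map_sum, map_sum]
    simp only [map_smul, hTm, SqSum.eval_apply, smul_eq_mul]
  simp_rw [hTx, Finset.mul_sum]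
  rw [Finset.sum_comm, logMean, Finset.sum_div]
  push_cast
  refine Finset.sum_congr rfl fun m _ => ?_
  rw [Finset.mul_sum, Finset.sum_div]
  refine Finset.sum_congr rfl fun α _ => ?_
  have h1 := colPhase_mul_rowPhase_mul_dirCol hb hc m α
  have h2 : (((((m : ℕ) : ℝ) ^ (-(1 / 2) : ℝ) : ℝ) : ℂ)) ^ 2 = 1 / (m : ℕ) := by
    rw [← Complex.ofReal_pow, natCast_rpow_neg_half_sq]
    push_cast
    rfl
  rw [Complex.ofReal_mul] at h1
  rw [← h2]
  linear_combination ((((m : ℕ) : ℝ) ^ (-(1 / 2) : ℝ) : ℝ) : ℂ) / (logMass u h : ℂ) * h1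

end TestVectors

section LowerBound

lemma sum_erase_inv_sq_le {n : ℕ} (i : Fin n) :
    ∑ k ∈ Finset.univ.erase i, 1 / ((i : ℝ) - (k : ℝ)) ^ 2 ≤ ∑' z : ℤ, 1 / (z : ℝ) ^ 2 := by
  have hs : Summable fun z : ℤ => 1 / (z : ℝ) ^ 2 :=
    Real.summable_one_div_int_pow.2 one_lt_two
  let f : Fin n ↪ ℤ := ⟨fun k => (i : ℤ) - (k : ℤ), fun k l h => by
    have : (i : ℤ) - (k : ℤ) = (i : ℤ) - (l : ℤ) := h
    exact Fin.ext (by omega)⟩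
  refine le_trans (le_of_eq ?_)
    (hs.sum_le_tsum ((Finset.univ.erase i).map f) fun _ _ => by positivity)
  rw [Finset.sum_map]
  refine Finset.sum_congr rfl fun k _ => ?_
  have : ((f k : ℤ) : ℝ) = (i : ℝ) - (k : ℝ) := Int.cast_sub _ _
  rw [this]

variable {d : ℕ} {c : ℂ} {b : Fin d → ℂ}

/-- Separation of scales: the averaged Poisson laws at the points `N ^ 2 + i * (L * N)` are
concentrated on the corresponding boxes. -/
lemma exists_separation {r : Fin d → ℝ} (hr : ∀ j, 0 < r j) (j₀ : Fin d) :
    ∃ A : ℝ, 1 ≤ A ∧ ∃ L : ℕ, 2 ≤ L ∧ ∀ n : ℕ, 0 < n → ∀ N : ℝ, N = L * n →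
      ∀ u : Fin n → ℝ, (∀ i, u i = N ^ 2 + i * (L * N)) →
      (Pairwise fun i k => Disjoint (indexBox r (u i) (A * N)) (indexBox r (u k) (A * N))) ∧
      (∀ i, 1 / 2 ≤ logMean (u i) N fun t => ∑ α ∈ indexBox r (u i) (A * N), prodPoisson r t α) ∧
      (∀ i, ∑ k ∈ Finset.univ.erase i,
        (logMean (u k) N fun t => ∑ α ∈ indexBox r (u i) (A * N), prodPoisson r t α) ≤ 1 / 4) ∧
      (∀ k, ∑ i ∈ Finset.univ.erase k,
        (logMean (u k) N fun t => ∑ α ∈ indexBox r (u i) (A * N), prodPoisson r t α) ≤ 1 / 4) := by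
  have hr' : ∀ j, 0 ≤ r j := fun j => (hr j).le
  set ρ := r j₀ with hρ
  have hρ0 : 0 < ρ := hr j₀
  set R := ∑ j, r j with hR
  have hrR : ∀ j, r j ≤ R := fun j =>
    Finset.single_le_sum (fun i _ => hr' i) (Finset.mem_univ j)
  have hR0 : 0 < R := hρ0.trans_le (hrR j₀)
  set a := 4 * d * R + 1 with ha
  have ha1 : 1 ≤ a := by rw [ha]; linarith [show 0 ≤ 4 * d * R by positivity]
  set Z := ∑' z : ℤ, 1 / (z : ℝ) ^ 2 with hZ
  have hZ0 : 0 ≤ Z := tsum_nonneg fun _ => by positivity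
  set L := max 2 (max ⌈2 * (R + a + ρ) / ρ⌉₊ ⌈32 * Z / ρ⌉₊) with hL
  have hL2 : 2 ≤ L := le_max_left _ _
  have hL2' : (2 : ℝ) ≤ L := by exact_mod_cast hL2
  have hL3 : 2 * (R + a + ρ) ≤ ρ * L := by
    rw [mul_comm ρ, ← div_le_iff₀ hρ0]
    exact Nat.ceil_le.1 ((le_max_left _ _).trans (le_max_right _ _))
  have hL4 : 32 * Z ≤ ρ * L ^ 2 := by
    have : 32 * Z ≤ L * ρ := by
      rw [← div_le_iff₀ hρ0]
      exact Nat.ceil_le.1 ((le_max_right _ _).trans (le_max_right _ _))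
    nlinarith
  refine ⟨R + a, by linarith, L, hL2, fun n hn N hN u hu => ?_⟩
  have hn1 : (1 : ℝ) ≤ n := by exact_mod_cast hn
  have hN1 : 1 ≤ N := by rw [hN]; nlinarith
  have hN0 : 0 < N := by linarith
  have hu0 : ∀ i, 0 ≤ u i := fun i => by rw [hu]; positivity
  have huN : ∀ i, u i + N ≤ 2 * N ^ 2 := by
    intro i
    have h1 : ((i : ℕ) : ℝ) + 1 ≤ n := by exact_mod_cast i.isLt
    have h2 : ((i : ℕ) + 1 : ℝ) * (L * N) ≤ n * (L * N) := by gcongr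
    have h3 : (n : ℝ) * (L * N) = N ^ 2 := by rw [sq]; nth_rw 2 [hN]; ring
    have h4 : N ≤ L * N := by nlinarith
    rw [hu]
    linarith
  have hdiff : ∀ i k, |u i - u k| = |(i : ℝ) - (k : ℝ)| * (L * N) := by
    intro i k
    rw [hu, hu, ← abs_of_pos (show 0 < (L : ℝ) * N by positivity), ← abs_mul,
      abs_of_pos (show 0 < (L : ℝ) * N by positivity)]
    congr 1; ring
  have hD : ∀ i k : Fin n, i ≠ k → 1 ≤ |(i : ℝ) - (k : ℝ)| := by
    intro i k hik
    have h1 : ((i : ℕ) : ℤ) - ((k : ℕ) : ℤ) ≠ 0 := by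
      have := Fin.val_ne_of_ne hik
      omega
    have := Int.one_le_abs h1
    exact_mod_cast this
  have hAN : 0 ≤ (R + a) * N := by positivity
  have hoff : ∀ i k, i ≠ k →
      (logMean (u k) N fun t => ∑ α ∈ indexBox r (u i) ((R + a) * N), prodPoisson r t α)
        ≤ 8 / (ρ * L ^ 2) * (1 / ((i : ℝ) - (k : ℝ)) ^ 2) := by
    intro i k hik
    refine logMean_le (hu0 k) hN1 fun t ht1 ht2 => ?_
    set D := |(i : ℝ) - (k : ℝ)| with hDdef
    have hD1 : 1 ≤ D := hD i k hik
    have hsep : ρ * L ≤ ρ * L * D := le_mul_of_one_le_right (by positivity) hD1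
    refine (sum_indexBox_le hr' (hu0 i) ((hu0 k).trans ht1) hAN j₀
      (s := ρ * D * (L * N) / 2) (by positivity) ?_).trans ?_
    · have h1 : D * (L * N) - N ≤ |t - u i| := by
        rw [← hdiff]
        have h2 := abs_sub_le (u i) t (u k)
        rw [abs_sub_comm (u i) t, abs_of_nonneg (by linarith : 0 ≤ t - u k)] at h2
        linarith
      have h2 := mul_le_mul_of_nonneg_left h1 hρ0.le
      have h3 : (R + a + ρ) * N ≤ (ρ * L * D / 2) * N := by gcongr; linarith
      rw [← hρ]
      linarith
    · have ht : t ≤ 2 * N ^ 2 := ht2.trans (huN k)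
      rw [← sq_abs ((i : ℝ) - (k : ℝ)), ← hDdef]
      calc ρ * t / (ρ * D * (L * N) / 2) ^ 2
          ≤ ρ * (2 * N ^ 2) / (ρ * D * (L * N) / 2) ^ 2 := by gcongr
        _ = _ := by field_simp; norm_num
  have hquarter : ∀ i : Fin n, 8 / (ρ * L ^ 2) *
      ∑ k ∈ Finset.univ.erase i, 1 / ((i : ℝ) - (k : ℝ)) ^ 2 ≤ 1 / 4 := by
    intro i
    calc _ ≤ 8 / (ρ * L ^ 2) * Z := by gcongr; exact sum_erase_inv_sq_le i
      _ ≤ 1 / 4 := by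
        rw [div_mul_eq_mul_div, div_le_iff₀ (by positivity)]
        linarith
  refine ⟨fun i k hik => ?_, fun i => ?_, fun i => ?_, fun k => ?_⟩
  · refine disjoint_indexBox hr' (hu0 i) (hu0 k) hAN j₀ ?_
    rw [hdiff, ← hρ]
    have h1 : ρ * L ≤ ρ * L * |(i : ℝ) - (k : ℝ)| :=
      le_mul_of_one_le_right (by positivity) (hD i k hik)
    have h2 : 2 * (R + a) * N < (ρ * L * |(i : ℝ) - (k : ℝ)|) * N :=
      mul_lt_mul_of_pos_right (by linarith) hN0
    linarith
  · refine le_logMean (hu0 i) hN1 fun t ht1 ht2 => ?_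
    refine half_le_sum_indexBox hr' (hu0 i) ((hu0 i).trans ht1) hAN fun j =>
      ⟨a * N, by positivity, ?_, ?_⟩
    · rw [abs_of_nonneg (by linarith)]
      have : r j * (t - u i) ≤ R * N := by
        gcongr
        · exact hrR j
        · linarith
      linarith
    · have ht : t ≤ 2 * N ^ 2 := ht2.trans (huN i)
      have h1 : 4 * d * R ≤ a ^ 2 := by nlinarith [show 0 ≤ 4 * d * R by positivity]
      calc 2 * d * (r j * t) ≤ 2 * d * (R * (2 * N ^ 2)) := by
            gcongr
            · exact (hu0 i).trans ht1
            · exact hrR j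
        _ = (4 * d * R) * N ^ 2 := by ring
        _ ≤ a ^ 2 * N ^ 2 := by gcongr
        _ = _ := by ring
  · refine le_trans ?_ (hquarter i)
    rw [Finset.mul_sum]
    exact Finset.sum_le_sum fun k hk => hoff i k (Finset.ne_of_mem_erase hk).symm
  · refine le_trans ?_ (hquarter k)
    rw [Finset.mul_sum]
    refine Finset.sum_le_sum fun i hi => ?_
    rw [sub_sq_comm]
    exact hoff i k (Finset.ne_of_mem_erase hi)

lemma exists_le_approxNumber_comp {F : Type*} [NormedAddCommGroup F] [NormedSpace ℂ F]
    (hd : 0 < d) (hb : ∀ j, b j ≠ 0) (hc : c.re = 1 / 2 + ∑ j, ‖b j‖)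
    (T : H2 →L[ℂ] SqSum (Fin d → ℕ)) (hT : ∀ x : H2, HasSum (fun n => x n • dirCol c b n) (T x))
    (J : SqSum (Fin d → ℕ) →L[ℂ] F) (hJ : ∀ y, ‖J y‖ = ‖y‖) :
    ∃ κ : ℝ, 0 < κ ∧ ∀ n : ℕ, 0 < n →
      κ * (n : ℝ) ^ (-(((d : ℝ) - 1) / 2)) ≤ approxNumber (J.comp T) n := by
  obtain ⟨A, hA, L, hL, hsep⟩ := exists_separation (fun j => norm_pos_iff.2 (hb j)) ⟨0, hd⟩
  have hL2 : (2 : ℝ) ≤ L := by exact_mod_cast hL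
  have hL0 : (0 : ℝ) < L := by linarith
  have hA0 : 0 < A := by linarith
  refine ⟨√L / (8 * √((3 * (A * L)) ^ d)), by positivity, fun n hn => ?_⟩
  have hn1 : (1 : ℝ) ≤ n := by exact_mod_cast hn
  have hn0 : (0 : ℝ) < n := by linarith
  set N : ℝ := L * n with hN
  have hN1 : 1 ≤ N := by rw [hN]; nlinarith
  have hN0 : 0 < N := by linarith
  set u : Fin n → ℝ := fun i => N ^ 2 + i * (L * N) with hu
  have hu0 : ∀ i, 0 ≤ u i := fun i => by simp only [hu]; positivity
  obtain ⟨hdisj, hdiag, hrow, hcol⟩ := hsep n hn N hN u fun _ => rfl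
  have hAN : 1 ≤ A * N := by nlinarith
  set g : ℝ := (3 * (A * N)) ^ d with hg
  have hg0 : 0 < g := by positivity
  have hlt : ∀ i k, i < k → ∀ m, m ∈ logInterval (u i) N → m ∉ logInterval (u k) N := by
    intro i k hik m hi hk
    have h1 := (log_mem_of_mem_logInterval hi).2
    have h2 := (log_mem_of_mem_logInterval hk).1
    have h3 : ((i : ℕ) : ℝ) + 1 ≤ (k : ℕ) := by exact_mod_cast hik
    have h4 : ((i : ℕ) + 1 : ℝ) * (L * N) ≤ (k : ℕ) * (L * N) := by gcongr
    have h5 : N < L * N := by nlinarith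
    simp only [hu] at h1 h2
    linarith
  have hx : ∀ m i k, i ≠ k → testVec c (u i) N m = 0 ∨ testVec c (u k) N m = 0 := by
    intro m i k hik
    rw [testVec_apply, testVec_apply]
    rcases lt_or_gt_of_ne hik with h | h
    · by_cases hm : m ∈ logInterval (u i) N
      · exact Or.inr (if_neg (hlt i k h m hm))
      · exact Or.inl (if_neg hm)
    · by_cases hm : m ∈ logInterval (u k) N
      · exact Or.inl (if_neg (hlt k i h m hm))
      · exact Or.inr (if_neg hm)
  have key := le_approxNumber_of_test (J.comp T) hn (fun i => testVec c (u i) N)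
    (A := 1 / (4 * √g)) (B := 2 / √N) (by positivity)
    (SqSum.norm_sum_smul_le_of_disjoint _ hx (by positivity) fun i =>
      norm_testVec_le c (hu0 i) hN1) fun x => by
      have h0 : ∀ i k, 0 ≤ logMean (u k) N
          fun t => ∑ α ∈ indexBox (fun j => ‖b j‖) (u i) (A * N),
            prodPoisson (fun j => ‖b j‖) t α := fun i k =>
        le_logMean (hu0 k) hN1 fun t ht _ => Finset.sum_nonneg fun α _ =>
          prodPoisson_nonneg (fun _ => norm_nonneg _) ((hu0 k).trans ht) α
      have h1 := sum_sq_norm_le_of_test_sets (fun k => T (testVec c (u k) N))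
        (fun i => indexBox (fun j => ‖b j‖) (u i) (A * N)) hdisj (g := g)
        (fun i => card_indexBox_le (fun _ => norm_nonneg _) (hu0 i) hAN) (rowPhase b)
        (norm_rowPhase hb) _ (fun i k => sum_rowPhase_mul_testVec hb hc T hT (u k) N _)
        h0 hdiag hrow hcol x
      rw [ContinuousLinearMap.comp_apply, hJ, map_sum]
      simp only [map_smul]
      rw [one_div_mul_eq_div, div_le_iff₀ (by positivity)]
      refine Real.sqrt_le_iff.2 ⟨by positivity, h1.trans (le_of_eq ?_)⟩
      rw [mul_pow, mul_pow, Real.sq_sqrt hg0.le]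
      ring
  refine le_trans (le_of_eq ?_) key
  have e1 : √g = √((3 * (A * L)) ^ d) * √((n : ℝ) ^ d) := by
    rw [← Real.sqrt_mul (by positivity), ← mul_pow, hg, hN]; congr 2; ring
  have e2 : √N = √L * √n := by rw [hN, Real.sqrt_mul hL0.le]
  have e3 : (n : ℝ) ^ (-(((d : ℝ) - 1) / 2)) = √n / √((n : ℝ) ^ d) := by
    rw [Real.sqrt_eq_rpow, Real.sqrt_eq_rpow, ← Real.rpow_natCast_mul hn0.le, ← Real.rpow_sub hn0]
    congr 1; ring
  rw [e1, e2, e3]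
  field_simp
  norm_num

end LowerBound

theorem stmt5 (d : ℕ) (hd : 1 ≤ d) (q : Fin d → ℕ) (hq : ∀ j, 2 ≤ q j)
    (hind : MultIndep q) (a : Fin d → ℂ) (ha : ∀ j, a j ≠ 0) (c₁ : ℂ)
    (hκ : c₁.re - ∑ j, ‖a j‖ = 1 / 2) :
    ∃ T : H2 →L[ℂ] H2,
      IsCompOp (fun s => c₁ + ∑ j, a j * (q j : ℂ) ^ (-s)) T ∧
      ∃ c : ℝ, 0 < c ∧ ∃ C : ℝ, 0 < C ∧ ∀ n : ℕ, 2 ≤ n →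
        c * (n : ℝ) ^ (-(((d : ℝ) - 1) / 2)) ≤ approxNumber T n ∧
        approxNumber T n ≤ C * ((n : ℝ) / Real.log n) ^ (-(((d : ℝ) - 1) / 2)) := by
  have hq0 : ∀ j, 0 < q j := fun j => two_pos.trans_le (hq j)
  have hb : ∀ j, -a j ≠ 0 := fun j => neg_ne_zero.2 (ha j)
  have hc : c₁.re = 1 / 2 + ∑ j, ‖-a j‖ := by simp only [norm_neg]; linarith
  obtain ⟨T, hT⟩ := exists_dirCol_operator hb hc ⟨0, hd⟩
  set J := SqSum.push _ (monomialIndex_injective hq0 hind)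
  obtain ⟨κ, hκ0, hκT⟩ := exists_le_approxNumber_comp hd hb hc T hT J.toContinuousLinearMap
    J.norm_map
  obtain ⟨C, hC0, hCT⟩ := exists_approxNumber_comp_le hd hb hc T hT J.toContinuousLinearMap
    J.norm_toContinuousLinearMap_le
  refine ⟨J.toContinuousLinearMap.comp T, ?_, κ, hκ0, C, hC0, fun n hn =>
    ⟨hκT n (two_pos.trans_le hn), hCT n hn⟩⟩
  convert isCompOp_push_comp hq0 hind c₁ (fun j => -a j) T hT using 2 with s
  simp
end
end

section
/- Let (q_j)_{j≥1} be a sequence of multiplicatively independent integers ≥ 2, let (c_{q_j})_{j≥1} be nonzero complex numbers with ∑_{j≥1} |c_{q_j}| < ∞, and let c₁ ∈ ℂ with Re c₁ − ∑_{j≥1} |c_{q_j}| = 1/2; set φ(s) = c₁ + ∑_{j≥1} c_{q_j} q_j^{−s}. Then the composition operator C_φ is bounded on ℋ² and for every p > 0 one has ∑_{n≥1} a_n(C_φ)^p < ∞ (that is, C_φ belongs to every Schatten class S_p). -/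
open Complex Filter MeasureTheory

noncomputable section

/-- The positive integers `q j ≥ 2` are multiplicatively independent: equal products
with finitely supported nonnegative integer exponents force equal exponents. -/
def MultIndepSeq (q : ℕ → ℕ) : Prop :=
  ∀ α β : ℕ →₀ ℕ, (α.prod fun j e => q j ^ e) = (β.prod fun j e => q j ^ e) → α = β

section General

/-- A square-summable family of vectors defines a bounded (Hilbert–Schmidt) operator on `ℋ²`. -/
lemma exists_clm_of_summable_norm_sq {E : Type*} [NormedAddCommGroup E] [NormedSpace ℂ E]
    [CompleteSpace E] (w : ℕ+ → E) (hw : Summable fun n => ‖w n‖ ^ 2) :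
    ∃ T : H2 →L[ℂ] E, (∀ x : H2, HasSum (fun n => x n • w n) (T x)) ∧
      ‖T‖ ≤ √(∑' n, ‖w n‖ ^ 2) := by
  have key (x : H2) : Summable (fun n => ‖x n • w n‖) ∧
      ∑' n, ‖x n • w n‖ ≤ ‖x‖ * √(∑' n, ‖w n‖ ^ 2) := by
    have hx : HasSum (fun n => ‖x n‖ ^ 2) (‖x‖ ^ 2) := by
      simpa using lp.hasSum_norm (by simp) x
    have h := Real.summable_and_inner_le_Lp_mul_Lq_tsum_of_nonneg (p := 2) (q := 2)
      Real.HolderConjugate.two_two (fun n => norm_nonneg (x n)) (fun n => norm_nonneg (w n))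
      (by simpa using hx.summable) (by simpa using hw)
    simp only [norm_smul]
    refine ⟨h.1, h.2.trans_eq ?_⟩
    simp only [Real.rpow_ofNat, hx.tsum_eq, ← Real.sqrt_eq_rpow, Real.sqrt_sq (norm_nonneg x)]
  have hs (x : H2) : HasSum (fun n => x n • w n) (∑' n, x n • w n) :=
    (key x).1.of_norm.hasSum
  let L : H2 →ₗ[ℂ] E :=
    { toFun := fun x => ∑' n, x n • w n
      map_add' := fun x y => by
        refine HasSum.tsum_eq ?_
        simpa [add_smul] using (hs x).add (hs y)
      map_smul' := fun c x => by
        refine HasSum.tsum_eq ?_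
        simpa [mul_smul] using (hs x).const_smul c }
  have hL (x : H2) : ‖L x‖ ≤ √(∑' n, ‖w n‖ ^ 2) * ‖x‖ := by
    rw [mul_comm]
    exact (norm_tsum_le_tsum_norm (key x).1).trans (key x).2
  exact ⟨L.mkContinuous _ hL, hs, L.mkContinuous_norm_le (Real.sqrt_nonneg _) hL⟩

/-- Exponential accuracy of the Taylor polynomials of the exponential. -/
lemma norm_exp_sub_sum_le {A : Type*} [NormedRing A] [NormOneClass A] [NormedAlgebra ℂ A]
    [CompleteSpace A] (x : A) (m : ℕ) :
    ‖NormedSpace.exp x - ∑ i ∈ Finset.range m, (i.factorial⁻¹ : ℂ) • x ^ i‖ ≤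
      (1 / 2) ^ m * Real.exp (2 * ‖x‖) := by
  have h := NormedSpace.exp_series_hasSum_exp' (𝕂 := ℂ) x
  have h1 := (hasSum_nat_add_iff' m).2 h
  have h2 : HasSum (fun i : ℕ => (2 * ‖x‖) ^ i / i.factorial) (Real.exp (2 * ‖x‖)) := by
    rw [Real.exp_eq_exp_ℝ]; exact NormedSpace.expSeries_div_hasSum_exp _
  have h3 := (summable_nat_add_iff m).2 h2.summable
  rw [← h1.tsum_eq]
  refine (tsum_of_norm_bounded (h3.hasSum.mul_left ((1 / 2 : ℝ) ^ m)) fun i => ?_).trans ?_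
  · rw [norm_smul, norm_inv, Complex.norm_natCast, mul_pow, div_eq_inv_mul, pow_add (2 : ℝ)]
    have : ‖x ^ (i + m)‖ ≤ ‖x‖ ^ (i + m) := norm_pow_le x _
    calc ((i + m).factorial : ℝ)⁻¹ * ‖x ^ (i + m)‖
        ≤ ((i + m).factorial : ℝ)⁻¹ * (2 ^ i * ‖x‖ ^ (i + m)) := by
          gcongr
          exact this.trans (le_mul_of_one_le_left (by positivity) (one_le_pow₀ (by norm_num)))
      _ = _ := by rw [mul_one, inv_pow]; field_simp
  · gcongr
    rw [← h2.tsum_eq]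
    have := h2.summable.sum_add_tsum_nat_add m
    have h0 : 0 ≤ ∑ i ∈ Finset.range m, (2 * ‖x‖) ^ i / (i.factorial : ℝ) :=
      Finset.sum_nonneg fun i _ => by positivity
    linarith

lemma norm_exp_le {A : Type*} [NormedRing A] [NormOneClass A] [NormedAlgebra ℂ A]
    [CompleteSpace A] (x : A) : ‖NormedSpace.exp x‖ ≤ Real.exp ‖x‖ := by
  have h := NormedSpace.exp_series_hasSum_exp' (𝕂 := ℂ) x
  have h2 : HasSum (fun i : ℕ => ‖x‖ ^ i / i.factorial) (Real.exp ‖x‖) := by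
    rw [Real.exp_eq_exp_ℝ]; exact NormedSpace.expSeries_div_hasSum_exp _
  rw [← h.tsum_eq]
  refine tsum_of_norm_bounded h2 fun i => ?_
  rw [norm_smul, norm_inv, Complex.norm_natCast, div_eq_inv_mul]
  gcongr
  exact norm_pow_le x _

lemma pow_div_factorial_le (r : ℝ) (hr : 0 < r) (k : ℕ) :
    r ^ k / k.factorial ≤ Real.exp r / √(k + 1) := by
  rcases Nat.eq_zero_or_pos k with rfl | hk
  · simpa using hr.le
  have hk' : (1 : ℝ) ≤ k := by exact_mod_cast hk
  have h1 : √((k : ℝ) + 1) * (k / Real.exp 1) ^ k ≤ k.factorial := by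
    refine le_trans ?_ (Stirling.le_factorial_stirling k)
    gcongr
    nlinarith [Real.pi_gt_three]
  have h2 : (r / k) ^ k ≤ Real.exp (r - k) := by
    have : r / k ≤ Real.exp (r / k - 1) := by linarith [Real.add_one_le_exp (r / k - 1)]
    calc (r / k) ^ k ≤ Real.exp (r / k - 1) ^ k := by gcongr
      _ = Real.exp (r - k) := by
        rw [← Real.exp_nat_mul]; congr 1; field_simp
  have h3 : (0 : ℝ) < k.factorial := by exact_mod_cast k.factorial_pos
  have h4 : 0 < √((k : ℝ) + 1) := by positivity
  rw [div_le_div_iff₀ h3 h4]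
  calc r ^ k * √((k : ℝ) + 1)
      = (r / k) ^ k * (k : ℝ) ^ k * √((k : ℝ) + 1) := by rw [div_pow]; field_simp
    _ ≤ Real.exp (r - k) * (k : ℝ) ^ k * √((k : ℝ) + 1) := by gcongr
    _ = Real.exp r * (√((k : ℝ) + 1) * (k / Real.exp 1) ^ k) := by
        rw [Real.exp_sub, div_pow, ← Real.exp_nat_mul, mul_one]; ring
    _ ≤ Real.exp r * k.factorial := by gcongr

/-- The series `∑ (r ^ k / k!) ^ 2` (a modified Bessel function at `2 r`) is at most
`exp (2 r) / √r`. -/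
lemma summable_and_tsum_pow_div_factorial_sq_le (r : ℝ) (hr : 0 < r) :
    Summable (fun k : ℕ => (r ^ k / k.factorial) ^ 2) ∧
      ∑' k : ℕ, (r ^ k / k.factorial) ^ 2 ≤ Real.exp (2 * r) / √r := by
  have h0 : HasSum (fun k : ℕ => r ^ k / k.factorial) (Real.exp r) := by
    rw [Real.exp_eq_exp_ℝ]; exact NormedSpace.expSeries_div_hasSum_exp _
  have h1 : HasSum (fun k : ℕ => r ^ k / k.factorial / (k + 1)) ((Real.exp r - 1) / r) := by
    have := ((hasSum_nat_add_iff' 1).2 h0).div_const r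
    simp only [Finset.range_one, Finset.sum_singleton, pow_zero, Nat.factorial_zero, Nat.cast_one,
      div_one] at this
    refine this.congr_fun fun k => ?_
    rw [Nat.factorial_succ, pow_succ]
    push_cast
    field_simp
  have hs : 0 < √r := Real.sqrt_pos.2 hr
  have h2 := ((h0.mul_left (1 / √r)).add (h1.mul_left (√r))).mul_left (Real.exp r / 2)
  have hle (k : ℕ) : (r ^ k / k.factorial) ^ 2 ≤
      Real.exp r / 2 * (1 / √r * (r ^ k / k.factorial) + √r * (r ^ k / k.factorial / (k + 1))) := by
    have hk : (0 : ℝ) < √((k : ℝ) + 1) := by positivity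
    have hk2 : √((k : ℝ) + 1) ^ 2 = k + 1 := Real.sq_sqrt (by positivity)
    have hu : 0 ≤ r ^ k / k.factorial := by positivity
    have hA : 1 / √((k : ℝ) + 1) ≤ (1 / √r + √r / (k + 1)) / 2 := by
      rw [show √r / ((k : ℝ) + 1) = √r / √((k : ℝ) + 1) ^ 2 by rw [hk2],
        div_add_div _ _ hs.ne' (by positivity), div_div,
        div_le_div_iff₀ hk (by positivity)]
      nlinarith [mul_nonneg hk.le (sq_nonneg (√((k : ℝ) + 1) - √r))]
    calc (r ^ k / k.factorial) ^ 2 = r ^ k / k.factorial * (r ^ k / k.factorial) := sq _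
      _ ≤ r ^ k / k.factorial * (Real.exp r / √(k + 1)) := by
          exact mul_le_mul_of_nonneg_left (pow_div_factorial_le r hr k) hu
      _ = r ^ k / k.factorial * Real.exp r * (1 / √(k + 1)) := by ring
      _ ≤ r ^ k / k.factorial * Real.exp r * ((1 / √r + √r / (k + 1)) / 2) := by gcongr
      _ = _ := by ring
  have hsm := Summable.of_nonneg_of_le (fun k => sq_nonneg _) hle h2.summable
  refine ⟨hsm, (hsm.tsum_le_tsum hle h2.summable).trans ?_⟩
  rw [h2.tsum_eq]
  have hrr : √r * ((Real.exp r - 1) / r) ≤ 1 / √r * Real.exp r := by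
    rw [mul_div_left_comm, Real.sqrt_div_self, mul_comm, one_div]
    gcongr
    linarith
  calc Real.exp r / 2 * (1 / √r * Real.exp r + √r * ((Real.exp r - 1) / r))
      ≤ Real.exp r / 2 * (1 / √r * Real.exp r + 1 / √r * Real.exp r) := by gcongr
    _ = Real.exp (2 * r) / √r := by rw [two_mul r, Real.exp_add]; ring

/-- Bessel-type bound for the sum of a series with pairwise orthogonal terms. -/
lemma norm_sq_le_of_hasSum_orthogonal {E : Type*} [NormedAddCommGroup E] [InnerProductSpace ℂ E]
    {f : ℕ → E} {y : E} (hf : HasSum f y) (ho : ∀ k l, k ≠ l → inner ℂ (f k) (f l) = 0)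
    (hs : Summable fun k => ‖f k‖ ^ 2) : ‖y‖ ^ 2 ≤ ∑' k, ‖f k‖ ^ 2 := by
  have hp (N : ℕ) : ‖∑ k ∈ Finset.range N, f k‖ ^ 2 = ∑ k ∈ Finset.range N, ‖f k‖ ^ 2 := by
    induction N with
    | zero => simp
    | succ N ih =>
      rw [Finset.sum_range_succ, Finset.sum_range_succ, ← ih, sq, sq, sq]
      refine norm_add_sq_eq_norm_sq_add_norm_sq_of_inner_eq_zero (𝕜 := ℂ) _ _ ?_
      rw [sum_inner]
      exact Finset.sum_eq_zero fun k hk => ho k N (Finset.mem_range.1 hk).ne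
  refine le_of_tendsto (hf.tendsto_sum_nat.norm.pow 2) (Eventually.of_forall fun N => ?_)
  rw [hp]
  exact hs.sum_le_tsum _ fun k _ => sq_nonneg _

/-- Dyadic condensation over `ℕ+`. -/
lemma summable_and_tsum_le_of_dyadic {f : ℕ+ → ℝ} {b : ℕ → ℝ} (hf : ∀ n, 0 ≤ f n)
    (hb : Summable b) (hb0 : ∀ k, 0 ≤ b k)
    (h : ∀ n : ℕ+, f n ≤ b (Nat.log 2 n) / 2 ^ Nat.log 2 n) :
    Summable f ∧ ∑' n, f n ≤ ∑' k, b k := by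
  have key (s : Finset ℕ+) : ∑ n ∈ s, f n ≤ ∑' k, b k := by
    let g : ℕ+ → ℕ := fun n => Nat.log 2 n
    rw [← Finset.sum_fiberwise_of_maps_to (t := s.image g) (g := g)
      fun n hn => Finset.mem_image_of_mem g hn]
    refine (Finset.sum_le_sum fun k _ => ?_).trans (hb.sum_le_tsum (s.image g) fun k _ => hb0 k)
    have hcard : (s.filter fun n => g n = k).card ≤ 2 ^ k := by
      have : ((s.filter fun n => g n = k).image fun n : ℕ+ => (n : ℕ)) ⊆
          Finset.Ico (2 ^ k) (2 ^ (k + 1)) := by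
        intro m hm
        obtain ⟨n, hn, rfl⟩ := Finset.mem_image.1 hm
        have hn' : Nat.log 2 n = k := (Finset.mem_filter.1 hn).2
        rw [Finset.mem_Ico, ← hn']
        exact ⟨Nat.pow_log_le_self 2 n.pos.ne', Nat.lt_pow_succ_log_self one_lt_two _⟩
      have hc := Finset.card_le_card this
      rw [Finset.card_image_of_injective _ PNat.coe_injective, Nat.card_Ico, pow_succ] at hc
      omega
    calc ∑ n ∈ s with g n = k, f n ≤ ∑ n ∈ s with g n = k, b k / 2 ^ k := by
          refine Finset.sum_le_sum fun n hn => ?_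
          have hn' : Nat.log 2 n = k := (Finset.mem_filter.1 hn).2
          rw [← hn']; exact h n
      _ = (s.filter fun n => g n = k).card * (b k / 2 ^ k) := by
          rw [Finset.sum_const, nsmul_eq_mul]
      _ ≤ (2 ^ k : ℕ) * (b k / 2 ^ k) := by
          gcongr
          exact div_nonneg (hb0 k) (by positivity)
      _ = b k := by push_cast; field_simp
  have hs := summable_of_sum_le hf key
  exact ⟨hs, hs.tsum_le_of_sum_le key⟩

end General

section Shift

/-- The Dirichlet monomial `n^{-s}` as an element of `ℋ²`. -/
def monomial (n : ℕ+) : H2 := lp.single 2 n 1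

lemma hasSum_smul_monomial (x : H2) : HasSum (fun n => x n • monomial n) x := by
  refine (lp.hasSum_single (by simp) x).congr_fun fun n => ?_
  rw [monomial, ← lp.single_smul, smul_eq_mul, mul_one]

lemma inner_monomial (n : ℕ+) (x : H2) : inner ℂ (monomial n) x = x n := by
  rw [monomial, lp.inner_single_left]
  simp

lemma norm_monomial (n : ℕ+) : ‖monomial n‖ = 1 := by
  rw [monomial, lp.norm_single (by simp)]
  simp

instance : Nontrivial H2 :=
  ⟨monomial 1, 0, fun h => by simpa [h] using norm_monomial 1⟩

lemma orthonormal_monomial : Orthonormal ℂ monomial := by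
  refine ⟨norm_monomial, fun m n hmn => ?_⟩
  change inner ℂ (monomial m) (monomial n) = 0
  rw [inner_monomial, monomial, lp.single_apply_ne _ _ _ hmn]

lemma clm_ext_monomial {E : Type*} [NormedAddCommGroup E] [NormedSpace ℂ E]
    {T U : H2 →L[ℂ] E} (h : ∀ n, T (monomial n) = U (monomial n)) : T = U := by
  ext x
  refine ((hasSum_smul_monomial x).mapL T).unique ?_
  simpa [h] using (hasSum_smul_monomial x).mapL U

/-- Multiplication by the Dirichlet monomial `m^{-s}` on `ℋ²`. -/
def shift (m : ℕ+) : H2 →L[ℂ] H2 :=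
  ((orthonormal_monomial.comp _ (mul_right_injective m)).orthogonalFamily.linearIsometry
    ).toContinuousLinearMap

lemma shift_monomial (m n : ℕ+) : shift m (monomial n) = monomial (m * n) := by
  simp [shift, monomial]

lemma norm_shift_apply (m : ℕ+) (x : H2) : ‖shift m x‖ = ‖x‖ :=
  LinearIsometry.norm_map _ x

lemma norm_shift_le (m : ℕ+) : ‖shift m‖ ≤ 1 :=
  ContinuousLinearMap.opNorm_le_bound _ zero_le_one fun x => by
    rw [norm_shift_apply, one_mul]

lemma shift_mul (m n : ℕ+) : shift (m * n) = shift m * shift n :=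
  clm_ext_monomial fun k => by
    rw [mul_apply_eq_comp, shift_monomial, shift_monomial, shift_monomial, mul_assoc]

lemma shift_one : shift 1 = 1 :=
  clm_ext_monomial fun k => by
    rw [shift_monomial, one_mul, one_apply_eq_self]

lemma shift_pow (m : ℕ+) (k : ℕ) : shift m ^ k = shift (m ^ k) := by
  induction k with
  | zero => rw [pow_zero, pow_zero, shift_one]
  | succ k ih => rw [pow_succ, pow_succ, shift_mul, ih]

lemma commute_shift (m n : ℕ+) : Commute (shift m) (shift n) := by
  rw [Commute, SemiconjBy, ← shift_mul, ← shift_mul, mul_comm]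

lemma shift_apply_eq_zero {m k : ℕ+} {x : H2} (h : ∀ n, x n ≠ 0 → m * n ≠ k) :
    shift m x k = 0 := by
  have h1 := ((hasSum_smul_monomial x).mapL (shift m)).mapL (innerSL ℂ (monomial k))
  simp only [innerSL_apply_apply, map_smul, inner_monomial, shift_monomial] at h1
  refine h1.unique ?_
  convert hasSum_zero using 2 with n
  by_cases hn : x n = 0
  · rw [hn, zero_smul]
  · rw [monomial, lp.single_apply_ne _ _ _ (h n hn).symm, smul_zero]

/-- If the `m ^ k`-dilates of the support of `x` are disjoint, then the terms of
`exp (b • shift m) x` are orthogonal. -/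
lemma norm_exp_smul_shift_sq_le {Q : Set ℕ+} {m : ℕ+} {x : H2} (hx : ∀ n, x n ≠ 0 → n ∈ Q)
    (hQ : ∀ k l : ℕ, ∀ n ∈ Q, ∀ n' ∈ Q, m ^ k * n = m ^ l * n' → k = l)
    {b : ℂ} (hb : b ≠ 0) :
    (∀ n, NormedSpace.exp (b • shift m) x n ≠ 0 → ∃ k : ℕ, ∃ n' ∈ Q, m ^ k * n' = n) ∧
    ‖NormedSpace.exp (b • shift m) x‖ ^ 2 ≤ Real.exp (2 * ‖b‖) / √‖b‖ * ‖x‖ ^ 2 := by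
  have h0 := (NormedSpace.exp_series_hasSum_exp' (𝕂 := ℂ) (b • shift m)).mapL
    (ContinuousLinearMap.apply ℂ H2 x)
  simp only [ContinuousLinearMap.apply_apply, _root_.smul_apply, smul_pow,
    shift_pow] at h0
  have hsupp (k : ℕ) (n : ℕ+) (hn : shift (m ^ k) x n ≠ 0) : ∃ n' ∈ Q, m ^ k * n' = n := by
    by_contra! hcon
    exact hn (shift_apply_eq_zero fun n' hn' => hcon n' (hx n' hn'))
  refine ⟨fun n hn => ?_, ?_⟩
  · by_contra! hcon
    have h1 := h0.mapL (innerSL ℂ (monomial n))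
    refine hn ?_
    simp only [innerSL_apply_apply, inner_monomial] at h1
    refine h1.unique ?_
    convert hasSum_zero using 2 with k
    have : shift (m ^ k) x n = 0 := by
      by_contra hne
      obtain ⟨n', h', h''⟩ := hsupp k n hne
      exact hcon k n' h' h''
    simp [this]
  · have hnorm (k : ℕ) : ‖(k.factorial⁻¹ : ℂ) • b ^ k • shift (m ^ k) x‖ ^ 2 =
        (‖b‖ ^ k / k.factorial) ^ 2 * ‖x‖ ^ 2 := by
      rw [norm_smul, norm_smul, norm_shift_apply, norm_inv, Complex.norm_natCast, norm_pow]
      ring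
    obtain ⟨hs, hle⟩ := summable_and_tsum_pow_div_factorial_sq_le ‖b‖ (norm_pos_iff.2 hb)
    refine (norm_sq_le_of_hasSum_orthogonal h0 (fun k l hkl => ?_) ?_).trans ?_
    · rw [inner_smul_left, inner_smul_left, inner_smul_right, inner_smul_right,
        lp.inner_eq_tsum]
      have : ∀ n, inner ℂ (shift (m ^ k) x n) (shift (m ^ l) x n) = 0 := by
        intro n
        by_contra hne
        have hk : shift (m ^ k) x n ≠ 0 := fun h => hne (by rw [h, inner_zero_left])
        have hl : shift (m ^ l) x n ≠ 0 := fun h => hne (by rw [h, inner_zero_right])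
        obtain ⟨u, hu, hun⟩ := hsupp k n hk
        obtain ⟨v, hv, hvn⟩ := hsupp l n hl
        exact hkl (hQ k l u hu v hv (hun.trans hvn.symm))
      simp only [this, tsum_zero, mul_zero]
    · simpa only [hnorm] using hs.mul_right _
    · simp only [hnorm]
      rw [tsum_mul_right]
      gcongr

lemma exp_add_clm {A B : H2 →L[ℂ] H2} (h : Commute A B) :
    NormedSpace.exp (A + B) = NormedSpace.exp A * NormedSpace.exp B := by
  let _ : NormedAlgebra ℚ (H2 →L[ℂ] H2) := NormedAlgebra.restrictScalars ℚ ℂ _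
  exact NormedSpace.exp_add_of_commute h

/-- Evaluation at a point of `ℂ_{1/2}`. -/
lemma exists_evaluation {s : ℂ} (hs : 1 / 2 < s.re) :
    ∃ ev : H2 →L[ℂ] ℂ, (∀ x, ev x = H2series x s) ∧
      ∀ n : ℕ+, ev (monomial n) = (n : ℂ) ^ (-s) := by
  have hnorm (n : ℕ+) : ‖(n : ℂ) ^ (-s)‖ ^ 2 = ((n : ℕ) : ℝ) ^ (-(2 * s.re)) := by
    rw [Complex.norm_natCast_cpow_of_pos n.pos, ← Real.rpow_natCast,
      ← Real.rpow_mul (by positivity)]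
    congr 1
    simp
    ring
  obtain ⟨ev, hev, -⟩ := exists_clm_of_summable_norm_sq (fun n : ℕ+ => (n : ℂ) ^ (-s)) (by
    simp only [hnorm]
    exact (Real.summable_nat_rpow.2 (by linarith)).comp_injective PNat.coe_injective)
  refine ⟨ev, fun x => (hev x).tsum_eq.symm, fun n => (hev _).unique ?_⟩
  refine (hasSum_ite_eq n ((n : ℂ) ^ (-s))).congr_fun fun k => ?_
  by_cases hk : k = n
  · subst hk; simp [monomial]
  · rw [monomial, lp.single_apply_ne _ _ _ hk, zero_smul, if_neg hk]

end Shift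

section Generator

/-- The indices of the Dirichlet monomials in the variables `q 0 ^ {-s}, …, q (d - 1) ^ {-s}`. -/
def multSpan (q : ℕ → ℕ+) (d : ℕ) : Set ℕ+ :=
  {n | ∃ α : ℕ →₀ ℕ, (∀ j, d ≤ j → α j = 0) ∧ (α.prod fun j e => (q j : ℕ) ^ e) = n}

lemma prod_add_single (q : ℕ → ℕ+) (α : ℕ →₀ ℕ) (d k : ℕ) :
    ((α + Finsupp.single d k).prod fun j e => (q j : ℕ) ^ e) =
      (q d : ℕ) ^ k * α.prod fun j e => (q j : ℕ) ^ e := by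
  rw [Finsupp.prod_add_index' (h := fun j e => (q j : ℕ) ^ e) (fun _ => pow_zero _)
    (fun _ _ _ => pow_add _ _ _),
    Finsupp.prod_single_index (h := fun j e => (q j : ℕ) ^ e) (pow_zero _), mul_comm]

lemma pow_mul_mem_multSpan {q : ℕ → ℕ+} {d : ℕ} (k : ℕ) {n : ℕ+} (hn : n ∈ multSpan q d) :
    q d ^ k * n ∈ multSpan q (d + 1) := by
  obtain ⟨α, h0, hα⟩ := hn
  refine ⟨α + Finsupp.single d k, fun j hj => ?_, ?_⟩
  · rw [Finsupp.add_apply, h0 j (by omega), Finsupp.single_eq_of_ne (by omega), add_zero]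
  · rw [prod_add_single, hα]
    simp

lemma eq_of_pow_mul_eq {q : ℕ → ℕ+} (hind : MultIndepSeq fun j => (q j : ℕ)) {d : ℕ} (k l : ℕ)
    (n : ℕ+) (hn : n ∈ multSpan q d) (n' : ℕ+) (hn' : n' ∈ multSpan q d)
    (h : q d ^ k * n = q d ^ l * n') : k = l := by
  obtain ⟨α, hα0, hα⟩ := hn
  obtain ⟨β, hβ0, hβ⟩ := hn'
  have := hind (α + Finsupp.single d k) (β + Finsupp.single d l) (by
    rw [prod_add_single, prod_add_single, hα, hβ]
    exact_mod_cast congrArg PNat.val h)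
  simpa [hα0 d le_rfl, hβ0 d le_rfl] using DFunLike.congr_fun this d

variable {q : ℕ → ℕ+} {a : ℕ → ℂ}

lemma norm_exp_sum_shift_sq_le (hind : MultIndepSeq fun j => (q j : ℕ)) (ha : ∀ j, a j ≠ 0)
    {t : ℝ} (ht : 0 < t) (d : ℕ) :
    (∀ n, NormedSpace.exp (∑ j ∈ Finset.range d, ((t : ℂ) * -a j) • shift (q j)) (monomial 1) n ≠ 0
      → n ∈ multSpan q d) ∧
    ‖NormedSpace.exp (∑ j ∈ Finset.range d, ((t : ℂ) * -a j) • shift (q j)) (monomial 1)‖ ^ 2 ≤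
      ∏ j ∈ Finset.range d, Real.exp (2 * (t * ‖a j‖)) / √(t * ‖a j‖) := by
  induction d with
  | zero =>
    rw [Finset.sum_range_zero, Finset.prod_range_zero, NormedSpace.exp_zero, one_apply_eq_self,
      norm_monomial]
    refine ⟨fun n hn => ?_, by norm_num⟩
    have : n = 1 := by
      by_contra h
      exact hn (lp.single_apply_ne _ _ _ h)
    subst this
    exact ⟨0, by simp, by simp⟩
  | succ d ih =>
    have hb : (t : ℂ) * -a d ≠ 0 :=
      mul_ne_zero (Complex.ofReal_ne_zero.2 ht.ne') (neg_ne_zero.2 (ha d))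
    have hbn : ‖(t : ℂ) * -a d‖ = t * ‖a d‖ := by
      rw [norm_mul, norm_neg, Complex.norm_of_nonneg ht.le]
    have hc : Commute (((t : ℂ) * -a d) • shift (q d))
        (∑ j ∈ Finset.range d, ((t : ℂ) * -a j) • shift (q j)) :=
      Commute.sum_right _ _ _ fun j _ =>
        ((commute_shift _ _).smul_right _).smul_left _
    obtain ⟨h1, h2⟩ := norm_exp_smul_shift_sq_le ih.1 (eq_of_pow_mul_eq hind) hb
    rw [Finset.sum_range_succ, add_comm, exp_add_clm hc, mul_apply_eq_comp]
    refine ⟨fun n hn => ?_, ?_⟩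
    · obtain ⟨k, n', hn', rfl⟩ := h1 n hn
      exact pow_mul_mem_multSpan k hn'
    · rw [hbn] at h2
      rw [Finset.prod_range_succ, mul_comm (∏ j ∈ Finset.range d, _)]
      exact h2.trans (mul_le_mul_of_nonneg_left ih.2 (by positivity))

lemma norm_smul_shift_le (c : ℂ) (m : ℕ+) : ‖c • shift m‖ ≤ ‖c‖ := by
  rw [norm_smul]
  exact mul_le_of_le_one_right (norm_nonneg _) (norm_shift_le m)

/-- Multiplication by `-∑ a j * q j ^ {-s}` on `ℋ²`. -/
def generator (q : ℕ → ℕ+) (a : ℕ → ℂ) : H2 →L[ℂ] H2 := ∑' j, (-a j) • shift (q j)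

lemma hasSum_generator (hsum : Summable fun j => ‖a j‖) :
    HasSum (fun j => (-a j) • shift (q j)) (generator q a) :=
  (Summable.of_norm_bounded hsum fun j => by
    simpa using norm_smul_shift_le (-a j) (q j)).hasSum

lemma norm_generator_le (hsum : Summable fun j => ‖a j‖) :
    ‖generator q a‖ ≤ ∑' j, ‖a j‖ :=
  tsum_of_norm_bounded hsum.hasSum fun j => by simpa using norm_smul_shift_le (-a j) (q j)

lemma commute_generator_shift (m : ℕ+) : Commute (generator q a) (shift m) :=
  Commute.tsum_left _ fun j => (commute_shift (q j) m).smul_left _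

/-- The orbit of `1` under the semigroup of the generator beats its exponential type by
any number of factors `(t ‖a j‖) ^ (-1/2)`. -/
lemma norm_exp_generator_sq_le (hind : MultIndepSeq fun j => (q j : ℕ)) (ha : ∀ j, a j ≠ 0)
    (hsum : Summable fun j => ‖a j‖) {t : ℝ} (ht : 0 < t) (d : ℕ) :
    ‖NormedSpace.exp ((t : ℂ) • generator q a) (monomial 1)‖ ^ 2 ≤
      Real.exp (2 * t * ∑' j, ‖a j‖) * ∏ j ∈ Finset.range d, (√(t * ‖a j‖))⁻¹ := by
  set P := ∑ j ∈ Finset.range d, ((t : ℂ) * -a j) • shift (q j) with hP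
  have hrest : HasSum (fun j => ((t : ℂ) * -a (j + d)) • shift (q (j + d)))
      ((t : ℂ) • generator q a - P) := by
    have h := (hasSum_generator (q := q) hsum).const_smul (t : ℂ)
    simp only [smul_smul] at h
    exact (hasSum_nat_add_iff' d).2 h
  have hbound : ‖(t : ℂ) • generator q a - P‖ ≤ t * ∑' j, ‖a (j + d)‖ := by
    rw [← hrest.tsum_eq]
    refine tsum_of_norm_bounded (((summable_nat_add_iff d).2 hsum).hasSum.mul_left t) fun j => ?_
    refine (norm_smul_shift_le _ _).trans_eq ?_
    rw [norm_mul, norm_neg, Complex.norm_of_nonneg ht.le]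
  have hc : Commute ((t : ℂ) • generator q a - P) P := by
    refine Commute.sub_left ?_ (Commute.refl P)
    exact Commute.sum_right _ _ _ fun j _ =>
      ((commute_generator_shift _).smul_right _).smul_left _
  have hsplit : (t : ℂ) • generator q a = ((t : ℂ) • generator q a - P) + P := by abel
  have htsum := hsum.sum_add_tsum_nat_add d
  have hE := (norm_exp_sum_shift_sq_le hind ha ht d).2
  rw [← hP, Finset.prod_congr rfl fun j _ => div_eq_mul_inv _ _, Finset.prod_mul_distrib,
    ← Real.exp_sum] at hE
  rw [hsplit, exp_add_clm hc, mul_apply_eq_comp]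
  calc _ ≤ (Real.exp (t * ∑' j, ‖a (j + d)‖) * ‖NormedSpace.exp P (monomial 1)‖) ^ 2 := by
        gcongr
        refine (ContinuousLinearMap.le_opNorm _ _).trans ?_
        gcongr
        exact (norm_exp_le _).trans (Real.exp_le_exp.2 hbound)
    _ = Real.exp (2 * (t * ∑' j, ‖a (j + d)‖)) * ‖NormedSpace.exp P (monomial 1)‖ ^ 2 := by
        rw [mul_pow, ← Real.exp_nat_mul]; norm_num
    _ ≤ Real.exp (2 * (t * ∑' j, ‖a (j + d)‖)) *
        (Real.exp (∑ j ∈ Finset.range d, 2 * (t * ‖a j‖)) *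
          ∏ j ∈ Finset.range d, (√(t * ‖a j‖))⁻¹) := by gcongr
    _ = _ := by
        rw [← mul_assoc, ← Real.exp_add, ← Finset.mul_sum, ← Finset.mul_sum]
        congr 2
        rw [← htsum]
        ring

lemma exists_norm_exp_generator_sq_le (hind : MultIndepSeq fun j => (q j : ℕ))
    (ha : ∀ j, a j ≠ 0) (hsum : Summable fun j => ‖a j‖) (A : ℕ) :
    ∃ C : ℝ, 0 ≤ C ∧ ∀ k : ℕ,
      ‖NormedSpace.exp (((k * Real.log 2 : ℝ) : ℂ) • generator q a) (monomial 1)‖ ^ 2 ≤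
        C * Real.exp (2 * (k * Real.log 2) * ∑' j, ‖a j‖) / (k + 1) ^ A := by
  set D := ∏ j ∈ Finset.range (2 * A), (√‖a j‖)⁻¹ with hD
  have hD0 : 0 ≤ D := Finset.prod_nonneg fun j _ => by positivity
  have hl : (1 : ℝ) / 2 ≤ Real.log 2 := by linarith [Real.log_two_gt_d9]
  refine ⟨1 + 4 ^ A * D, by positivity, fun k => ?_⟩
  rcases Nat.eq_zero_or_pos k with rfl | hk
  · simp only [Nat.cast_zero, zero_mul, Complex.ofReal_zero, zero_smul, NormedSpace.exp_zero,
      one_apply_eq_self, norm_monomial, mul_zero, Real.exp_zero, zero_add, one_pow, mul_one, div_one]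
    linarith [show 0 ≤ 4 ^ A * D by positivity]
  have hk1 : (1 : ℝ) ≤ k := by exact_mod_cast hk
  have ht : ((k : ℝ) + 1) / 4 ≤ k * Real.log 2 := by nlinarith
  have ht0 : 0 < k * Real.log 2 := by positivity
  refine (norm_exp_generator_sq_le hind ha hsum ht0 (2 * A)).trans ?_
  have h1 : ∏ j ∈ Finset.range (2 * A), (√(k * Real.log 2 * ‖a j‖))⁻¹ =
      ((k * Real.log 2)⁻¹) ^ A * D := by
    rw [hD, Finset.prod_congr rfl fun j _ => by rw [Real.sqrt_mul ht0.le, mul_inv],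
      Finset.prod_mul_distrib, Finset.prod_const, Finset.card_range, pow_mul, inv_pow,
      Real.sq_sqrt ht0.le]
  have h2 : ((k * Real.log 2)⁻¹) ^ A ≤ 4 ^ A / ((k : ℝ) + 1) ^ A := by
    rw [← div_pow]
    gcongr
    rw [inv_le_comm₀ ht0 (by positivity), inv_div]
    exact ht
  rw [h1]
  calc _ ≤ Real.exp (2 * (k * Real.log 2) * ∑' j, ‖a j‖) * (4 ^ A / ((k : ℝ) + 1) ^ A * D) := by
        gcongr
    _ = 4 ^ A * D * Real.exp (2 * (k * Real.log 2) * ∑' j, ‖a j‖) / (k + 1) ^ A := by ring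
    _ ≤ _ := by gcongr; linarith

lemma evaluation_exp_generator (hsum : Summable fun j => ‖a j‖) {s : ℂ} {ev : H2 →L[ℂ] ℂ}
    (hev : ∀ n : ℕ+, ev (monomial n) = (n : ℂ) ^ (-s)) (t : ℂ) :
    ev (NormedSpace.exp (t • generator q a) (monomial 1)) =
      Complex.exp (-(t * ∑' j, a j * (q j : ℂ) ^ (-s))) := by
  set z := ∑' j, a j * (q j : ℂ) ^ (-s) with hz
  have hshift (m : ℕ+) (x : H2) : ev (shift m x) = (m : ℂ) ^ (-s) * ev x := by
    have : ev.comp (shift m) = (m : ℂ) ^ (-s) • ev := clm_ext_monomial fun n => by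
      simp only [ContinuousLinearMap.comp_apply, _root_.smul_apply, smul_eq_mul, shift_monomial,
        hev, PNat.mul_coe, Nat.cast_mul]
      exact Complex.natCast_mul_natCast_cpow _ _ _
    simpa using DFunLike.congr_fun this x
  have hgen (x : H2) : ev (generator q a x) = -z * ev x := by
    have h := ((hasSum_generator (q := q) hsum).mapL (ContinuousLinearMap.apply ℂ H2 x)).mapL ev
    simp only [ContinuousLinearMap.apply_apply, map_smul, hshift,
      smul_eq_mul] at h
    rw [← h.tsum_eq, hz, ← tsum_neg, ← tsum_mul_right]
    exact tsum_congr fun j => by ring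
  have hpow (i : ℕ) (x : H2) : ev ((generator q a ^ i) x) = (-z) ^ i * ev x := by
    induction i with
    | zero => simp
    | succ i ih => rw [pow_succ', mul_apply_eq_comp, hgen, ih, pow_succ']; ring
  have h := ((NormedSpace.exp_series_hasSum_exp' (𝕂 := ℂ) (t • generator q a)).mapL
    (ContinuousLinearMap.apply ℂ H2 (monomial 1))).mapL ev
  simp only [ContinuousLinearMap.apply_apply, map_smul, smul_pow, hpow, hev,
    PNat.one_coe, Nat.cast_one, Complex.one_cpow, mul_one, smul_eq_mul, ← mul_pow] at h
  refine h.unique ?_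
  rw [← mul_neg, Complex.exp_eq_exp_ℂ]
  exact NormedSpace.exp_series_hasSum_exp' (𝕂 := ℂ) (t * -z)

end Generator

section Approximation

lemma approxNumber_nonneg (T : H2 →L[ℂ] H2) (n : ℕ) : 0 ≤ approxNumber T n :=
  Real.sInf_nonneg fun c hc => by
    obtain ⟨R, -, -, rfl⟩ := hc
    exact norm_nonneg _

lemma approxNumber_le_s6 (T R : H2 →L[ℂ] H2) (V : Submodule ℂ H2) [FiniteDimensional ℂ V]
    (hR : ∀ x, R x ∈ V) {n : ℕ} (hV : Module.finrank ℂ V < n) : approxNumber T n ≤ ‖T - R‖ := by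
  have hle : LinearMap.range (R : H2 →ₗ[ℂ] H2) ≤ V := by
    rintro _ ⟨x, rfl⟩
    exact hR x
  refine csInf_le ⟨0, ?_⟩
    ⟨R, Submodule.finiteDimensional_of_le hle, (Submodule.finrank_mono hle).trans_lt hV, rfl⟩
  rintro c ⟨R, -, -, rfl⟩
  exact norm_nonneg _

/-- The image of `n^{-s}` under the composition operator with symbol `c₁ + ∑ a j * q j ^ {-s}`. -/
def orbit (q : ℕ → ℕ+) (a : ℕ → ℂ) (c₁ : ℂ) (n : ℕ+) : H2 :=
  (n : ℂ) ^ (-c₁) • NormedSpace.exp (((Real.log n : ℝ) : ℂ) • generator q a) (monomial 1)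

variable {q : ℕ → ℕ+} {a : ℕ → ℂ} {c₁ : ℂ}

lemma evaluation_orbit (hsum : Summable fun j => ‖a j‖) {s : ℂ} {ev : H2 →L[ℂ] ℂ}
    (hev : ∀ n : ℕ+, ev (monomial n) = (n : ℂ) ^ (-s)) (n : ℕ+) :
    ev (orbit q a c₁ n) = (n : ℂ) ^ (-(c₁ + ∑' j, a j * (q j : ℂ) ^ (-s))) := by
  have hn : (n : ℂ) ≠ 0 := Nat.cast_ne_zero.2 n.ne_zero
  rw [orbit, map_smul, evaluation_exp_generator hsum hev, smul_eq_mul, neg_add,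
    Complex.cpow_add _ _ hn, Complex.natCast_log, Complex.cpow_def_of_ne_zero hn (-(∑' j, _)),
    mul_neg]

/-- Taylor expansion of `orbit` at the dyadic points of the logarithmic scale. -/
def taylorOrbit (q : ℕ → ℕ+) (a : ℕ → ℂ) (c₁ : ℂ) (m : ℕ) (n : ℕ+) : H2 :=
  (n : ℂ) ^ (-c₁) • ∑ i ∈ Finset.range m,
    ((i.factorial⁻¹ : ℂ) * ((Real.log n - Nat.log 2 n * Real.log 2 : ℝ) : ℂ) ^ i) •
      (generator q a ^ i) (NormedSpace.exp
        (((Nat.log 2 n * Real.log 2 : ℝ) : ℂ) • generator q a) (monomial 1))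

lemma log_sub_natLog_mem (n : ℕ+) :
    0 ≤ Real.log n - Nat.log 2 n * Real.log 2 ∧ Real.log n - Nat.log 2 n * Real.log 2 ≤ 1 := by
  have hn : (0 : ℝ) < (n : ℕ) := Nat.cast_pos.2 n.pos
  have h1 : ((2 : ℝ) ^ Nat.log 2 n) ≤ (n : ℕ) := by
    exact_mod_cast Nat.pow_log_le_self 2 n.ne_zero
  have h2 : ((n : ℕ) : ℝ) ≤ 2 ^ (Nat.log 2 n + 1) := by
    exact_mod_cast (Nat.lt_pow_succ_log_self one_lt_two (n : ℕ)).le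
  have h3 := Real.log_le_log (by positivity) h1
  have h4 := Real.log_le_log hn h2
  rw [Real.log_pow] at h3 h4
  push_cast at h4
  constructor <;> linarith [Real.log_two_lt_d9]

lemma norm_orbit_sub_taylorOrbit_sq_le (hsum : Summable fun j => ‖a j‖)
    (hκ : c₁.re - ∑' j, ‖a j‖ = 1 / 2) {A : ℕ} {C : ℝ}
    (hC : ∀ k : ℕ,
      ‖NormedSpace.exp (((k * Real.log 2 : ℝ) : ℂ) • generator q a) (monomial 1)‖ ^ 2 ≤
        C * Real.exp (2 * (k * Real.log 2) * ∑' j, ‖a j‖) / (k + 1) ^ A) (m : ℕ) (n : ℕ+) :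
    ‖orbit q a c₁ n - taylorOrbit q a c₁ m n‖ ^ 2 ≤
      C * Real.exp (4 * ∑' j, ‖a j‖) * (1 / 4) ^ m / (Nat.log 2 n + 1) ^ A / 2 ^ Nat.log 2 n := by
  set K := ∑' j, ‖a j‖ with hK
  have hK0 : 0 ≤ K := tsum_nonneg fun j => norm_nonneg _
  set k := Nat.log 2 n with hk
  obtain ⟨hu0, hu1⟩ := log_sub_natLog_mem n
  rw [← hk] at hu0 hu1
  set t : ℝ := k * Real.log 2 with ht
  have ht0 : 0 ≤ t := by positivity
  set u : ℝ := Real.log n - t with hu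
  set L := generator q a with hL
  set x := NormedSpace.exp ((t : ℂ) • L) (monomial 1) with hx
  have hlog : ((Real.log n : ℝ) : ℂ) • L = (u : ℂ) • L + (t : ℂ) • L := by
    rw [← add_smul, hu]; push_cast; ring_nf
  have hcomm : Commute ((u : ℂ) • L) ((t : ℂ) • L) :=
    ((Commute.refl L).smul_right _).smul_left _
  have hdiff : orbit q a c₁ n - taylorOrbit q a c₁ m n = (n : ℂ) ^ (-c₁) •
      (NormedSpace.exp ((u : ℂ) • L) -
        ∑ i ∈ Finset.range m, (i.factorial⁻¹ : ℂ) • ((u : ℂ) • L) ^ i) x := by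
    rw [orbit, taylorOrbit, ← smul_sub, ← hL, hlog, exp_add_clm hcomm, mul_apply_eq_comp,
      _root_.sub_apply, _root_.sum_apply]
    simp only [smul_pow, smul_smul, _root_.smul_apply]
    rfl
  have h1 : ‖(n : ℂ) ^ (-c₁)‖ ≤ Real.exp (-(t * c₁.re)) := by
    have hn : (0 : ℝ) < (n : ℕ) := Nat.cast_pos.2 n.pos
    rw [Complex.norm_natCast_cpow_of_pos n.pos, Real.rpow_def_of_pos hn, Complex.neg_re,
      Real.exp_le_exp]
    nlinarith
  have huL : ‖(u : ℂ) • L‖ ≤ K := by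
    rw [norm_smul, Complex.norm_of_nonneg hu0]
    exact (mul_le_of_le_one_left (norm_nonneg _) hu1).trans (norm_generator_le hsum)
  have h2 : ‖NormedSpace.exp ((u : ℂ) • L) -
      ∑ i ∈ Finset.range m, (i.factorial⁻¹ : ℂ) • ((u : ℂ) • L) ^ i‖ ≤
      (1 / 2) ^ m * Real.exp (2 * K) :=
    (norm_exp_sub_sum_le _ m).trans (by gcongr)
  have hexp : Real.exp (-(t * c₁.re)) ^ 2 * Real.exp (2 * t * K) = 1 / 2 ^ k := by
    have : (2 : ℝ) ^ k = Real.exp t := by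
      rw [ht, Real.exp_nat_mul, Real.exp_log two_pos]
    rw [this, ← Real.exp_nat_mul, ← Real.exp_add, one_div, ← Real.exp_neg]
    congr 1
    push_cast
    linear_combination (-2 * t) * hκ
  have hexp' : Real.exp (2 * K) ^ 2 = Real.exp (4 * K) := by
    rw [← Real.exp_nat_mul]; congr 1; push_cast; ring
  have hpow : (((1 : ℝ) / 2) ^ m) ^ 2 = (1 / 4) ^ m := by
    rw [← pow_mul, mul_comm, pow_mul]; norm_num
  calc ‖orbit q a c₁ n - taylorOrbit q a c₁ m n‖ ^ 2
      ≤ (Real.exp (-(t * c₁.re)) * (((1 / 2) ^ m * Real.exp (2 * K)) * ‖x‖)) ^ 2 := by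
        rw [hdiff, norm_smul]
        gcongr
        exact (ContinuousLinearMap.le_opNorm _ _).trans (by gcongr)
    _ = Real.exp (-(t * c₁.re)) ^ 2 * ((1 / 4) ^ m * Real.exp (4 * K)) * ‖x‖ ^ 2 := by
        rw [mul_pow, mul_pow, mul_pow, hpow, hexp']; ring
    _ ≤ Real.exp (-(t * c₁.re)) ^ 2 * ((1 / 4) ^ m * Real.exp (4 * K)) *
          (C * Real.exp (2 * t * K) / (k + 1) ^ A) := by
        gcongr
        exact hC k
    _ = C * Real.exp (4 * K) * (1 / 4) ^ m / (k + 1) ^ A *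
          (Real.exp (-(t * c₁.re)) ^ 2 * Real.exp (2 * t * K)) := by ring
    _ = _ := by rw [hexp]; ring

lemma exists_quarter_pow_le (B : ℕ) : ∃ D : ℝ, 0 ≤ D ∧
    ∀ X : ℕ, (1 / 4 : ℝ) ^ X ≤ D / (X + 1) ^ B := by
  obtain ⟨D, hD⟩ :=
    (tendsto_pow_const_div_const_pow_of_one_lt B (r := 4) (by norm_num)).bddAbove_range
  have hD' (X : ℕ) : ((X : ℝ) + 1) ^ B / 4 ^ (X + 1) ≤ D := by
    have := hD ⟨X + 1, rfl⟩
    push_cast at this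
    exact this
  have hD0 : 0 ≤ D := le_trans (by positivity) (hD' 0)
  refine ⟨4 * D, by positivity, fun X => ?_⟩
  rw [le_div_iff₀ (by positivity), one_div, inv_pow]
  have := hD' X
  rw [pow_succ, div_le_iff₀ (by positivity)] at this
  rw [inv_mul_le_iff₀ (by positivity)]
  linarith

/-- Keeping `X` Taylor coefficients on each of the first `X` dyadic blocks approximates the orbit
to any polynomial order in `X`. -/
lemma exists_norm_orbit_sub_taylorOrbit_le (hind : MultIndepSeq fun j => (q j : ℕ))
    (ha : ∀ j, a j ≠ 0) (hsum : Summable fun j => ‖a j‖)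
    (hκ : c₁.re - ∑' j, ‖a j‖ = 1 / 2) (B : ℕ) :
    ∃ M : ℝ, 0 ≤ M ∧ ∀ X : ℕ,
      (Summable fun n => ‖orbit q a c₁ n -
        taylorOrbit q a c₁ (if Nat.log 2 n < X then X else 0) n‖ ^ 2) ∧
      ∑' n, ‖orbit q a c₁ n -
        taylorOrbit q a c₁ (if Nat.log 2 n < X then X else 0) n‖ ^ 2 ≤ M / (X + 1) ^ B := by
  obtain ⟨C, hC0, hC⟩ := exists_norm_exp_generator_sq_le hind ha hsum (B + 2)
  obtain ⟨D, hD0, hD⟩ := exists_quarter_pow_le B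
  set E := C * Real.exp (4 * ∑' j, ‖a j‖) with hE
  have hE0 : 0 ≤ E := by positivity
  have hS : Summable fun k : ℕ => 1 / ((k : ℝ) + 1) ^ 2 := by
    simpa using (summable_nat_add_iff 1).2 (Real.summable_one_div_nat_pow.2 one_lt_two)
  refine ⟨E * (D + 1) * ∑' k : ℕ, 1 / ((k : ℝ) + 1) ^ 2, by positivity, fun X => ?_⟩
  obtain ⟨h1, h2⟩ := summable_and_tsum_le_of_dyadic
    (b := fun k => E * (D + 1) / (X + 1) ^ B * (1 / ((k : ℝ) + 1) ^ 2))
    (f := fun n => ‖orbit q a c₁ n -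
        taylorOrbit q a c₁ (if Nat.log 2 n < X then X else 0) n‖ ^ 2)
    (fun n => sq_nonneg _) (hS.mul_left _) (fun k => by positivity) (fun n => by
      refine (norm_orbit_sub_taylorOrbit_sq_le hsum hκ hC _ n).trans ?_
      rw [← hE]
      set k := Nat.log 2 n
      have key : (1 / 4 : ℝ) ^ (if k < X then X else 0) / (k + 1) ^ B ≤
          (D + 1) / (X + 1) ^ B := by
        split_ifs with hk
        · refine (div_le_self (by positivity) (one_le_pow₀ (by simp))).trans ((hD X).trans ?_)
          gcongr
          linarith
        · have hk' : (X : ℝ) ≤ k := by exact_mod_cast not_lt.1 hk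
          rw [pow_zero]
          gcongr
          linarith
      calc _ = E * ((1 / 4 : ℝ) ^ (if k < X then X else 0) / (k + 1) ^ B) *
            (1 / ((k : ℝ) + 1) ^ 2) / 2 ^ k := by rw [pow_add]; field_simp
        _ ≤ E * ((D + 1) / (X + 1) ^ B) * (1 / ((k : ℝ) + 1) ^ 2) / 2 ^ k := by gcongr
        _ = _ := by ring)
  refine ⟨h1, h2.trans_eq ?_⟩
  rw [tsum_mul_left]
  ring

lemma exists_taylorOrbit_mem (q : ℕ → ℕ+) (a : ℕ → ℂ) (c₁ : ℂ) (X : ℕ) :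
    ∃ V : Submodule ℂ H2, FiniteDimensional ℂ V ∧ Module.finrank ℂ V ≤ X * X ∧
      ∀ n : ℕ+, taylorOrbit q a c₁ (if Nat.log 2 n < X then X else 0) n ∈ V := by
  classical
  let g : ℕ × ℕ → H2 := fun p => (generator q a ^ p.2) (NormedSpace.exp
        (((p.1 * Real.log 2 : ℝ) : ℂ) • generator q a) (monomial 1))
  let S : Finset H2 := (Finset.range X ×ˢ Finset.range X).image g
  refine ⟨Submodule.span ℂ S, FiniteDimensional.span_finset ℂ S, ?_, fun n => ?_⟩
  · refine (finrank_span_finset_le_card S).trans (Finset.card_image_le.trans ?_)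
    rw [Finset.card_product, Finset.card_range]
  · refine Submodule.smul_mem _ _ (Submodule.sum_mem _ fun i hi => Submodule.smul_mem _ _ ?_)
    split_ifs at hi with hk
    · refine Submodule.subset_span
        (Finset.mem_coe.2 (Finset.mem_image.2 ⟨(Nat.log 2 n, i), ?_, rfl⟩))
      exact Finset.mem_product.2 ⟨Finset.mem_range.2 hk, hi⟩
    · simp at hi

lemma exists_approxNumber_le (hind : MultIndepSeq fun j => (q j : ℕ))
    (ha : ∀ j, a j ≠ 0) (hsum : Summable fun j => ‖a j‖)
    (hκ : c₁.re - ∑' j, ‖a j‖ = 1 / 2) {T : H2 →L[ℂ] H2}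
    (hT : ∀ x : H2, HasSum (fun n => x n • orbit q a c₁ n) (T x)) (D : ℕ) :
    ∃ M : ℝ, 0 ≤ M ∧ ∀ n : ℕ, approxNumber T (n + 1) ≤ M / (n + 1) ^ D := by
  obtain ⟨M, hM0, hM⟩ := exists_norm_orbit_sub_taylorOrbit_le hind ha hsum hκ (4 * D)
  refine ⟨√M, Real.sqrt_nonneg _, fun n => ?_⟩
  set X := Nat.sqrt n
  obtain ⟨hs, hle⟩ := hM X
  obtain ⟨U, hU, hUn⟩ := exists_clm_of_summable_norm_sq _ hs
  obtain ⟨V, hV, hVX, hVn⟩ := exists_taylorOrbit_mem q a c₁ X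
  have hmem (x : H2) : (T - U) x ∈ V := by
    have h := (hT x).sub (hU x)
    simp only [← smul_sub, sub_sub_cancel] at h
    exact (Submodule.closed_of_finiteDimensional V).mem_of_tendsto h
      (Eventually.of_forall fun s => Submodule.sum_mem _ fun n _ => Submodule.smul_mem _ _ (hVn n))
  refine (approxNumber_le_s6 T (T - U) V hmem (Nat.lt_succ_of_le
    (hVX.trans (Nat.sqrt_le n)))).trans ?_
  rw [sub_sub_cancel]
  refine hUn.trans ((Real.sqrt_le_sqrt hle).trans ?_)
  rw [Real.sqrt_div hM0]
  have hX : ((n : ℝ) + 1) ≤ ((X : ℝ) + 1) ^ 2 := by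
    have : n + 1 ≤ (X + 1) ^ 2 := Nat.lt_succ_sqrt' n
    exact_mod_cast this
  gcongr
  refine Real.le_sqrt_of_sq_le ?_
  calc (((n : ℝ) + 1) ^ D) ^ 2 ≤ ((((X : ℝ) + 1) ^ 2) ^ D) ^ 2 := by gcongr
    _ = _ := by rw [← pow_mul, ← pow_mul]; congr 1; ring

end Approximation

theorem stmt6 (q : ℕ → ℕ) (hq : ∀ j, 2 ≤ q j) (hind : MultIndepSeq q)
    (a : ℕ → ℂ) (ha : ∀ j, a j ≠ 0) (hsum : Summable fun j => ‖a j‖) (c₁ : ℂ)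
    (hκ : c₁.re - ∑' j, ‖a j‖ = 1 / 2) :
    ∃ T : H2 →L[ℂ] H2,
      IsCompOp (fun s => c₁ + ∑' j, a j * (q j : ℂ) ^ (-s)) T ∧
      ∀ p : ℝ, 0 < p → Summable fun n : ℕ => approxNumber T (n + 1) ^ p := by
  lift q to ℕ → ℕ+ using fun j => two_pos.trans_le (hq j)
  obtain ⟨M, -, hM⟩ := exists_norm_orbit_sub_taylorOrbit_le hind ha hsum hκ 0
  obtain ⟨T, hT, -⟩ := exists_clm_of_summable_norm_sq (orbit q a c₁) (by
    simpa [taylorOrbit] using (hM 0).1)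
  refine ⟨T, fun x s hs => ?_, fun p hp => ?_⟩
  · obtain ⟨ev, hev, hevn⟩ := exists_evaluation hs
    have h := (hT x).mapL ev
    simp only [map_smul, evaluation_orbit hsum hevn, smul_eq_mul] at h
    rw [← hev, ← h.tsum_eq]
    rfl
  · obtain ⟨D, hD⟩ := exists_nat_gt (1 / p)
    obtain ⟨M, hM0, hM⟩ := exists_approxNumber_le hind ha hsum hκ hT D
    have hDp : 1 < D * p := (div_lt_iff₀ hp).1 hD
    have hS : Summable fun n : ℕ => M ^ p * (1 / ((n + 1 : ℕ) : ℝ) ^ (D * p)) :=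
      ((summable_nat_add_iff 1).2 (Real.summable_one_div_nat_rpow.2 hDp)).mul_left _
    refine hS.of_nonneg_of_le (fun n => Real.rpow_nonneg (approxNumber_nonneg _ _) _) fun n => ?_
    refine (Real.rpow_le_rpow (approxNumber_nonneg _ _) (hM n) hp.le).trans_eq ?_
    rw [Real.div_rpow hM0 (by positivity), ← Real.rpow_natCast, ← Real.rpow_mul (by positivity)]
    push_cast
    ring
end
end
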